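/- A simple graph G is 4-arc connected if and only if G is a chain graph such that: (1) every link is 2-connected and its realization is 4-arc connected; (2) every interior link (a link that meets two other links) is a single edge; and (3) whenever v is a cut vertex of G and L is a link of G with v ∈ L, the degree of v in L is at most 2. -/

import Mathlib

open Topology

noncomputable section

variable {V : Type*}

open Classical in
/-- The Dirac function marking a vertex: the point of `|G|` corresponding to vertex `v`. -/
noncomputable def vertexPoint (v : V) : V → ℝ := fun u => if u = v then 1 else 0

open Classical in
/-- The point of `|G|` lying on the edge `vw` at parameter `t` (measured from `v` towards `w`). -/
noncomputable def edgePoint (v w : V) (t : ℝ) : V → ℝ :=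
  fun u => (if u = v then 1 - t else 0) + (if u = w then t else 0)

/-- The geometric realization `|G|` of a simple graph `G`, realized as the set of
formal convex combinations of adjacent pairs of vertices; each closed edge carries
its usual topology as a copy of `[0,1]`. -/
def GraphRealization (G : SimpleGraph V) : Set (V → ℝ) :=
  {x | (∃ v, x = vertexPoint v) ∨
    ∃ v w t, G.Adj v w ∧ t ∈ Set.Icc (0 : ℝ) 1 ∧ x = edgePoint v w t}

/-- A subset of a topological space is an arc if it is homeomorphic to `[0,1]`. -/
def IsArc {X : Type*} [TopologicalSpace X] (A : Set X) : Prop :=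
  Nonempty (↥A ≃ₜ ↥unitInterval)

/-- A space is `n`-arc connected if any at most `n` points lie on a common arc. -/
def NArcConn (X : Type*) [TopologicalSpace X] (n : ℕ) : Prop :=
  ∀ S : Finset X, S.card ≤ n → ∃ A : Set X, IsArc A ∧ ↑S ⊆ A

/-- The unit circle in the plane. -/
def unitCircleSet : Set (ℝ × ℝ) := {p | p.1 ^ 2 + p.2 ^ 2 = 1}

/-- A subset of a topological space is a simple closed curve if homeomorphic to the circle. -/
def IsSimpleClosedCurve {X : Type*} [TopologicalSpace X] (C : Set X) : Prop :=
  Nonempty (↥C ≃ₜ ↥unitCircleSet)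

/-- A space is `n`-circle connected if any at most `n` points lie on a common
simple closed curve. -/
def NCircleConn (X : Type*) [TopologicalSpace X] (n : ℕ) : Prop :=
  ∀ S : Finset X, S.card ≤ n → ∃ C : Set X, IsSimpleClosedCurve C ∧ ↑S ⊆ C

/-- A space is `n`-strongly arc connected if any list of at most `n` points is contained
in an arc, the points appearing along the arc in the listed order. -/
def NStrongArcConn (X : Type*) [TopologicalSpace X] (n : ℕ) : Prop :=
  ∀ l : List X, l.length ≤ n →
    ∃ f : ↥unitInterval → X, Topology.IsEmbedding f ∧
      ∃ t : Fin l.length → ↥unitInterval, Monotone t ∧ ∀ i, f (t i) = l.get i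

/-- A graph is `k`-connected if removing fewer than `k` vertices leaves it connected. -/
def KConnected (G : SimpleGraph V) (k : ℕ) : Prop :=
  ∀ S : Set V, S.encard < (k : ℕ∞) → (G.induce (Sᶜ : Set V)).Connected

/-- A graph is cyclically connected if any two vertices lie on a common cycle. -/
def CyclicallyConnected (G : SimpleGraph V) : Prop :=
  ∀ v w : V, ∃ (u : V) (c : G.Walk u u), c.IsCycle ∧ v ∈ c.support ∧ w ∈ c.support

/-- The circle of radius `r` centered at `c` in the plane. -/
def circleAt (c : ℝ × ℝ) (r : ℝ) : Set (ℝ × ℝ) :=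
  {p | (p.1 - c.1) ^ 2 + (p.2 - c.2) ^ 2 = r ^ 2}

/-- The horizontal segment at height `y` from abscissa `a` to `b`. -/
def hSeg (y a b : ℝ) : Set (ℝ × ℝ) := {p | p.2 = y ∧ a ≤ p.1 ∧ p.1 ≤ b}

/-- The θ-curve: unit circle together with horizontal diameter. -/
def thetaSet : Set (ℝ × ℝ) := circleAt (0, 0) 1 ∪ hSeg 0 (-1) 1

/-- Figure-eight: two unit circles meeting at the origin. -/
def figureEightSet : Set (ℝ × ℝ) := circleAt (-1, 0) 1 ∪ circleAt (1, 0) 1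

/-- Lollipop: unit circle with the segment from `(1,0)` to `(2,0)` attached. -/
def lollipopSet : Set (ℝ × ℝ) := circleAt (0, 0) 1 ∪ hSeg 0 1 2

/-- Lollipop with its free endpoint removed. -/
def openLollipopSet : Set (ℝ × ℝ) := lollipopSet \ {(2, 0)}

/-- Dumbbell: two disjoint unit circles joined by a segment. -/
def dumbbellSet : Set (ℝ × ℝ) := circleAt (-2, 0) 1 ∪ circleAt (2, 0) 1 ∪ hSeg 0 (-1) 1

/-- Happy-face curve: two circles meeting at a point, joined by a further arc. -/
def happyFaceSet : Set (ℝ × ℝ) :=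
  circleAt (-1, 0) 1 ∪ circleAt (1, 0) 1 ∪ {p | p.1 ^ 2 + p.2 ^ 2 = 4 ∧ p.2 ≤ 0}

/-- Baguette curve: two disjoint circles joined by two disjoint arcs. -/
def baguetteSet : Set (ℝ × ℝ) :=
  circleAt (-3, 0) 1 ∪ circleAt (3, 0) 1 ∪ hSeg 0 (-2) 2 ∪ hSeg 1 (-3) 3

/-- A graph is a basic 4-ac graph iff its realization is homeomorphic to a circle,
a θ-curve, a happy-face curve or a baguette curve (this captures precisely the
subdivisions of those four graphs). -/
def IsBasicFourAC {W : Type*} (H : SimpleGraph W) : Prop :=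
  Nonempty (↥(GraphRealization H) ≃ₜ ↥unitCircleSet) ∨
  Nonempty (↥(GraphRealization H) ≃ₜ ↥thetaSet) ∨
  Nonempty (↥(GraphRealization H) ≃ₜ ↥happyFaceSet) ∨
  Nonempty (↥(GraphRealization H) ≃ₜ ↥baguetteSet)

/-- A chain-graph decomposition of the connected graph `G`: links indexed by an
interval `J` of `ℤ`, non-consecutive links are disjoint, consecutive links share
exactly one vertex. -/
structure IsChainGraph (G : SimpleGraph V) (J : Set ℤ) (L : ℤ → G.Subgraph) : Prop where
  connected : G.Connected
  ordConnected : J.OrdConnected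
  nonempty : J.Nonempty
  cover : (⨆ i ∈ J, L i) = (⊤ : G.Subgraph)
  sep : ∀ i ∈ J, ∀ j ∈ J, i + 1 < j → (L i).verts ∩ (L j).verts = ∅
  link : ∀ i ∈ J, i + 1 ∈ J → ∃ v, (L i).verts ∩ (L (i + 1)).verts = {v}

/-- A cut-vertex: a vertex whose removal disconnects the graph. -/
def IsCutVertex (G : SimpleGraph V) (v : V) : Prop :=
  ¬ (G.induce ({v}ᶜ : Set V)).Connected

/-- A block: a maximal 2-connected subgraph. -/
def IsBlock (G : SimpleGraph V) (H : G.Subgraph) : Prop :=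
  KConnected H.coe 2 ∧ ∀ H' : G.Subgraph, H ≤ H' → KConnected H'.coe 2 → H' = H

/-- The block graph of `G`: the bipartite graph on cut-vertices and blocks, a cut-vertex
being adjacent to the blocks containing it. -/
def BlockGraph (G : SimpleGraph V) :
    SimpleGraph ({v : V // IsCutVertex G v} ⊕ {H : G.Subgraph // IsBlock G H}) :=
  SimpleGraph.fromRel fun a b =>
    ∃ (c : {v : V // IsCutVertex G v}) (B : {H : G.Subgraph // IsBlock G H}),
      a = Sum.inl c ∧ b = Sum.inr B ∧ (c : V) ∈ (B : G.Subgraph).verts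

/-- An `A`–`B` path: a path starting in `A`, ending in `B` and meeting `A ∪ B` only
in these two endvertices. -/
structure ABPath (G : SimpleGraph V) (A B : Set V) where
  first : V
  last : V
  walk : G.Walk first last
  isPath : walk.IsPath
  firstA : first ∈ A
  lastB : last ∈ B
  meetA : ∀ v ∈ walk.support, v ∈ A → v = first
  meetB : ∀ v ∈ walk.support, v ∈ B → v = last

/-- A family of pairwise vertex-disjoint paths. -/
def PathFamilyDisjoint {G : SimpleGraph V} {A B : Set V} {k : ℕ}
    (P : Fin k → ABPath G A B) : Prop :=
  ∀ i j, i ≠ j → ∀ v, v ∈ (P i).walk.support → v ∉ (P j).walk.support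

/-- The set of vertices used by a family of paths. -/
def familySupport {G : SimpleGraph V} {A B : Set V} {k : ℕ}
    (P : Fin k → ABPath G A B) : Set V :=
  {v | ∃ i, v ∈ (P i).walk.support}

/-- The set of edges used by a family of paths. -/
def familyEdges {G : SimpleGraph V} {A B : Set V} {k : ℕ}
    (P : Fin k → ABPath G A B) : Set (Sym2 V) :=
  {e | ∃ i, e ∈ (P i).walk.edges}

/-- A walk `W` (with no repeated edges) is alternating with respect to the disjoint
path family `P`: it starts in `A` off the paths; repeated vertices lie on paths of the
family; upon hitting a path by a new edge it follows that path backwards for at least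
one edge; and it traverses edges of paths of the family only backwards. -/
structure IsAlternatingWalk {G : SimpleGraph V} {A B : Set V} {k : ℕ}
    (P : Fin k → ABPath G A B) {x y : V} (W : G.Walk x y) : Prop where
  trail : W.IsTrail
  startA : x ∈ A
  startOff : x ∉ familySupport P
  repeats : ∀ v, List.Duplicate v W.support → v ∈ familySupport P
  follows : ∀ (i : ℕ) (hi : i < W.darts.length) (j : Fin k),
      (W.darts.get ⟨i, hi⟩).snd ∈ (P j).walk.support →
      (W.darts.get ⟨i, hi⟩).edge ∉ (P j).walk.edges →
      ∃ h : i + 1 < W.darts.length, (W.darts.get ⟨i + 1, h⟩).symm ∈ (P j).walk.darts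
  backward : ∀ d ∈ W.darts, ∀ j : Fin k,
      d.edge ∈ (P j).walk.edges → d.symm ∈ (P j).walk.darts

end

section Arcs

open Set Topology

/-- `A` is a (possibly degenerate) arc with endpoints `a` and `b`. -/
def ArcFromTo {X : Type*} [TopologicalSpace X] (a b : X) (A : Set X) : Prop :=
  ∃ (f : ℝ → X) (s t : ℝ), s ≤ t ∧ ContinuousOn f (Icc s t) ∧ InjOn f (Icc s t) ∧
    f s = a ∧ f t = b ∧ f '' Icc s t = A

namespace ArcFromTo

variable {X : Type*} [TopologicalSpace X] {a b c x y : X} {A B C : Set X}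

theorem refl (a : X) : ArcFromTo a a {a} :=
  ⟨fun _ => a, 0, 0, le_rfl, continuousOn_const, by simp, rfl, rfl, by simp⟩

theorem left_mem (h : ArcFromTo a b A) : a ∈ A := by
  obtain ⟨f, s, t, hst, -, -, rfl, -, rfl⟩ := h
  exact mem_image_of_mem f (left_mem_Icc.2 hst)

theorem right_mem (h : ArcFromTo a b A) : b ∈ A := by
  obtain ⟨f, s, t, hst, -, -, -, rfl, rfl⟩ := h
  exact mem_image_of_mem f (right_mem_Icc.2 hst)

theorem symm (h : ArcFromTo a b A) : ArcFromTo b a A := by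
  obtain ⟨f, s, t, hst, hc, hi, rfl, rfl, rfl⟩ := h
  have hm : MapsTo (fun r : ℝ => -r) (Icc (-t) (-s)) (Icc s t) := fun r hr => by
    simp only [mem_Icc] at hr ⊢; constructor <;> linarith
  refine ⟨fun r => f (-r), -t, -s, by linarith, hc.comp continuous_neg.continuousOn hm,
    fun r hr r' hr' h => neg_injective (hi (hm hr) (hm hr') h), by simp, by simp, ?_⟩
  rw [← image_image f (fun r : ℝ => -r)]
  simp

theorem isPreconnected (h : ArcFromTo a b A) : IsPreconnected A := by
  obtain ⟨f, s, t, hst, hc, hi, rfl, rfl, rfl⟩ := h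
  exact isPreconnected_Icc.image f hc

theorem isClosed [T2Space X] (h : ArcFromTo a b A) : IsClosed A := by
  obtain ⟨f, s, t, hst, hc, hi, rfl, rfl, rfl⟩ := h
  exact (isCompact_Icc.image_of_continuousOn hc).isClosed

theorem concat (h₁ : ArcFromTo a b A) (h₂ : ArcFromTo b c B) (h : A ∩ B ⊆ {b}) :
    ArcFromTo a c (A ∪ B) := by
  obtain ⟨f, s, t, hst, hc, hi, rfl, hb, rfl⟩ := h₁
  obtain ⟨g, s', t', hst', hc', hi', hb', rfl, rfl⟩ := h₂
  have hm : MapsTo (fun r : ℝ => r - t + s') (Icc t (t + (t' - s'))) (Icc s' t') := fun r hr => by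
    simp only [mem_Icc] at hr ⊢; constructor <;> linarith
  set k : ℝ → X := fun r => g (r - t + s') with hk
  have hkt : k t = b := by simp [hk, hb']
  have hkc : ContinuousOn k (Icc t (t + (t' - s'))) := hc'.comp (by fun_prop) hm
  have hki : InjOn k (Icc t (t + (t' - s'))) := fun r hr r' hr' h => by
    have := hi' (hm hr) (hm hr') h
    simpa using this
  have hkim : k '' Icc t (t + (t' - s')) = g '' Icc s' t' := by
    refine Subset.antisymm (by rintro _ ⟨r, hr, rfl⟩; exact ⟨_, hm hr, rfl⟩) ?_
    rintro _ ⟨r, hr, rfl⟩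
    refine ⟨r - s' + t, ?_, by simp [hk]⟩
    simp only [mem_Icc] at hr ⊢; constructor <;> linarith
  rw [← hkim] at h ⊢
  have hu : Icc s (t + (t' - s')) = Icc s t ∪ Icc t (t + (t' - s')) :=
    (Icc_union_Icc_eq_Icc hst (by linarith)).symm
  set q : ℝ → X := fun r => if r ≤ t then f r else k r with hq
  have q1 : EqOn q f (Icc s t) := fun r hr => by simp [hq, hr.2]
  have q2 : EqOn q k (Icc t (t + (t' - s'))) := fun r hr => by
    rcases hr.1.eq_or_lt with rfl | h'
    · simp [hq, hb, hkt]
    · simp [hq, not_le.2 h']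
  refine ⟨q, s, t + (t' - s'), by linarith, ?_, ?_, ?_, ?_, ?_⟩
  · rw [hu]
    exact (hc.congr q1).union_of_isClosed (hkc.congr q2) isClosed_Icc isClosed_Icc
  · have key : ∀ r ∈ Icc s t, ∀ r' ∈ Icc t (t + (t' - s')), f r = k r' → r = r' := by
      intro r hr r' hr' e
      have : f r ∈ ({b} : Set X) := h ⟨⟨r, hr, rfl⟩, ⟨r', hr', e.symm⟩⟩
      have h1 : r = t := hi hr (right_mem_Icc.2 hst) (by rw [hb]; exact this)
      have h2 : r' = t := hki hr' (left_mem_Icc.2 (by linarith)) (by rw [hkt, ← e]; exact this)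
      rw [h1, h2]
    rw [hu]
    rintro r (hr | hr) r' (hr' | hr') e
    · rw [q1 hr, q1 hr'] at e; exact hi hr hr' e
    · rw [q1 hr, q2 hr'] at e; exact key r hr r' hr' e
    · rw [q2 hr, q1 hr'] at e; exact (key r' hr' r hr e.symm).symm
    · rw [q2 hr, q2 hr'] at e; exact hki hr hr' e
  · exact q1 (left_mem_Icc.2 hst)
  · rw [q2 (right_mem_Icc.2 (by linarith))]; simp [hk]
  · rw [hu, image_union, q1.image_eq, q2.image_eq]

theorem split (h : ArcFromTo a b A) (hx : x ∈ A) :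
    ∃ A₁ A₂, ArcFromTo a x A₁ ∧ ArcFromTo x b A₂ ∧ A = A₁ ∪ A₂ ∧ A₁ ∩ A₂ = {x} := by
  obtain ⟨f, s, t, hst, hc, hi, rfl, rfl, rfl⟩ := h
  obtain ⟨r, hr, rfl⟩ := hx
  have h1 : Icc s r ⊆ Icc s t := Icc_subset_Icc_right hr.2
  have h2 : Icc r t ⊆ Icc s t := Icc_subset_Icc_left hr.1
  refine ⟨f '' Icc s r, f '' Icc r t, ⟨f, s, r, hr.1, hc.mono h1, hi.mono h1, rfl, rfl, rfl⟩,
    ⟨f, r, t, hr.2, hc.mono h2, hi.mono h2, rfl, rfl, rfl⟩, ?_, ?_⟩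
  · rw [← image_union, Icc_union_Icc_eq_Icc hr.1 hr.2]
  · rw [← hi.image_inter h1 h2, Icc_inter_Icc_eq_singleton hr.1 hr.2, image_singleton]

theorem exists_first_hit (h : ArcFromTo a b A) (hC : IsClosed C) (hne : (A ∩ C).Nonempty) :
    ∃ p D E, ArcFromTo a p D ∧ ArcFromTo p b E ∧ A = D ∪ E ∧ D ∩ E = {p} ∧ D ∩ C = {p} := by
  obtain ⟨f, s, t, hst, hc, hi, rfl, rfl, rfl⟩ := h
  obtain ⟨_, ⟨r, hr, rfl⟩, hrC⟩ := hne
  have hcl : IsCompact (Icc s t ∩ f ⁻¹' C) :=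
    isCompact_Icc.of_isClosed_subset (hc.preimage_isClosed_of_isClosed isClosed_Icc hC)
      inter_subset_left
  obtain ⟨m, ⟨hm, hmC⟩, hmin⟩ := hcl.exists_isLeast ⟨r, hr, hrC⟩
  have h1 : Icc s m ⊆ Icc s t := Icc_subset_Icc_right hm.2
  have h2 : Icc m t ⊆ Icc s t := Icc_subset_Icc_left hm.1
  refine ⟨f m, f '' Icc s m, f '' Icc m t,
    ⟨f, s, m, hm.1, hc.mono h1, hi.mono h1, rfl, rfl, rfl⟩,
    ⟨f, m, t, hm.2, hc.mono h2, hi.mono h2, rfl, rfl, rfl⟩, ?_, ?_, ?_⟩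
  · rw [← image_union, Icc_union_Icc_eq_Icc hm.1 hm.2]
  · rw [← hi.image_inter h1 h2, Icc_inter_Icc_eq_singleton hm.1 hm.2, image_singleton]
  apply Subset.antisymm
  · rintro _ ⟨⟨q, hq, rfl⟩, hqC⟩
    have := hmin ⟨h1 hq, hqC⟩
    rw [le_antisymm hq.2 this]; rfl
  · rintro _ rfl
    exact ⟨⟨m, right_mem_Icc.2 hm.1, rfl⟩, hmC⟩

theorem image {Y : Type*} [TopologicalSpace Y] {g : X → Y} (h : ArcFromTo a b A)
    (hg : Continuous g) (hinj : Function.Injective g) : ArcFromTo (g a) (g b) (g '' A) := by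
  obtain ⟨f, s, t, hst, hc, hi, rfl, rfl, rfl⟩ := h
  exact ⟨g ∘ f, s, t, hst, hg.comp_continuousOn hc, hinj.comp_injOn hi, rfl, rfl,
    image_comp g f _⟩

theorem preimage {Y : Type*} [TopologicalSpace Y] {g : Y → X} (h : ArcFromTo a b A)
    (hg : IsEmbedding g) (hA : A ⊆ range g) :
    ∃ a' b', g a' = a ∧ g b' = b ∧ ArcFromTo a' b' (g ⁻¹' A) := by
  obtain ⟨f, s, t, hst, hc, hi, rfl, rfl, rfl⟩ := h
  have hex : ∀ r : ℝ, ∃ y : Y, r ∈ Icc s t → g y = f r := by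
    intro r
    by_cases hr : r ∈ Icc s t
    · obtain ⟨y, hy⟩ := hA ⟨r, hr, rfl⟩
      exact ⟨y, fun _ => hy⟩
    · obtain ⟨y, -⟩ := hA ⟨s, left_mem_Icc.2 hst, rfl⟩
      exact ⟨y, fun h => absurd h hr⟩
  choose k hk using hex
  refine ⟨k s, k t, hk s (left_mem_Icc.2 hst), hk t (right_mem_Icc.2 hst), k, s, t, hst,
    ?_, ?_, rfl, rfl, ?_⟩
  · rw [hg.continuousOn_iff]
    exact hc.congr fun r hr => hk r hr
  · intro r hr r' hr' e
    exact hi hr hr' (by rw [← hk r hr, ← hk r' hr', e])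
  · ext y
    constructor
    · rintro ⟨r, hr, rfl⟩
      exact ⟨r, hr, (hk r hr).symm⟩
    · rintro ⟨r, hr, e⟩
      exact ⟨r, hr, hg.injective (by rw [hk r hr, e])⟩

theorem isArc [T2Space X] (h : ArcFromTo a b A) (hab : a ≠ b) : IsArc A := by
  obtain ⟨f, s, t, hst, hc, hi, rfl, rfl, rfl⟩ := h
  have hlt : s < t := lt_of_le_of_ne hst (fun e => hab (by rw [e]))
  let e₁ : Icc s t ≃ₜ f '' Icc s t :=
    Continuous.homeoOfEquivCompactToT2 (f := Equiv.Set.imageOfInjOn f _ hi)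
      (Continuous.subtype_mk hc.domRestrict _)
  exact ⟨e₁.symm.trans (iccHomeoI s t hlt)⟩

theorem exists_of_isArc (h : IsArc A) : ∃ a b, a ≠ b ∧ ArcFromTo a b A := by
  obtain ⟨e⟩ := h
  have hc : Continuous fun t : unitInterval => (e.symm t : X) :=
    continuous_subtype_val.comp e.symm.continuous
  have hi : Function.Injective fun t : unitInterval => (e.symm t : X) :=
    Subtype.val_injective.comp e.symm.injective
  refine ⟨e.symm 0, e.symm 1, fun h => zero_ne_one (hi h),
    fun r => e.symm (projIcc 0 1 zero_le_one r), 0, 1, zero_le_one,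
    (hc.comp continuous_projIcc).continuousOn, ?_, ?_, ?_, ?_⟩
  · intro r hr r' hr' h
    have := hi h
    rw [projIcc_of_mem _ hr, projIcc_of_mem _ hr'] at this
    simpa using this
  · simp
  · simp
  · ext z
    constructor
    · rintro ⟨r, hr, rfl⟩; exact (e.symm _).2
    · intro hz
      refine ⟨e ⟨z, hz⟩, (e ⟨z, hz⟩).2, ?_⟩
      simp

/-- Among more than `C.card + 1` points of an arc outside the finite set `C`, some two are joined
by a subarc avoiding `C`. -/
theorem exists_subarc_disjoint (h : ArcFromTo a b A) (C : Finset X) {n : ℕ} (p : Fin n → X)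
    (hpA : ∀ i, p i ∈ A) (hpC : ∀ i, p i ∉ C) (hn : C.card + 1 < n) :
    ∃ i j D, i ≠ j ∧ ArcFromTo (p i) (p j) D ∧ D ⊆ A ∧ ∀ c ∈ C, c ∉ D := by
  classical
  obtain ⟨f, s, t, hst, hc, hi, rfl, rfl, rfl⟩ := h
  choose r hr hrp using hpA
  let F : Fin n → Finset X := fun i => C.filter fun c => c ∈ f '' Icc s (r i)
  let φ : Fin n → Fin (C.card + 1) := fun i =>
    ⟨(F i).card, Nat.lt_succ_of_le (Finset.card_filter_le _ _)⟩
  obtain ⟨i, j, hij, he⟩ := Fintype.exists_ne_map_eq_of_card_lt φ (by simpa using hn)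
  have he' : (F i).card = (F j).card := congrArg Fin.val he
  have main : ∀ i j, i ≠ j → r i ≤ r j → (F i).card = (F j).card →
      ∃ D, ArcFromTo (p i) (p j) D ∧ D ⊆ f '' Icc s t ∧ ∀ c ∈ C, c ∉ D := by
    intro i j hij hle hcard
    have hsub : Icc (r i) (r j) ⊆ Icc s t := Icc_subset_Icc (hr i).1 (hr j).2
    have hFF : F i = F j := by
      apply Finset.eq_of_subset_of_card_le _ hcard.ge
      apply Finset.monotone_filter_right
      intro c _ hcc
      exact image_mono (Icc_subset_Icc_right hle) hcc
    refine ⟨f '' Icc (r i) (r j), ⟨f, _, _, hle, hc.mono hsub, hi.mono hsub, hrp i, hrp j, rfl⟩,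
      image_mono hsub, ?_⟩
    rintro _ hcC ⟨q, hq, rfl⟩
    have : f q ∈ F j := Finset.mem_filter.2 ⟨hcC, q, ⟨(hr i).1.trans hq.1, hq.2⟩, rfl⟩
    rw [← hFF] at this
    obtain ⟨-, q', hq', e⟩ := Finset.mem_filter.1 this
    have := hi ⟨hq'.1, hq'.2.trans (hr i).2⟩ (hsub hq) e
    have : q = r i := le_antisymm (this ▸ hq'.2) hq.1
    exact hpC i (by rw [← hrp i, ← this]; exact hcC)
  rcases le_total (r i) (r j) with hle | hle
  · obtain ⟨D, h1, h2, h3⟩ := main i j hij hle he'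
    exact ⟨i, j, D, hij, h1, h2, h3⟩
  · obtain ⟨D, h1, h2, h3⟩ := main j i hij.symm hle he'.symm
    exact ⟨j, i, D, hij.symm, h1, h2, h3⟩

theorem exists_trans [T2Space X] (h₁ : ArcFromTo a b A) (h₂ : ArcFromTo b c B) :
    ∃ D, ArcFromTo a c D ∧ D ⊆ A ∪ B := by
  obtain ⟨p, D, E, hD, -, rfl, -, hDB⟩ :=
    h₁.exists_first_hit h₂.isClosed ⟨b, h₁.right_mem, h₂.left_mem⟩
  have hp : p ∈ B := (hDB.ge rfl).2
  obtain ⟨B₁, B₂, -, hB₂, rfl, -⟩ := h₂.split hp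
  refine ⟨D ∪ B₂, hD.concat hB₂ ?_, ?_⟩
  · rw [← hDB]
    exact inter_subset_inter_right D subset_union_right
  · exact union_subset_union subset_union_left subset_union_right

end ArcFromTo

theorem nArcConn_iff {X : Type*} [TopologicalSpace X] [T2Space X] {n : ℕ} :
    NArcConn X n ↔ ∀ S : Finset X, S.card ≤ n → ∃ a b A, a ≠ b ∧ ArcFromTo a b A ∧ (S : Set X) ⊆ A := by
  refine forall₂_congr fun S _ => ⟨?_, ?_⟩
  · rintro ⟨A, hA, hS⟩
    obtain ⟨a, b, hab, h⟩ := ArcFromTo.exists_of_isArc hA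
    exact ⟨a, b, A, hab, h, hS⟩
  · rintro ⟨a, b, A, hab, h, hS⟩
    exact ⟨A, h.isArc hab, hS⟩

end Arcs

section TwoConnectedSpaces

open Set Topology

/-- An arc whose interior is open in the ambient space. -/
def IsSegment {X : Type*} [TopologicalSpace X] (y z : X) (σ : Set X) : Prop :=
  ArcFromTo y z σ ∧ IsOpen (σ \ {y, z})

/-- After removing any point, any two remaining points are joined by a chain of segments. -/
def SegmentTwoConnected (X : Type*) [TopologicalSpace X] : Prop :=
  ∀ p a b : X, a ≠ p → b ≠ p →
    Relation.ReflTransGen (fun y z => ∃ σ, IsSegment y z σ ∧ p ∉ σ) a b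

/-- Two arcs from `x` to distinct points of `C`, disjoint apart from `x` and meeting `C` only in
their endpoints. -/
structure IsFan {X : Type*} [TopologicalSpace X] (C : Set X) (x c₁ c₂ : X) (F₁ F₂ : Set X) :
    Prop where
  ne : c₁ ≠ c₂
  arc₁ : ArcFromTo x c₁ F₁
  arc₂ : ArcFromTo x c₂ F₂
  inter : ∀ y ∈ F₁, y ∈ F₂ → y = x
  mem₁ : c₁ ∈ C
  mem₂ : c₂ ∈ C
  meet₁ : ∀ y ∈ F₁, y ∈ C → y = c₁
  meet₂ : ∀ y ∈ F₂, y ∈ C → y = c₂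

/-- `A` and `B` are two arcs from `a` to `b` forming a simple closed curve. -/
structure IsArcPair {X : Type*} [TopologicalSpace X] (a b : X) (A B : Set X) : Prop where
  ne : a ≠ b
  arc₁ : ArcFromTo a b A
  arc₂ : ArcFromTo a b B
  inter : ∀ y ∈ A, y ∈ B → y = a ∨ y = b

/-- Simple closed curves, seen as unions of two arcs with common endpoints. -/
def IsCycleSet {X : Type*} [TopologicalSpace X] (C : Set X) : Prop :=
  ∃ a b A B, IsArcPair a b A B ∧ C = A ∪ B

variable {X : Type*} [TopologicalSpace X]

namespace ArcFromTo

variable {a b c x : X} {A B C : Set X}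

theorem concat' (h₁ : ArcFromTo a b A) (h₂ : ArcFromTo b c B) (h : ∀ x ∈ A, x ∈ B → x = b) :
    ArcFromTo a c (A ∪ B) :=
  h₁.concat h₂ fun x hx => h x hx.1 hx.2

theorem split' (h : ArcFromTo a b A) (hx : x ∈ A) :
    ∃ A₁ A₂, ArcFromTo a x A₁ ∧ ArcFromTo x b A₂ ∧ A = A₁ ∪ A₂ ∧ ∀ y ∈ A₁, y ∈ A₂ → y = x := by
  obtain ⟨A₁, A₂, h1, h2, h3, h4⟩ := h.split hx
  exact ⟨A₁, A₂, h1, h2, h3, fun y hy hy' => h4.le ⟨hy, hy'⟩⟩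

theorem exists_first_hit' (h : ArcFromTo a b A) (hC : IsClosed C) (hx : x ∈ A) (hx' : x ∈ C) :
    ∃ p D, ArcFromTo a p D ∧ D ⊆ A ∧ p ∈ C ∧ ∀ y ∈ D, y ∈ C → y = p := by
  obtain ⟨p, D, E, h1, h2, h3, h4, h5⟩ := h.exists_first_hit hC ⟨x, hx, hx'⟩
  exact ⟨p, D, h1, h3 ▸ subset_union_left, (h5.ge rfl).2, fun y hy hy' => h5.le ⟨hy, hy'⟩⟩

end ArcFromTo

namespace IsArcPair

variable {a b c d : X} {A B : Set X}

theorem swap (h : IsArcPair a b A B) : IsArcPair a b B A :=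
  ⟨h.ne, h.arc₂, h.arc₁, fun y h1 h2 => h.inter y h2 h1⟩

theorem symm (h : IsArcPair a b A B) : IsArcPair b a A B :=
  ⟨h.ne.symm, h.arc₁.symm, h.arc₂.symm, fun y h1 h2 => (h.inter y h1 h2).symm⟩

theorem rebase_right (h : IsArcPair a b A B) (hc : c ∈ A ∪ B) (hca : c ≠ a) :
    ∃ A' B', IsArcPair a c A' B' ∧ A ∪ B = A' ∪ B' := by
  wlog hcA : c ∈ A generalizing A B
  · obtain ⟨A', B', h1, h2⟩ := this h.swap hc.symm (hc.resolve_left hcA)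
    exact ⟨A', B', h1, by rw [← h2, union_comm]⟩
  obtain ⟨D, E, h1, h2, rfl, h4⟩ := h.arc₁.split' hcA
  obtain ⟨hne, -, a2, hi⟩ := h
  have := h1.left_mem
  have := a2.left_mem
  have := h2.left_mem
  have := h2.right_mem
  refine ⟨D, B ∪ E, ⟨hca.symm, h1, a2.concat' h2.symm ?_, ?_⟩, ?_⟩
  · simp only [mem_union] at *; grind
  · simp only [mem_union] at *; grind
  · rw [union_assoc, union_comm E]

theorem rebase (h : IsArcPair a b A B) (hc : c ∈ A ∪ B) (hd : d ∈ A ∪ B) (hcd : c ≠ d) :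
    ∃ A' B', IsArcPair c d A' B' ∧ A ∪ B = A' ∪ B' := by
  by_cases hca : c = a
  · subst hca
    exact h.rebase_right hd hcd.symm
  · obtain ⟨A', B', h1, h2⟩ := h.rebase_right hc hca
    rw [h2] at hd ⊢
    exact h1.symm.rebase_right hd hcd.symm

end IsArcPair

theorem IsCycleSet.nontrivial {C : Set X} (hC : IsCycleSet C) : C.Nontrivial := by
  obtain ⟨a, b, A, B, h, rfl⟩ := hC
  exact ⟨a, Or.inl h.arc₁.left_mem, b, Or.inl h.arc₁.right_mem, h.ne⟩

namespace IsCycleSet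

variable {c d x y z : X} {C : Set X}

theorem exists_arcPair (hC : IsCycleSet C) (hc : c ∈ C) (hd : d ∈ C) (hcd : c ≠ d) :
    ∃ A B, IsArcPair c d A B ∧ C = A ∪ B := by
  obtain ⟨a, b, A, B, h, rfl⟩ := hC
  exact h.rebase hc hd hcd

theorem exists_arc_from_two (hC : IsCycleSet C) (hd : d ∈ C) (hx : x ∈ C) (hy : y ∈ C) :
    ∃ e A, ArcFromTo d e A ∧ A ⊆ C ∧ x ∈ A ∧ y ∈ A := by
  wlog hxd : x ≠ d generalizing x y
  · rw [not_not] at hxd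
    subst hxd
    by_cases hxy : y = x
    · subst hxy
      exact ⟨y, {y}, ArcFromTo.refl y, by simpa using hx, rfl, rfl⟩
    · obtain ⟨e, A, h1, h2, h3, h4⟩ := this hy hx hxy
      exact ⟨e, A, h1, h2, h4, h3⟩
  obtain ⟨A, B, h, rfl⟩ := hC.exists_arcPair hd hx hxd.symm
  rcases hy with hy | hy
  · exact ⟨x, A, h.arc₁, subset_union_left, h.arc₁.right_mem, hy⟩
  · exact ⟨x, B, h.arc₂, subset_union_right, h.arc₂.right_mem, hy⟩

theorem exists_arc_from (hC : IsCycleSet C) (hd : d ∈ C) (hx : x ∈ C) (hy : y ∈ C) (hz : z ∈ C) :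
    ∃ e A, ArcFromTo d e A ∧ A ⊆ C ∧ x ∈ A ∧ y ∈ A ∧ z ∈ A := by
  by_cases hxd : x = d
  · subst hxd
    obtain ⟨e, A, h1, h2, h3, h4⟩ := hC.exists_arc_from_two hd hy hz
    exact ⟨e, A, h1, h2, h1.left_mem, h3, h4⟩
  by_cases hyd : y = d
  · subst hyd
    obtain ⟨e, A, h1, h2, h3, h4⟩ := hC.exists_arc_from_two hd hx hz
    exact ⟨e, A, h1, h2, h3, h1.left_mem, h4⟩
  by_cases hzd : z = d
  · subst hzd
    obtain ⟨e, A, h1, h2, h3, h4⟩ := hC.exists_arc_from_two hd hx hy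
    exact ⟨e, A, h1, h2, h3, h4, h1.left_mem⟩
  obtain ⟨A, B, h, rfl⟩ := hC.exists_arcPair hd hx (Ne.symm hxd)
  have main : ∀ {A B : Set X} {y z : X}, IsArcPair d x A B → z ≠ d → y ∈ A → z ∈ B →
      ∃ e D, ArcFromTo d e D ∧ D ⊆ A ∪ B ∧ x ∈ D ∧ y ∈ D ∧ z ∈ D := by
    intro A B y z h hzd hy hz
    obtain ⟨D, E, h1, h2, rfl, h4⟩ := h.arc₂.split' hz
    obtain ⟨hne, a1, -, hi⟩ := h
    have := h1.left_mem
    have := h2.left_mem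
    refine ⟨z, A ∪ E, a1.concat' h2.symm ?_, ?_, Or.inl a1.right_mem, Or.inl hy, Or.inr this⟩
    · simp only [mem_union] at *; grind
    · exact union_subset_union_right _ subset_union_right
  rcases hy with hy | hy <;> rcases hz with hz | hz
  · exact ⟨x, A, h.arc₁, subset_union_left, h.arc₁.right_mem, hy, hz⟩
  · exact main h hzd hy hz
  · obtain ⟨e, D, h1, h2, h3, h4, h5⟩ := main h hyd hz hy
    exact ⟨e, D, h1, h2, h3, h5, h4⟩
  · exact ⟨x, B, h.arc₂, subset_union_right, h.arc₂.right_mem, hy, hz⟩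

end IsCycleSet

theorem IsSegment.symm {y z : X} {σ : Set X} (h : IsSegment y z σ) : IsSegment z y σ :=
  ⟨h.1.symm, by rw [pair_comm]; exact h.2⟩

theorem IsSegment.exists_subsegment [T2Space X] {y z w : X} {σ C : Set X} (h : IsSegment y z σ)
    (hC : IsClosed C) (hw : w ∈ σ) (hw' : w ∈ C) :
    ∃ p τ, IsSegment p z τ ∧ τ ⊆ σ ∧ p ∈ C ∧ ∀ x ∈ τ, x ∈ C → x = p := by
  obtain ⟨p, A₁, A₂, h1, h2, h3, h4, h5⟩ := h.1.symm.exists_first_hit hC ⟨w, hw, hw'⟩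
  refine ⟨p, A₁, ⟨h1.symm, ?_⟩, h3 ▸ subset_union_left, (h5.ge rfl).2,
    fun x hx hx' => h5.le ⟨hx, hx'⟩⟩
  have h4' : ∀ x ∈ A₁, x ∈ A₂ → x = p := fun x hx hx' => h4.le ⟨hx, hx'⟩
  convert h.2.sdiff h2.isClosed using 1
  have := h1.left_mem
  have := h1.right_mem
  have := h2.left_mem
  have := h2.right_mem
  ext x
  simp only [mem_sdiff, mem_insert_iff, mem_singleton_iff, h3, mem_union]
  grind

theorem IsSegment.eq_of_mem_arc [T2Space X] {y z h : X} {σ δ : Set X} (hσ : IsSegment y z σ)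
    (hδ : ArcFromTo z h δ) (hy : y ∉ δ) (hh : h ∉ σ) : ∀ w ∈ δ, w ∈ σ → w = z := by
  intro w hw hwσ
  by_contra hne
  obtain ⟨D, E, h1, h2, h3, h4⟩ := hδ.split' hw
  have hzE : z ∉ E := fun hz => hne (h4 z h1.left_mem hz).symm
  have hyE : y ∉ E := fun h => hy (h3 ▸ Or.inr h)
  have hwy : w ≠ y := fun e => hy (e ▸ hw)
  obtain ⟨u, -, hu, hu'⟩ := h2.isPreconnected (σ \ {y, z}) σᶜ hσ.2 hσ.1.isClosed.isOpen_compl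
    (fun u hu => by
      by_cases huσ : u ∈ σ
      · left
        refine ⟨huσ, ?_⟩
        rintro (rfl | rfl)
        · exact hyE hu
        · exact hzE hu
      · exact Or.inr huσ)
    ⟨w, h2.left_mem, hwσ, by simp [hwy, hne]⟩ ⟨h, h2.right_mem, hh⟩
  exact hu' hu.1

variable [T2Space X]

theorem SegmentTwoConnected.exists_arc (hX : SegmentTwoConnected X) {p a b : X} (ha : a ≠ p)
    (hb : b ≠ p) : ∃ A, ArcFromTo a b A ∧ p ∉ A := by
  induction hX p a b ha hb with
  | refl => exact ⟨{a}, ArcFromTo.refl a, fun h => ha h.symm⟩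
  | tail _ hs ih =>
    obtain ⟨σ, hσ, hpσ⟩ := hs
    obtain ⟨A, hA, hpA⟩ := ih fun e => hpσ (e ▸ hσ.1.left_mem)
    obtain ⟨D, hD, hDs⟩ := hA.exists_trans hσ.1
    exact ⟨D, hD, fun h => (hDs h).elim hpA hpσ⟩

theorem SegmentTwoConnected.fan_step (hX : SegmentTwoConnected X) {C : Set X} (hC : IsClosed C)
    (hCn : C.Nontrivial) {y z : X} {σ : Set X} (hσ : IsSegment y z σ)
    (hy : y ∈ C ∨ ∃ c₁ c₂ F₁ F₂, IsFan C y c₁ c₂ F₁ F₂) (hz : z ∉ C) :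
    ∃ c₁ c₂ F₁ F₂, IsFan C z c₁ c₂ F₁ F₂ := by
  by_cases hCσ : ∃ w ∈ σ, w ∈ C
  · obtain ⟨w, hwσ, hwC⟩ := hCσ
    obtain ⟨p, τ, hτ, -, hpC, hτC⟩ := hσ.exists_subsegment hC hwσ hwC
    have hpz : p ≠ z := fun e => hz (e ▸ hpC)
    obtain ⟨c, hcC, hcp⟩ := hCn.exists_ne p
    obtain ⟨δ, hδ, hpδ⟩ := hX.exists_arc hpz.symm hcp
    obtain ⟨c', δ', hδ', hδδ, hc', hδC⟩ := hδ.exists_first_hit' hC hδ.right_mem hcC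
    have hc'τ : c' ∉ τ := fun h => hpδ (hδδ ((hτC c' h hc') ▸ hδ'.right_mem))
    have := hτ.eq_of_mem_arc hδ' (fun h => hpδ (hδδ h)) hc'τ
    exact ⟨p, c', τ, δ', ⟨fun e => hc'τ (e ▸ hτ.1.left_mem), hτ.1.symm, hδ',
      fun u hu hu' => this u hu' hu, hpC, hc', hτC, hδC⟩⟩
  push Not at hCσ
  have hyC : y ∉ C := hCσ y hσ.1.left_mem
  obtain ⟨c₁, c₂, F₁, F₂, hF⟩ := hy.resolve_left hyC
  have through : ∀ {c₁ c₂ F₁ F₂}, IsFan C y c₁ c₂ F₁ F₂ → z ∈ F₁ →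
      ∃ c₁ c₂ F₁ F₂, IsFan C z c₁ c₂ F₁ F₂ := by
    intro c₁ c₂ F₁ F₂ hF hzF
    obtain ⟨D, E, h1, h2, rfl, h4⟩ := hF.arc₁.split' hzF
    obtain ⟨hne, -, a2, hi, m1, m2, e1, e2⟩ := hF
    have := h1.left_mem
    have := a2.left_mem
    have := h2.left_mem
    have := h2.right_mem
    refine ⟨c₁, c₂, E, D ∪ F₂, hne, h2, h1.symm.concat' a2 ?_, ?_, m1, m2, ?_, ?_⟩ <;>
      simp only [mem_union] at * <;> grind
  by_cases hz1 : z ∈ F₁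
  · exact through hF hz1
  by_cases hz2 : z ∈ F₂
  · exact through ⟨hF.ne.symm, hF.arc₂, hF.arc₁, fun u h h' => hF.inter u h' h, hF.mem₂, hF.mem₁,
      hF.meet₂, hF.meet₁⟩ hz2
  have i1 := hσ.symm.eq_of_mem_arc hF.arc₁ hz1 (fun h => hCσ _ h hF.mem₁)
  have i2 := hσ.symm.eq_of_mem_arc hF.arc₂ hz2 (fun h => hCσ _ h hF.mem₂)
  have hzy : z ≠ y := fun e => hz1 (e ▸ hF.arc₁.left_mem)
  have hc1y : c₁ ≠ y := fun e => hyC (e ▸ hF.mem₁)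
  obtain ⟨δ, hδ, hyδ⟩ := hX.exists_arc hzy hc1y
  obtain ⟨h, δ', hδ', hδδ, hh, hδC⟩ := hδ.exists_first_hit'
    ((hC.union hF.arc₁.isClosed).union hF.arc₂.isClosed) hδ.right_mem (Or.inl (Or.inl hF.mem₁))
  have hyδ' : y ∉ δ' := fun h => hyδ (hδδ h)
  have hhy : h ≠ y := fun e => hyδ' (e ▸ hδ'.right_mem)
  have hhσ : h ∉ σ := by
    intro hh'
    rcases hh with (hh | hh) | hh
    · exact hCσ h hh' hh
    · exact hhy (i1 h hh hh')
    · exact hhy (i2 h hh hh')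
  have i3 := hσ.eq_of_mem_arc hδ' hyδ' hhσ
  have land : ∀ {c₁ c₂ F₁ F₂}, IsFan C y c₁ c₂ F₁ F₂ → (∀ w ∈ F₁, w ∈ σ → w = y) →
      (∀ w ∈ F₂, w ∈ σ → w = y) → z ∉ F₁ → z ∉ F₂ →
      (∀ u ∈ δ', u ∈ C ∨ u ∈ F₁ ∨ u ∈ F₂ → u = h) → h ∈ F₁ →
      ∃ c₁ c₂ F₁ F₂, IsFan C z c₁ c₂ F₁ F₂ := by
    intro c₁ c₂ F₁ F₂ hF i1 i2 hz1 hz2 hδC hhF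
    obtain ⟨D, E, h1, h2, rfl, h4⟩ := hF.arc₁.split' hhF
    obtain ⟨hne, -, a2, hi, m1, m2, e1, e2⟩ := hF
    have := h1.left_mem
    have := a2.left_mem
    have := h2.left_mem
    have := h2.right_mem
    refine ⟨c₁, c₂, δ' ∪ E, σ ∪ F₂, hne, hδ'.concat' h2 ?_, hσ.1.symm.concat' a2 ?_, ?_, m1, m2,
      ?_, ?_⟩ <;> simp only [mem_union] at * <;> grind
  by_cases hh1 : h ∈ F₁
  · exact land hF i1 i2 hz1 hz2 (fun u hu hu' => hδC u hu (by simpa [or_assoc] using hu')) hh1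
  by_cases hh2 : h ∈ F₂
  · exact land ⟨hF.ne.symm, hF.arc₂, hF.arc₁, fun u h h' => hF.inter u h' h, hF.mem₂, hF.mem₁,
      hF.meet₂, hF.meet₁⟩ i2 i1 hz2 hz1
      (fun u hu hu' => hδC u hu (by simp only [mem_union]; tauto)) hh2
  have hhC : h ∈ C := by simpa [hh1, hh2] using hh
  obtain ⟨hne, a1, a2, hi, m1, m2, e1, e2⟩ := hF
  have := a1.left_mem
  have := a1.right_mem
  refine ⟨h, c₁, δ', σ ∪ F₁, ?_, hδ', hσ.1.symm.concat' a1 ?_, ?_, hhC, m1, ?_, ?_⟩ <;>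
      simp only [mem_union] at * <;> grind

theorem SegmentTwoConnected.exists_fan (hX : SegmentTwoConnected X) {C : Set X} (hC : IsClosed C)
    (hCn : C.Nontrivial) {x : X} (hx : x ∉ C) : ∃ c₁ c₂ F₁ F₂, IsFan C x c₁ c₂ F₁ F₂ := by
  obtain ⟨c, hc, d, hd, hcd⟩ := hCn
  have hxc : x ≠ d := fun e => hx (e ▸ hd)
  have key : x ∈ C ∨ ∃ c₁ c₂ F₁ F₂, IsFan C x c₁ c₂ F₁ F₂ := by
    induction hX d c x hcd hxc with
    | refl => exact Or.inl hc
    | @tail y z _ hs ih =>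
      obtain ⟨σ, hσ, hdσ⟩ := hs
      by_cases hz : z ∈ C
      · exact Or.inl hz
      · refine Or.inr (hX.fan_step hC ⟨c, hc, d, hd, hcd⟩ hσ ?_ hz)
        by_cases hy : y ∈ C
        · exact Or.inl hy
        · exact ih hy fun e => hdσ (e ▸ hσ.1.left_mem)
  exact key.resolve_left hx

namespace IsCycleSet

variable {a b c d x y z : X} {C : Set X}

theorem isClosed (hC : IsCycleSet C) : IsClosed C := by
  obtain ⟨a, b, A, B, h, rfl⟩ := hC
  exact h.arc₁.isClosed.union h.arc₂.isClosed

theorem exists_insert (hX : SegmentTwoConnected X) (hC : IsCycleSet C) (hy : y ∈ C) (x : X) :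
    ∃ D, IsCycleSet D ∧ x ∈ D ∧ y ∈ D := by
  by_cases hx : x ∈ C
  · exact ⟨C, hC, hx, hy⟩
  obtain ⟨c, d, F, E, hF⟩ := hX.exists_fan hC.isClosed hC.nontrivial hx
  obtain ⟨A, B, h, rfl⟩ := hC.exists_arcPair hF.mem₁ hF.mem₂ hF.ne
  have hFE : ArcFromTo c d (F ∪ E) := hF.arc₁.symm.concat' hF.arc₂ hF.inter
  have main : ∀ {A : Set X}, ArcFromTo c d A → (∀ y ∈ F, y ∈ A → y = c) →
      (∀ y ∈ E, y ∈ A → y = d) → IsCycleSet (F ∪ E ∪ A) := by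
    intro A hA h1 h2
    refine ⟨c, d, F ∪ E, A, ⟨hF.ne, hFE, hA, ?_⟩, rfl⟩
    simp only [mem_union] at *; grind
  have hx' := hF.arc₁.left_mem
  rcases hy with hy | hy
  · exact ⟨_, main h.arc₁ (fun y h1 h2 => hF.meet₁ y h1 (Or.inl h2))
      (fun y h1 h2 => hF.meet₂ y h1 (Or.inl h2)), Or.inl (Or.inl hx'), Or.inr hy⟩
  · exact ⟨_, main h.arc₂ (fun y h1 h2 => hF.meet₁ y h1 (Or.inr h2))
      (fun y h1 h2 => hF.meet₂ y h1 (Or.inr h2)), Or.inl (Or.inl hx'), Or.inr hy⟩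

end IsCycleSet

end TwoConnectedSpaces

section Theta

open Set Topology

/-- Any three arcs issuing from `v` that are disjoint apart from `v` include a degenerate one. -/
def NoTriodAt {X : Type*} [TopologicalSpace X] (v : X) : Prop :=
  ∀ a b c A B C, ArcFromTo v a A → ArcFromTo v b B → ArcFromTo v c C →
    (∀ y ∈ A, y ∈ B → y = v) → (∀ y ∈ A, y ∈ C → y = v) → (∀ y ∈ B, y ∈ C → y = v) →
    a = v ∨ b = v ∨ c = v

/-- Three arcs from `c` to `d` forming a theta curve. -/
structure IsThetaTriple {X : Type*} [TopologicalSpace X] (c d : X) (T₁ T₂ T₃ : Set X) : Prop where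
  ne : c ≠ d
  arc₁ : ArcFromTo c d T₁
  arc₂ : ArcFromTo c d T₂
  arc₃ : ArcFromTo c d T₃
  inter₁₂ : ∀ y ∈ T₁, y ∈ T₂ → y = c ∨ y = d
  inter₁₃ : ∀ y ∈ T₁, y ∈ T₃ → y = c ∨ y = d
  inter₂₃ : ∀ y ∈ T₂, y ∈ T₃ → y = c ∨ y = d

variable {X : Type*} [TopologicalSpace X]

namespace ArcFromTo

variable {a b x y : X} {A : Set X}

theorem exists_interior (h : ArcFromTo a b A) (hab : a ≠ b) : ∃ m ∈ A, m ≠ a ∧ m ≠ b := by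
  obtain ⟨f, s, t, hst, hc, hi, rfl, rfl, rfl⟩ := h
  have hlt : s < t := lt_of_le_of_ne hst fun e => hab (by rw [e])
  have hm : (s + t) / 2 ∈ Icc s t := ⟨by linarith, by linarith⟩
  refine ⟨_, ⟨_, hm, rfl⟩, fun e => ?_, fun e => ?_⟩
  · have := hi hm (left_mem_Icc.2 hst) e
    linarith
  · have := hi hm (right_mem_Icc.2 hst) e
    linarith

theorem exists_subarc (h : ArcFromTo a b A) (hx : x ∈ A) (hy : y ∈ A) :
    ∃ D ⊆ A, ArcFromTo x y D := by
  obtain ⟨B, C, h1, h2, rfl, -⟩ := h.split' hx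
  rcases hy with hy | hy
  · obtain ⟨D, E, -, h3, rfl, -⟩ := h1.split' hy
    exact ⟨E, fun z hz => Or.inl (Or.inr hz), h3.symm⟩
  · obtain ⟨D, E, h3, -, rfl, -⟩ := h2.split' hy
    exact ⟨D, fun z hz => Or.inr (Or.inl hz), h3⟩

theorem exists_subarc_interior (h : ArcFromTo a b A)
    (hx : x ∈ A) (hy : y ∈ A) (hxa : x ≠ a) (hxb : x ≠ b) (hya : y ≠ a) (hyb : y ≠ b) :
    ∃ D, ArcFromTo x y D ∧ D ⊆ A ∧ a ∉ D ∧ b ∉ D := by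
  obtain ⟨R, S, hR, hS, e, hRS⟩ := h.split' hx
  have := hR.left_mem
  have := hR.right_mem
  have := hS.right_mem
  rw [e] at hy
  rcases hy with hy | hy
  · obtain ⟨R₁, R₂, hR₁, hR₂, rfl, hR₁₂⟩ := hR.split' hy
    have := hR₁.left_mem
    refine ⟨R₂, hR₂.symm, ?_, ?_, ?_⟩
    · rw [e]; exact fun y hy => Or.inl (Or.inr hy)
    · simp only [mem_union] at *; grind
    · simp only [mem_union] at *; grind
  · obtain ⟨S₁, S₂, hS₁, hS₂, rfl, hS₁₂⟩ := hS.split' hy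
    have := hS₂.right_mem
    refine ⟨S₁, hS₁, ?_, ?_, ?_⟩
    · rw [e]; exact fun y hy => Or.inr (Or.inl hy)
    · simp only [mem_union] at *; grind
    · simp only [mem_union] at *; grind

end ArcFromTo

namespace IsThetaTriple

variable {c d v x₁ x₂ x₃ p : X} {T₁ T₂ T₃ D : Set X}

theorem rotate (h : IsThetaTriple c d T₁ T₂ T₃) : IsThetaTriple c d T₂ T₃ T₁ :=
  ⟨h.ne, h.arc₂, h.arc₃, h.arc₁, h.inter₂₃, fun y h1 h2 => h.inter₁₂ y h2 h1,
    fun y h1 h2 => h.inter₁₃ y h2 h1⟩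

theorem symm (h : IsThetaTriple c d T₁ T₂ T₃) : IsThetaTriple d c T₁ T₂ T₃ :=
  ⟨h.ne.symm, h.arc₁.symm, h.arc₂.symm, h.arc₃.symm, fun y h1 h2 => (h.inter₁₂ y h1 h2).symm,
    fun y h1 h2 => (h.inter₁₃ y h1 h2).symm, fun y h1 h2 => (h.inter₂₃ y h1 h2).symm⟩

theorem exists_arc_of_access (h : IsThetaTriple c d T₁ T₂ T₃) (hx₁ : x₁ ∈ T₁) (hx₂ : x₂ ∈ T₂)
    (hx₃ : x₃ ∈ T₃) (hx₁c : x₁ ≠ c) (hx₁d : x₁ ≠ d) (hx₃d : x₃ ≠ d) (hx₃c : x₃ ≠ c)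
    (hD : ArcFromTo v p D) (hp : p ∈ T₁) (hpc : p ≠ c) (hpd : p ≠ d)
    (hDT : ∀ y ∈ D, y ∈ T₁ ∨ y ∈ T₂ ∨ y ∈ T₃ → y = p) :
    ∃ e A, ArcFromTo v e A ∧ x₁ ∈ A ∧ x₂ ∈ A ∧ x₃ ∈ A := by
  obtain ⟨U, W, hU, hW, e, hUW⟩ := h.arc₁.split' hx₁
  wlog hpU : p ∈ U generalizing c d U W
  · refine this h.symm hx₁d hx₁c hx₃c hx₃d hpd hpc W U hW.symm hU.symm (by rw [e, union_comm])
      (fun y h1 h2 => hUW y h2 h1) ?_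
    rw [e] at hp
    exact hp.resolve_left hpU
  subst e
  obtain ⟨U₁, U₂, hU₁, hU₂, rfl, hU₁₂⟩ := hU.split' hpU
  obtain ⟨R, S, hR, hS, rfl, hRS⟩ := h.arc₃.split' hx₃
  obtain ⟨hne, -, a2, -, i12, i13, i23⟩ := h
  have := hU₁.left_mem
  have := hU₂.left_mem
  have := hU₂.right_mem
  have := hW.right_mem
  have := hS.right_mem
  have := hR.left_mem
  have := hR.right_mem
  have := a2.left_mem
  have k1 : ArcFromTo v x₁ (D ∪ U₂) := hD.concat' hU₂ (by simp only [mem_union] at *; grind)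
  have k2 : ArcFromTo v d (D ∪ U₂ ∪ W) := k1.concat' hW (by simp only [mem_union] at *; grind)
  have k3 : ArcFromTo v c (D ∪ U₂ ∪ W ∪ T₂) :=
    k2.concat' a2.symm (by simp only [mem_union] at *; grind)
  have k4 : ArcFromTo v x₃ (D ∪ U₂ ∪ W ∪ T₂ ∪ R) :=
    k3.concat' hR (by simp only [mem_union] at *; grind)
  refine ⟨_, _, k4, ?_, ?_, ?_⟩ <;> simp only [mem_union] <;> tauto

/-- A theta curve with a further arc `T₀` through `v` between its branch points, and a bridge
between the interiors of `T₁` and `T₂`. -/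
theorem exists_arc_of_bridge {T₀ B : Set X} {q : X} (h : IsThetaTriple c d T₁ T₂ T₃)
    (h₀ : ArcFromTo c d T₀) (hi : ∀ y ∈ T₀, y ∈ T₁ ∨ y ∈ T₂ ∨ y ∈ T₃ → y = c ∨ y = d)
    (hv : v ∈ T₀) (hx₁ : x₁ ∈ T₁) (hx₂ : x₂ ∈ T₂) (hx₃ : x₃ ∈ T₃)
    (hvc : v ≠ c) (hvd : v ≠ d) (hx₂c : x₂ ≠ c) (hx₂d : x₂ ≠ d)
    (hB : ArcFromTo p q B) (hp : p ∈ T₁) (hq : q ∈ T₂) (hpc : p ≠ c) (hpd : p ≠ d)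
    (hqc : q ≠ c) (hqd : q ≠ d)
    (hBT : ∀ y ∈ B, y ∈ T₀ ∨ y ∈ T₁ ∨ y ∈ T₂ ∨ y ∈ T₃ → y = p ∨ y = q) :
    ∃ e A, ArcFromTo v e A ∧ x₁ ∈ A ∧ x₂ ∈ A ∧ x₃ ∈ A := by
  obtain ⟨U, W, hU, hW, e, hUW⟩ := h.arc₁.split' hp
  wlog hxU : x₁ ∈ W generalizing c d U W
  · refine this h.symm h₀.symm (fun y h1 h2 => (hi y h1 h2).symm) hvd hvc hx₂d hx₂c
      hpd hpc hqd hqc W U hW.symm hU.symm (by rw [e, union_comm]) (fun y h1 h2 => hUW y h2 h1) ?_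
    rw [e] at hx₁
    exact hx₁.resolve_right hxU
  subst e
  obtain ⟨M, N, hM, hN, rfl, hMN⟩ := h₀.split' hv
  obtain ⟨E, hE, hET, hcE, hdE⟩ := h.arc₂.exists_subarc_interior hq hx₂ hqc hqd hx₂c hx₂d
  obtain ⟨hne, -, -, a3, i12, i13, i23⟩ := h
  have hET' : ∀ y ∈ E, y ∈ T₂ := hET
  have := hU.left_mem
  have := hU.right_mem
  have := hW.right_mem
  have := hM.left_mem
  have := hN.right_mem
  have := hN.left_mem
  have := a3.left_mem
  have := a3.right_mem
  have := hE.left_mem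
  have := hE.right_mem
  have k1 : ArcFromTo v d (M ∪ T₃) := hM.symm.concat' a3 (by simp only [mem_union] at *; grind)
  have k2 : ArcFromTo v p (M ∪ T₃ ∪ W) :=
    k1.concat' hW.symm (by simp only [mem_union] at *; grind)
  have k3 : ArcFromTo v q (M ∪ T₃ ∪ W ∪ B) := k2.concat' hB (by simp only [mem_union] at *; grind)
  have k4 : ArcFromTo v x₂ (M ∪ T₃ ∪ W ∪ B ∪ E) :=
    k3.concat' hE (by simp only [mem_union] at *; grind)
  refine ⟨_, _, k4, ?_, ?_, ?_⟩ <;> simp only [mem_union] <;> tauto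

end IsThetaTriple

variable [T2Space X]

theorem SegmentTwoConnected.exists_isCycleSet (hX : SegmentTwoConnected X) {a b : X} {A : Set X}
    (h : ArcFromTo a b A) (hab : a ≠ b) : ∃ C : Set X, IsCycleSet C := by
  obtain ⟨m, hm, hma, hmb⟩ := h.exists_interior hab
  obtain ⟨D, E, h1, h2, -, h4⟩ := h.split' hm
  have hbD : b ∉ D := fun hb => hmb (h4 b hb h2.right_mem).symm
  obtain ⟨c, d, F₁, F₂, hF⟩ := hX.exists_fan h1.isClosed ⟨a, h1.left_mem, m, h1.right_mem, hma.symm⟩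
    hbD
  obtain ⟨G, hGD, hG⟩ := h1.exists_subarc hF.mem₁ hF.mem₂
  have hGD' : ∀ y ∈ G, y ∈ D := hGD
  have hFF := hF.arc₁.symm.concat' hF.arc₂ hF.inter
  refine ⟨_, c, d, F₁ ∪ F₂, G, ⟨hF.ne, hFF, hG, ?_⟩, rfl⟩
  have := hF.meet₁
  have := hF.meet₂
  simp only [mem_union] at *; grind

end Theta

section TerminalArc

open Set Topology

variable {X : Type*} [TopologicalSpace X] {c d v x₁ x₂ x₃ : X}

theorem NoTriodAt.ne_of_mem_arcs {T₁ T₂ T₃ : Set X} (hv : NoTriodAt v)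
    (h : IsThetaTriple c d T₁ T₂ T₃) : v ≠ c := by
  rintro rfl
  obtain ⟨hne, h1, h2, h3, i12, i13, i23⟩ := h
  obtain ⟨m₁, hm₁, k1, l1⟩ := h1.exists_interior hne
  obtain ⟨m₂, hm₂, k2, l2⟩ := h2.exists_interior hne
  obtain ⟨m₃, hm₃, k3, l3⟩ := h3.exists_interior hne
  obtain ⟨A₁, B₁, a1, b1, rfl, e1⟩ := h1.split' hm₁
  obtain ⟨A₂, B₂, a2, b2, rfl, e2⟩ := h2.split' hm₂
  obtain ⟨A₃, B₃, a3, b3, rfl, e3⟩ := h3.split' hm₃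
  have := b1.right_mem
  have := b2.right_mem
  have := b3.right_mem
  have := hv m₁ m₂ m₃ A₁ A₂ A₃ a1 a2 a3
  simp only [mem_union] at *
  grind

/-- An arc meeting the interiors of two members of a family of closed sets, off `c` and `d`,
contains a bridge between two members. -/
theorem ArcFromTo.exists_bridge [T2Space X] {ι : Type*} [Finite ι] {T : ι → Set X}
    (hT : ∀ i, IsClosed (T i)) {a b : X} {A : Set X} (h : ArcFromTo a b A) {i j : ι} (hij : i ≠ j)
    (ha : a ∈ T i) (hb : b ∈ T j) :
    ∃ i j p q B, i ≠ j ∧ ArcFromTo p q B ∧ B ⊆ A ∧ p ∈ T i ∧ q ∈ T j ∧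
      ∀ k, ∀ y ∈ B, y ∈ T k → y = p ∨ y = q := by
  have hcl : IsClosed (⋃ k ∈ {k | k ≠ i}, T k) :=
    (Set.toFinite _).isClosed_biUnion fun k _ => hT k
  obtain ⟨q, D, hD, hDA, hq, hD'⟩ := h.exists_first_hit' hcl h.right_mem (mem_biUnion hij.symm hb)
  obtain ⟨p, E, hE, hED, hp, hE'⟩ := hD.symm.exists_first_hit' (hT i) hD.left_mem ha
  simp only [mem_iUnion] at hq
  obtain ⟨k, hk, hqk⟩ := hq
  refine ⟨i, k, p, q, E, Ne.symm hk, hE.symm, hED.trans hDA, hp, hqk, fun l y hy hyl => ?_⟩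
  by_cases hl : l = i
  · subst hl; exact Or.inl (hE' y hy hyl)
  · exact Or.inr (hD' y (hED hy) (mem_biUnion (show l ∈ {k | k ≠ i} from hl) hyl))

namespace IsThetaTriple

variable {T₁ T₂ T₃ : Set X}

theorem swap (h : IsThetaTriple c d T₁ T₂ T₃) : IsThetaTriple c d T₂ T₁ T₃ :=
  ⟨h.ne, h.arc₂, h.arc₁, h.arc₃, fun y h1 h2 => h.inter₁₂ y h2 h1, h.inter₂₃, h.inter₁₃⟩

/-- If `v` can be joined to an interior point of a theta curve, then some arc from `v` passes
through three given points on the different arcs of the curve. -/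
theorem exists_arc_of_access' (h : IsThetaTriple c d T₁ T₂ T₃) (hx₁ : x₁ ∈ T₁) (hx₂ : x₂ ∈ T₂)
    (hx₃ : x₃ ∈ T₃) (hx₁' : x₁ ≠ c ∧ x₁ ≠ d) (hx₂' : x₂ ≠ c ∧ x₂ ≠ d) (hx₃' : x₃ ≠ c ∧ x₃ ≠ d)
    {p : X} {D : Set X} (hD : ArcFromTo v p D) (hp : p ∈ T₁ ∨ p ∈ T₂ ∨ p ∈ T₃) (hpc : p ≠ c)
    (hpd : p ≠ d) (hDT : ∀ y ∈ D, y ∈ T₁ ∨ y ∈ T₂ ∨ y ∈ T₃ → y = p) :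
    ∃ e A, ArcFromTo v e A ∧ x₁ ∈ A ∧ x₂ ∈ A ∧ x₃ ∈ A := by
  rcases hp with hp | hp | hp
  · exact h.exists_arc_of_access hx₁ hx₂ hx₃ hx₁'.1 hx₁'.2 hx₃'.2 hx₃'.1 hD hp hpc hpd hDT
  · obtain ⟨e, A, h1, h2, h3, h4⟩ := h.swap.exists_arc_of_access hx₂ hx₁ hx₃ hx₂'.1 hx₂'.2
      hx₃'.2 hx₃'.1 hD hp hpc hpd fun y hy hy' => hDT y hy (by tauto)
    exact ⟨e, A, h1, h3, h2, h4⟩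
  · obtain ⟨e, A, h1, h2, h3, h4⟩ := h.rotate.rotate.exists_arc_of_access hx₃ hx₁ hx₂ hx₃'.1 hx₃'.2
      hx₂'.2 hx₂'.1 hD hp hpc hpd fun y hy hy' => hDT y hy (by tauto)
    exact ⟨e, A, h1, h3, h4, h2⟩

end IsThetaTriple

variable [T2Space X]

theorem IsThetaTriple.exists_arc_of_bypass {T₀ T₁ T₂ T₃ : Set X} (h : IsThetaTriple c d T₁ T₂ T₃)
    (hx₁ : x₁ ∈ T₁) (hx₂ : x₂ ∈ T₂)
    (hx₃ : x₃ ∈ T₃) (hx₁' : x₁ ≠ c ∧ x₁ ≠ d) (hx₂' : x₂ ≠ c ∧ x₂ ≠ d) (hx₃' : x₃ ≠ c ∧ x₃ ≠ d)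
    (h₀ : ArcFromTo c d T₀) (hi : ∀ y ∈ T₀, y ∈ T₁ ∨ y ∈ T₂ ∨ y ∈ T₃ → y = c ∨ y = d)
    (hv : v ∈ T₀) (hvc : v ≠ c) (hvd : v ≠ d)
    {a b : X} {A : Set X} (hA : ArcFromTo a b A) (hvA : v ∈ A)
    (hx₁A : x₁ ∈ A) (hx₂A : x₂ ∈ A) (hx₃A : x₃ ∈ A) :
    ∃ e A, ArcFromTo v e A ∧ x₁ ∈ A ∧ x₂ ∈ A ∧ x₃ ∈ A := by
  classical
  obtain ⟨i, j, B, hij, hB, -, hBC⟩ := hA.exists_subarc_disjoint {c, d} ![v, x₁, x₂, x₃]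
    (by intro i; fin_cases i <;> simpa) (by intro i; fin_cases i <;> simp_all)
    (by rw [Finset.card_pair h.ne]; norm_num)
  let T : Fin 4 → Set X := ![T₀, T₁, T₂, T₃]
  have hT : ∀ i, IsClosed (T i) := by
    intro i; fin_cases i
    exacts [h₀.isClosed, h.arc₁.isClosed, h.arc₂.isClosed, h.arc₃.isClosed]
  have hmem : ∀ i, ![v, x₁, x₂, x₃] i ∈ T i := by
    intro i; fin_cases i <;> simpa [T]
  obtain ⟨i, j, p, q, E, hij, hE, hEB, hp, hq, hET⟩ :=
    hB.exists_bridge hT hij (hmem i) (hmem j)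
  have hpc : p ≠ c := fun e => hBC c (by simp) (hEB (e ▸ hE.left_mem))
  have hpd : p ≠ d := fun e => hBC d (by simp) (hEB (e ▸ hE.left_mem))
  have hqc : q ≠ c := fun e => hBC c (by simp) (hEB (e ▸ hE.right_mem))
  have hqd : q ≠ d := fun e => hBC d (by simp) (hEB (e ▸ hE.right_mem))
  clear hB hBC hEB
  wlog hlt : i < j generalizing i j p q
  · exact this j i q p hij.symm hE.symm hq hp (fun k y h1 h2 => (hET k y h1 h2).symm)
      hqc hqd hpc hpd (lt_of_le_of_ne (not_lt.1 hlt) hij.symm)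
  have hET' : ∀ y ∈ E, y ∈ T₀ ∨ y ∈ T₁ ∨ y ∈ T₂ ∨ y ∈ T₃ → y = p ∨ y = q := by
    rintro y hy (h | h | h | h)
    exacts [hET 0 y hy h, hET 1 y hy h, hET 2 y hy h, hET 3 y hy h]
  have access : p ∈ T₀ → q ∈ T₁ ∨ q ∈ T₂ ∨ q ∈ T₃ →
      ∃ e A, ArcFromTo v e A ∧ x₁ ∈ A ∧ x₂ ∈ A ∧ x₃ ∈ A := by
    intro hp hq
    obtain ⟨D, hD, hDT, hcD, hdD⟩ := h₀.exists_subarc_interior hv hp hvc hvd hpc hpd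
    have hqT : q ∉ T₀ := fun hq' => by
      have := hi q hq' hq
      tauto
    have hDT' : ∀ y ∈ D, y ∈ T₀ := hDT
    refine h.exists_arc_of_access' hx₁ hx₂ hx₃ hx₁' hx₂' hx₃'
      (hD.concat' hE fun y h1 h2 => ?_) hq hqc hqd ?_
    · have := hET' y h2 (Or.inl (hDT h1))
      grind
    · simp only [mem_union]
      grind
  obtain ⟨hx₁c, hx₁d⟩ := hx₁'
  obtain ⟨hx₂c, hx₂d⟩ := hx₂'
  obtain ⟨hx₃c, hx₃d⟩ := hx₃'
  have bridge : ∀ {S₁ S₂ S₃ : Set X} {y₁ y₂ y₃ : X}, IsThetaTriple c d S₁ S₂ S₃ →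
      (∀ y, y ∈ S₁ ∨ y ∈ S₂ ∨ y ∈ S₃ ↔ y ∈ T₁ ∨ y ∈ T₂ ∨ y ∈ T₃) → y₁ ∈ S₁ → y₂ ∈ S₂ →
      y₃ ∈ S₃ → y₂ ≠ c → y₂ ≠ d → p ∈ S₁ → q ∈ S₂ → 
      ∃ e A, ArcFromTo v e A ∧ y₁ ∈ A ∧ y₂ ∈ A ∧ y₃ ∈ A := by
    intro S₁ S₂ S₃ y₁ y₂ y₃ hS hST hy₁ hy₂ hy₃ hyc hyd hpS hqS
    exact hS.exists_arc_of_bridge h₀ (fun y h1 h2 => hi y h1 ((hST y).1 h2)) hv hy₁ hy₂ hy₃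
      hvc hvd hyc hyd hE hpS hqS hpc hpd hqc hqd fun y h1 h2 => hET' y h1 (by
        rcases h2 with h2 | h2
        · exact Or.inl h2
        · exact Or.inr ((hST y).1 h2))
  fin_cases i <;> fin_cases j <;> simp [T] at hp hq hlt
  · exact access hp (Or.inl hq)
  · exact access hp (Or.inr (Or.inl hq))
  · exact access hp (Or.inr (Or.inr hq))
  · exact bridge h (fun y => Iff.rfl) hx₁ hx₂ hx₃ hx₂c hx₂d hp hq
  · obtain ⟨e, A, k1, k2, k3, k4⟩ := bridge h.rotate.swap.rotate.rotate (fun y => by tauto)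
      hx₁ hx₃ hx₂ hx₃c hx₃d hp hq
    exact ⟨e, A, k1, k2, k4, k3⟩
  · obtain ⟨e, A, k1, k2, k3, k4⟩ := bridge h.rotate (fun y => by tauto)
      hx₂ hx₃ hx₁ hx₃c hx₃d hp hq
    exact ⟨e, A, k1, k4, k2, k3⟩

theorem IsCycleSet.exists_arc_of_mem {C : Set X} (hC : IsCycleSet C) {a b : X} {A : Set X}
    (hA : ArcFromTo a b A) (hvA : v ∈ A) (hxA : x₁ ∈ A) (hx₁ : x₁ ∈ C) (hx₂ : x₂ ∈ C)
    (hx₃ : x₃ ∈ C) : ∃ e A, ArcFromTo v e A ∧ x₁ ∈ A ∧ x₂ ∈ A ∧ x₃ ∈ A := by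
  obtain ⟨D, -, hD⟩ := hA.exists_subarc hvA hxA
  obtain ⟨p, E, hE, -, hp, hEC⟩ := hD.exists_first_hit' hC.isClosed hD.right_mem hx₁
  obtain ⟨e, B, hB, hBC, h1, h2, h3⟩ := hC.exists_arc_from hp hx₁ hx₂ hx₃
  exact ⟨e, _, hE.concat' hB fun y h h' => hEC y h (hBC h'), Or.inr h1, Or.inr h2, Or.inr h3⟩

/-- In a two-connected space, three points that lie on a common arc with a point `v` at which
there is no triod lie on an arc issuing from `v`. -/
theorem SegmentTwoConnected.exists_arc_from (hX : SegmentTwoConnected X) (hv : NoTriodAt v)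
    {a b : X} {A : Set X} (hab : a ≠ b) (hA : ArcFromTo a b A) (hvA : v ∈ A)
    (hx₁A : x₁ ∈ A) (hx₂A : x₂ ∈ A) (hx₃A : x₃ ∈ A) :
    ∃ e A, ArcFromTo v e A ∧ x₁ ∈ A ∧ x₂ ∈ A ∧ x₃ ∈ A := by
  obtain ⟨C, hC⟩ := hX.exists_isCycleSet hA hab
  obtain ⟨C, hC, hx₂, -⟩ := hC.exists_insert hX hC.nontrivial.nonempty.some_mem x₂
  obtain ⟨C, hC, hx₃, hx₂⟩ := hC.exists_insert hX hx₂ x₃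
  by_cases hx₁ : x₁ ∈ C
  · exact hC.exists_arc_of_mem hA hvA hx₁A hx₁ hx₂ hx₃
  obtain ⟨c, d, F₁, F₂, hF⟩ := hX.exists_fan hC.isClosed hC.nontrivial hx₁
  obtain ⟨T₂, T₃, hT, rfl⟩ := hC.exists_arcPair hF.mem₁ hF.mem₂ hF.ne
  wlog hx₂T : x₂ ∈ T₂ generalizing T₂ T₃
  · refine this T₃ T₂ hT.swap ?_ ?_ ?_ ?_ ?_ ?_
    · rwa [union_comm]
    · rwa [union_comm]
    · rwa [union_comm]
    · rwa [union_comm]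
    · rwa [union_comm]
    · exact hx₂.resolve_left hx₂T
  have h1 := hF.arc₁.symm.concat' hF.arc₂ hF.inter
  have hF1 := hF.meet₁
  have hF2 := hF.meet₂
  have hFm : x₁ ∈ F₁ ∪ F₂ := Or.inl hF.arc₁.left_mem
  have hFT : ∀ y ∈ F₁ ∪ F₂, y ∈ T₂ ∪ T₃ → y = c ∨ y = d := by
    simp only [mem_union] at *; grind
  by_cases hx₃T₂ : x₃ ∈ T₂
  · have hC' : IsCycleSet ((F₁ ∪ F₂) ∪ T₂) :=
      ⟨c, d, _, _, ⟨hF.ne, h1, hT.arc₁, fun y h h' => hFT y h (Or.inl h')⟩, rfl⟩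
    exact hC'.exists_arc_of_mem hA hvA hx₁A (Or.inl hFm) (Or.inr hx₂T) (Or.inr hx₃T₂)
  have hx₃T : x₃ ∈ T₃ := hx₃.resolve_left hx₃T₂
  by_cases hx₂T₃ : x₂ ∈ T₃
  · have hC' : IsCycleSet ((F₁ ∪ F₂) ∪ T₃) :=
      ⟨c, d, _, _, ⟨hF.ne, h1, hT.arc₂, fun y h h' => hFT y h (Or.inr h')⟩, rfl⟩
    exact hC'.exists_arc_of_mem hA hvA hx₁A (Or.inl hFm) (Or.inr hx₂T₃) (Or.inr hx₃T)
  have hcT := hT.arc₁.left_mem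
  have hdT := hT.arc₁.right_mem
  have hcT₃ := hT.arc₂.left_mem
  have hdT₃ := hT.arc₂.right_mem
  have hx₁' : x₁ ≠ c ∧ x₁ ≠ d :=
    ⟨fun e => hx₁ (e ▸ Or.inl hcT), fun e => hx₁ (e ▸ Or.inl hdT)⟩
  have hx₂' : x₂ ≠ c ∧ x₂ ≠ d := ⟨fun e => hx₂T₃ (e ▸ hcT₃), fun e => hx₂T₃ (e ▸ hdT₃)⟩
  have hΘ : IsThetaTriple c d (F₁ ∪ F₂) T₂ T₃ := ⟨hF.ne, h1, hT.arc₁, hT.arc₂,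
    fun y h h' => hFT y h (Or.inl h'), fun y h h' => hFT y h (Or.inr h'), hT.inter⟩
  have hx₃' : x₃ ≠ c ∧ x₃ ≠ d := ⟨fun e => hx₃T₂ (e ▸ hcT), fun e => hx₃T₂ (e ▸ hdT)⟩
  have hvc : v ≠ c := hv.ne_of_mem_arcs hΘ
  have hvd : v ≠ d := hv.ne_of_mem_arcs hΘ.symm
  generalize F₁ ∪ F₂ = T₁ at *
  clear hFT h1 hF1 hF2 hF
  have access := fun {p : X} {D : Set X} => hΘ.exists_arc_of_access' (v := v) (p := p) (D := D)
    hFm hx₂T hx₃T hx₁' hx₂' hx₃'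
  by_cases hvT : v ∈ T₁ ∨ v ∈ T₂ ∨ v ∈ T₃
  · exact access (ArcFromTo.refl v) hvT hvc hvd fun y hy _ => hy
  have hcl : IsClosed (T₁ ∪ (T₂ ∪ T₃)) :=
    hΘ.arc₁.isClosed.union (hΘ.arc₂.isClosed.union hΘ.arc₃.isClosed)
  obtain ⟨p, q, E₁, E₂, hE⟩ := hX.exists_fan hcl
    ⟨c, Or.inr (Or.inl hcT), d, Or.inr (Or.inl hdT), hΘ.ne⟩ (x := v) hvT
  by_cases hp : p ≠ c ∧ p ≠ d
  · exact access hE.arc₁ hE.mem₁ hp.1 hp.2 hE.meet₁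
  by_cases hq : q ≠ c ∧ q ≠ d
  · exact access hE.arc₂ hE.mem₂ hq.1 hq.2 hE.meet₂
  have h0 := hE.arc₁.symm.concat' hE.arc₂ hE.inter
  have hpq := hE.ne
  have hm₁ := hE.meet₁
  have hm₂ := hE.meet₂
  have hvE : v ∈ E₁ ∪ E₂ := Or.inl hE.arc₁.left_mem
  have hET : ∀ y ∈ E₁ ∪ E₂, y ∈ T₁ ∨ y ∈ T₂ ∨ y ∈ T₃ → y = p ∨ y = q := by
    rintro y (hy | hy) hy'
    exacts [Or.inl (hm₁ y hy hy'), Or.inr (hm₂ y hy hy')]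
  have hcase : (p = c ∧ q = d) ∨ (p = d ∧ q = c) := by grind
  rcases hcase with ⟨rfl, rfl⟩ | ⟨rfl, rfl⟩
  · exact hΘ.exists_arc_of_bypass hFm hx₂T hx₃T hx₁' hx₂' hx₃' h0 hET hvE hvc hvd hA hvA
      hx₁A hx₂A hx₃A
  · exact hΘ.exists_arc_of_bypass hFm hx₂T hx₃T hx₁' hx₂' hx₃' h0.symm
      (fun y h h' => (hET y h h').symm) hvE hvc hvd hA hvA hx₁A hx₂A hx₃A

end TerminalArc

section Realization

open Set Topology

variable {V : Type*} {v w u : V} {t : ℝ}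

theorem vertexPoint_self (v : V) : vertexPoint v v = 1 := by simp [vertexPoint]

theorem vertexPoint_of_ne (h : u ≠ v) : vertexPoint v u = 0 := by simp [vertexPoint, h]

theorem edgePoint_left (h : v ≠ w) : edgePoint v w t v = 1 - t := by simp [edgePoint, h]

theorem edgePoint_right (h : v ≠ w) : edgePoint v w t w = t := by simp [edgePoint, h.symm]

theorem edgePoint_of_ne (hv : u ≠ v) (hw : u ≠ w) : edgePoint v w t u = 0 := by
  simp [edgePoint, hv, hw]

theorem edgePoint_swap (v w : V) (t : ℝ) : edgePoint w v (1 - t) = edgePoint v w t := by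
  funext u
  simp [edgePoint, add_comm]

theorem edgePoint_zero (v w : V) : edgePoint v w 0 = vertexPoint v := by
  funext u
  simp [edgePoint, vertexPoint]

namespace GraphRealization

variable {G : SimpleGraph V}

/-- The point of the realization at a vertex. -/
noncomputable def vertex (G : SimpleGraph V) (v : V) : GraphRealization G :=
  ⟨vertexPoint v, Or.inl ⟨v, rfl⟩⟩

/-- The parametrization of an edge by the unit interval, extended to be constant outside it. -/
noncomputable def edge (h : G.Adj v w) (t : ℝ) : GraphRealization G :=
  ⟨edgePoint v w (projIcc 0 1 zero_le_one t), Or.inr ⟨v, w, _, h, (projIcc 0 1 _ t).2, rfl⟩⟩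

theorem coe_edge (h : G.Adj v w) (ht : t ∈ Icc (0 : ℝ) 1) : (edge h t : V → ℝ) = edgePoint v w t := by
  simp [edge, projIcc_of_mem zero_le_one ht]

theorem vertex_apply_self (v : V) : (vertex G v : V → ℝ) v = 1 := vertexPoint_self v

theorem vertex_apply_of_ne (h : u ≠ v) : (vertex G v : V → ℝ) u = 0 := vertexPoint_of_ne h

theorem edge_apply_left (h : G.Adj v w) (ht : t ∈ Icc (0 : ℝ) 1) :
    (edge h t : V → ℝ) v = 1 - t := by
  rw [coe_edge h ht, edgePoint_left h.ne]

theorem edge_apply_right (h : G.Adj v w) (ht : t ∈ Icc (0 : ℝ) 1) :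
    (edge h t : V → ℝ) w = t := by
  rw [coe_edge h ht, edgePoint_right h.ne]

theorem edge_apply_of_ne (h : G.Adj v w) (hv : u ≠ v) (hw : u ≠ w) :
    (edge h t : V → ℝ) u = 0 := edgePoint_of_ne hv hw

theorem edge_zero (h : G.Adj v w) : edge h 0 = vertex G v :=
  Subtype.ext (by rw [coe_edge h ⟨le_rfl, zero_le_one⟩, edgePoint_zero]; rfl)

theorem edge_symm (h : G.Adj v w) (ht : t ∈ Icc (0 : ℝ) 1) : edge h.symm (1 - t) = edge h t := by
  have ht' : 1 - t ∈ Icc (0 : ℝ) 1 := ⟨by linarith [ht.2], by linarith [ht.1]⟩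
  exact Subtype.ext (by rw [coe_edge _ ht, coe_edge _ ht', edgePoint_swap])

theorem edge_one (h : G.Adj v w) : edge h 1 = vertex G w := by
  rw [← edge_symm h ⟨zero_le_one, le_rfl⟩, sub_self, edge_zero]

theorem continuous_coord (u : V) : Continuous fun x : GraphRealization G => (x : V → ℝ) u :=
  (continuous_apply u).comp continuous_subtype_val

theorem continuous_edge (h : G.Adj v w) : Continuous (edge h) := by
  refine Continuous.subtype_mk (continuous_pi fun u => ?_) _
  have hc : Continuous fun t : ℝ => (projIcc (0 : ℝ) 1 zero_le_one t : ℝ) :=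
    continuous_subtype_val.comp continuous_projIcc
  unfold edgePoint
  split_ifs <;> fun_prop

theorem injOn_edge (h : G.Adj v w) : InjOn (edge h) (Icc 0 1) := fun s hs t ht e => by
  rw [← edge_apply_right h hs, e, edge_apply_right h ht]

theorem mem_cases (x : GraphRealization G) :
    (∃ v, x = vertex G v) ∨ ∃ v w, ∃ h : G.Adj v w, ∃ t, 0 < t ∧ t < 1 ∧ x = edge h t := by
  obtain ⟨x, ⟨v, rfl⟩ | ⟨v, w, t, h, ht, rfl⟩⟩ := x
  · exact Or.inl ⟨v, rfl⟩
  · have e : (⟨edgePoint v w t, Or.inr ⟨v, w, t, h, ht, rfl⟩⟩ : GraphRealization G) = edge h t :=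
      Subtype.ext (coe_edge h ht).symm
    rw [e]
    rcases ht.1.eq_or_lt with rfl | h0
    · exact Or.inl ⟨v, edge_zero h⟩
    rcases ht.2.eq_or_lt with rfl | h1
    · exact Or.inl ⟨w, edge_one h⟩
    exact Or.inr ⟨v, w, h, t, h0, h1, rfl⟩

variable (x : GraphRealization G)

theorem coord_nonneg (u : V) : 0 ≤ (x : V → ℝ) u := by
  rcases mem_cases x with ⟨v, rfl⟩ | ⟨v, w, h, t, h0, h1, rfl⟩
  · by_cases e : u = v
    · rw [e, vertex_apply_self]; exact zero_le_one
    · rw [vertex_apply_of_ne e]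
  · by_cases e : u = v
    · rw [e, edge_apply_left h ⟨h0.le, h1.le⟩]; linarith
    by_cases e' : u = w
    · rw [e', edge_apply_right h ⟨h0.le, h1.le⟩]; exact h0.le
    rw [edge_apply_of_ne h e e']

theorem exists_coord_pos : ∃ u, 0 < (x : V → ℝ) u := by
  rcases mem_cases x with ⟨v, rfl⟩ | ⟨v, w, h, t, h0, h1, rfl⟩
  · exact ⟨v, by rw [vertex_apply_self]; exact zero_lt_one⟩
  · exact ⟨w, by rw [edge_apply_right h ⟨h0.le, h1.le⟩]; exact h0⟩

variable {x}

theorem eq_of_coord_pos_vertex (h : 0 < (vertex G v : V → ℝ) u) : u = v := by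
  by_contra e
  rw [vertex_apply_of_ne e] at h
  exact h.false

theorem eq_or_eq_of_coord_pos_edge (h : G.Adj v w) (hu : 0 < (edge h t : V → ℝ) u) :
    u = v ∨ u = w := by
  by_contra! e
  rw [edge_apply_of_ne h e.1 e.2] at hu
  exact hu.false

theorem eq_vertex (h : ∀ u, 0 < (x : V → ℝ) u → u = v) : x = vertex G v := by
  rcases mem_cases x with ⟨a, rfl⟩ | ⟨a, b, hab, t, h0, h1, rfl⟩
  · rw [h a (by rw [vertex_apply_self]; exact zero_lt_one)]
  · exfalso
    refine hab.ne ((h a ?_).trans (h b ?_).symm)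
    · rw [edge_apply_left hab ⟨h0.le, h1.le⟩]; linarith
    · rw [edge_apply_right hab ⟨h0.le, h1.le⟩]; exact h0

theorem eq_edge (hvw : v ≠ w) (hv : 0 < (x : V → ℝ) v) (hw : 0 < (x : V → ℝ) w) :
    ∃ h : G.Adj v w, (x : V → ℝ) w < 1 ∧ x = edge h ((x : V → ℝ) w) := by
  rcases mem_cases x with ⟨a, rfl⟩ | ⟨a, b, h, t, h0, h1, rfl⟩
  · exact absurd ((eq_of_coord_pos_vertex hv).trans (eq_of_coord_pos_vertex hw).symm) hvw
  · have ht : t ∈ Icc (0 : ℝ) 1 := ⟨h0.le, h1.le⟩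
    rcases eq_or_eq_of_coord_pos_edge h hv with rfl | rfl <;>
    rcases eq_or_eq_of_coord_pos_edge h hw with rfl | rfl
    · exact absurd rfl hvw
    · rw [edge_apply_right h ht]
      exact ⟨h, h1, rfl⟩
    · rw [edge_apply_left h ht]
      exact ⟨h.symm, by linarith, (edge_symm h ht).symm⟩
    · exact absurd rfl hvw

theorem eq_edge_of_subset (h : G.Adj v w) (hx : ∀ u, 0 < (x : V → ℝ) u → u = v ∨ u = w) :
    (x : V → ℝ) w ∈ Icc (0 : ℝ) 1 ∧ x = edge h ((x : V → ℝ) w) := by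
  rcases (coord_nonneg x w).eq_or_lt with hw | hw
  · have : x = vertex G v := eq_vertex fun u hu => (hx u hu).resolve_right (by rintro rfl; linarith)
    rw [← hw, edge_zero]
    exact ⟨⟨le_rfl, zero_le_one⟩, this⟩
  rcases (coord_nonneg x v).eq_or_lt with hv | hv
  · have : x = vertex G w := eq_vertex fun u hu => (hx u hu).resolve_left (by rintro rfl; linarith)
    rw [this, vertex_apply_self, edge_one]
    exact ⟨⟨zero_le_one, le_rfl⟩, rfl⟩
  obtain ⟨_, h1, h2⟩ := eq_edge h.ne hv hw
  exact ⟨⟨hw.le, h1.le⟩, h2⟩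

theorem vertex_injective : Function.Injective (vertex G) := fun v w e =>
  eq_of_coord_pos_vertex (G := G) (by rw [← e, vertex_apply_self]; exact zero_lt_one)

theorem exists_coord_pos_of_ne_vertex (h : x ≠ vertex G v) : ∃ u, u ≠ v ∧ 0 < (x : V → ℝ) u := by
  by_contra! hx
  exact h (eq_vertex fun u hu => by_contra fun e => (hx u e).not_gt hu)

theorem isSegment_edge (h : G.Adj v w) {s t : ℝ} (hs : 0 ≤ s) (hst : s ≤ t) (ht : t ≤ 1) :
    IsSegment (edge h s) (edge h t) (edge h '' Icc s t) := by
  have hsub : Icc s t ⊆ Icc 0 1 := Icc_subset_Icc hs ht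
  refine ⟨⟨edge h, s, t, hst, (continuous_edge h).continuousOn, (injOn_edge h).mono hsub,
    rfl, rfl, rfl⟩, ?_⟩
  have e : edge h '' Icc s t \ {edge h s, edge h t} =
      {x : GraphRealization G | 0 < (x : V → ℝ) v} ∩
        ({x : GraphRealization G | s < (x : V → ℝ) w} ∩ {x : GraphRealization G | (x : V → ℝ) w < t}) := by
    ext x
    constructor
    · rintro ⟨⟨r, hr, rfl⟩, hne⟩
      have h1 : r ≠ s := fun e => hne (by simp [e])
      have h2 : r ≠ t := fun e => hne (by simp [e])
      have h3 := hr.1.lt_of_ne' h1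
      have h4 := hr.2.lt_of_ne h2
      simp only [mem_inter_iff, mem_ofPred_eq, edge_apply_left h (hsub hr), edge_apply_right h (hsub hr)]
      exact ⟨by linarith, h3, h4⟩
    · rintro ⟨hv, hs', ht'⟩
      simp only [mem_ofPred_eq] at hv hs' ht'
      obtain ⟨_, h1, h2⟩ := eq_edge h.ne hv (hs.trans_lt hs')
      refine ⟨⟨_, ⟨hs'.le, ht'.le⟩, h2.symm⟩, ?_⟩
      rintro (e | e)
      · rw [e, edge_apply_right h ⟨hs, hst.trans ht⟩] at hs'
        exact hs'.false
      · rw [mem_singleton_iff.1 e, edge_apply_right h ⟨hs.trans hst, ht⟩] at ht'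
        exact ht'.false
  rw [e]
  exact (isOpen_lt continuous_const (continuous_coord v)).inter
    ((isOpen_lt continuous_const (continuous_coord w)).inter
      (isOpen_lt (continuous_coord w) continuous_const))

theorem arcFromTo_edge (h : G.Adj v w) :
    ArcFromTo (vertex G v) (vertex G w) (edge h '' Icc 0 1) := by
  have := (isSegment_edge h le_rfl zero_le_one le_rfl).1
  rwa [edge_zero, edge_one] at this

/-- A connected set avoiding all points supported on `C` cannot leave the region spanned by a set of
vertices whose neighbours all lie in the set or in `C`. -/
theorem exists_coord_pos_of_isPreconnected {C D : Set V} (hD : ∀ a ∈ D, ∀ b, G.Adj a b → b ∈ D ∨ b ∈ C)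
    {P : Set (GraphRealization G)} (hP : IsPreconnected P)
    (hPC : ∀ x ∈ P, ∃ u ∉ C, 0 < (x : V → ℝ) u) {x y : GraphRealization G} (hx : x ∈ P)
    (hy : y ∈ P) (hxD : ∃ u ∈ D, 0 < (x : V → ℝ) u) : ∃ u ∈ D, 0 < (y : V → ℝ) u := by
  by_contra hyD
  have hop : ∀ E : Set V, IsOpen {x : GraphRealization G | ∃ u ∈ E, 0 < (x : V → ℝ) u} := by
    intro E
    have : {x : GraphRealization G | ∃ u ∈ E, 0 < (x : V → ℝ) u} =
        ⋃ u ∈ E, {x : GraphRealization G | 0 < (x : V → ℝ) u} := by ext; simp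
    rw [this]
    exact isOpen_biUnion fun u _ => isOpen_lt continuous_const (continuous_coord u)
  obtain ⟨z, hz, ⟨a, haD, ha⟩, b, hb, hb'⟩ := hP _ _ (hop D) (hop {u | u ∉ D ∧ u ∉ C})
    (fun z hz => by
      obtain ⟨u, huC, hu⟩ := hPC z hz
      by_cases huD : u ∈ D
      · exact Or.inl ⟨u, huD, hu⟩
      · exact Or.inr ⟨u, ⟨huD, huC⟩, hu⟩)
    ⟨x, hx, hxD⟩
    ⟨y, hy, by
      obtain ⟨u, huC, hu⟩ := hPC y hy
      exact ⟨u, ⟨fun huD => hyD ⟨u, huD, hu⟩, huC⟩, hu⟩⟩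
  have hab : a ≠ b := fun e => hb.1 (e ▸ haD)
  obtain ⟨hadj, -⟩ := eq_edge hab ha hb'
  have := hD a haD b hadj
  have := hb.1
  have := hb.2
  tauto

end GraphRealization

end Realization

section RealizationArcs

open Set Topology

variable {V : Type*} {G : SimpleGraph V} {v w u : V}

namespace GraphRealization

theorem segmentTwoConnected (hG : KConnected G 2) (h3 : ∀ a b : V, ∃ c, c ≠ a ∧ c ≠ b) :
    SegmentTwoConnected (GraphRealization G) := by
  intro p
  set R := Relation.ReflTransGen
    (fun y z : GraphRealization G => ∃ σ, IsSegment y z σ ∧ p ∉ σ) with hR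
  have hsymm : ∀ {x y}, R x y → R y x := by
    intro x y h
    induction h with
    | refl => exact Relation.ReflTransGen.refl
    | tail _ h ih =>
      obtain ⟨σ, h1, h2⟩ := h
      exact Relation.ReflTransGen.head ⟨σ, h1.symm, h2⟩ ih
  have hvert : ∀ u, 0 < (p : V → ℝ) u → ∀ v w, v ≠ u → w ≠ u → R (vertex G v) (vertex G w) := by
    intro u hu v w hv hw
    have hconn := hG {u} (by rw [encard_singleton]; norm_num)
    obtain ⟨W⟩ := hconn.preconnected ⟨v, hv⟩ ⟨w, hw⟩
    suffices H : ∀ (a b : ↥({u}ᶜ : Set V)), (G.induce ({u}ᶜ : Set V)).Walk a b →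
        R (vertex G a) (vertex G b) from H _ _ W
    intro a b W
    induction W with
    | nil => exact Relation.ReflTransGen.refl
    | @cons a b c hab W ih =>
      have hab' : G.Adj a b := hab
      refine Relation.ReflTransGen.head ⟨(edge hab') '' Icc 0 1, ?_, ?_⟩ ih
      · have := isSegment_edge hab' le_rfl zero_le_one le_rfl
        rwa [edge_zero, edge_one] at this
      · rintro ⟨t, ht, rfl⟩
        rcases eq_or_eq_of_coord_pos_edge hab' hu with e | e
        · exact a.2 e.symm
        · exact b.2 e.symm
  have hvert' : ∀ v w, vertex G v ≠ p → vertex G w ≠ p → R (vertex G v) (vertex G w) := by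
    intro v w hv hw
    obtain ⟨u, hu⟩ := exists_coord_pos p
    by_cases hp : p = vertex G u
    · exact hvert u hu v w (by rintro rfl; exact hv hp.symm) (by rintro rfl; exact hw hp.symm)
    obtain ⟨u', huu', hu'⟩ := exists_coord_pos_of_ne_vertex hp
    obtain ⟨c, hc, hc'⟩ := h3 u u'
    have key : ∀ v, R (vertex G v) (vertex G c) := by
      intro v
      by_cases hvu : v = u
      · exact hvert u' hu' v c (by rw [hvu]; exact huu'.symm) hc'
      · exact hvert u hu v c hvu hc
    exact (key v).trans (hsymm (key w))
  have hpt : ∀ x, x ≠ p → ∃ v, vertex G v ≠ p ∧ R x (vertex G v) := by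
    intro x hx
    rcases mem_cases x with ⟨v, rfl⟩ | ⟨v, w, h, t, h0, h1, rfl⟩
    · exact ⟨v, hx, Relation.ReflTransGen.refl⟩
    have s1 := isSegment_edge h le_rfl h0.le h1.le
    have s2 := isSegment_edge h h0.le h1.le le_rfl
    by_cases hp : p ∈ edge h '' Icc t 1
    · have hp' : p ∉ edge h '' Icc 0 t := by
        rintro ⟨r, hr, rfl⟩
        obtain ⟨r', hr', e⟩ := hp
        have := injOn_edge h ⟨h0.le.trans hr'.1, hr'.2⟩ ⟨hr.1, hr.2.trans h1.le⟩ e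
        have : r = t := le_antisymm hr.2 (this ▸ hr'.1)
        exact hx (by rw [this])
      rw [edge_zero] at s1
      exact ⟨v, fun e => hp' (e ▸ s1.1.left_mem), Relation.ReflTransGen.single ⟨_, s1.symm, hp'⟩⟩
    · rw [edge_one] at s2
      exact ⟨w, fun e => hp (e ▸ s2.1.right_mem), Relation.ReflTransGen.single ⟨_, s2, hp⟩⟩
  intro a b ha hb
  obtain ⟨v, hv, hav⟩ := hpt a ha
  obtain ⟨w, hw, hbw⟩ := hpt b hb
  exact (hav.trans (hvert' v w hv hw)).trans (hsymm hbw)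

theorem exists_edge_subset_of_arc {b : GraphRealization G} {A : Set (GraphRealization G)}
    (hA : ArcFromTo (vertex G v) b A) (hb : b ≠ vertex G v) :
    ∃ u, ∃ h : G.Adj v u, ∃ ε, 0 < ε ∧ ε < 1 ∧ ∀ t, 0 < t → t ≤ ε → edge h t ∈ A := by
  obtain ⟨f, s, t, hst, hc, hi, hs, rfl, rfl⟩ := hA
  have hlt : s < t := hst.lt_of_ne (by rintro rfl; exact hb hs)
  have hcv : ContinuousOn (fun r => (f r : V → ℝ) v) (Icc s t) :=
    (continuous_coord v).comp_continuousOn hc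
  obtain ⟨r, hr, hr'⟩ : ∃ r ∈ Ioc s t, ∀ r' ∈ Icc s r, 0 < (f r' : V → ℝ) v := by
    have h1 : ∀ᶠ r in 𝓝[≥] s, 0 < (f r : V → ℝ) v := by
      have := (hcv s (left_mem_Icc.2 hst)).mono_of_mem_nhdsWithin (Icc_mem_nhdsGE hlt)
      refine this.eventually (lt_mem_nhds ?_)
      simp only [hs, vertex_apply_self, zero_lt_one]
    obtain ⟨r, hr, h⟩ := (mem_nhdsGE_iff_exists_Icc_subset.1 h1)
    exact ⟨min r t, ⟨lt_min hr hlt, min_le_right _ _⟩,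
      fun r' hr' => h ⟨hr'.1, hr'.2.trans (min_le_left _ _)⟩⟩
  have hsub : Icc s r ⊆ Icc s t := Icc_subset_Icc_right hr.2
  have hne : f r ≠ vertex G v := fun e => by
    have := hi (hsub (right_mem_Icc.2 hr.1.le)) (left_mem_Icc.2 hst) (e.trans hs.symm)
    exact hr.1.ne' this
  obtain ⟨u, huv, hu⟩ := exists_coord_pos_of_ne_vertex hne
  obtain ⟨h, hlt1, -⟩ := eq_edge huv.symm (hr' r (right_mem_Icc.2 hr.1.le)) hu
  refine ⟨u, h, _, hu, hlt1, fun τ h0 hτ => ?_⟩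
  have hcu : ContinuousOn (fun r => (f r : V → ℝ) u) (Icc s r) :=
    ((continuous_coord u).comp_continuousOn hc).mono hsub
  obtain ⟨q, hq, e⟩ := intermediate_value_Icc hr.1.le hcu
    (show τ ∈ Icc _ _ from ⟨by rw [hs, vertex_apply_of_ne huv]; exact h0.le, hτ⟩)
  simp only at e
  obtain ⟨_, -, h2⟩ := eq_edge huv.symm (hr' q hq) (e.symm ▸ h0)
  rw [e] at h2
  exact ⟨q, hsub hq, h2⟩

theorem noTriodAt_vertex (hv : (G.neighborSet v).encard ≤ 2) : NoTriodAt (vertex G v) := by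
  intro a b c A B C hA hB hC hAB hAC hBC
  by_contra! hne
  obtain ⟨u₁, h₁, ε₁, e₁, l₁, hu₁⟩ := exists_edge_subset_of_arc hA hne.1
  obtain ⟨u₂, h₂, ε₂, e₂, l₂, hu₂⟩ := exists_edge_subset_of_arc hB hne.2.1
  obtain ⟨u₃, h₃, ε₃, e₃, l₃, hu₃⟩ := exists_edge_subset_of_arc hC hne.2.2
  have key : ∀ {u u'} (h : G.Adj v u) (h' : G.Adj v u') {ε ε' : ℝ}
      {P Q : Set (GraphRealization G)}, 0 < ε → ε < 1 → 0 < ε' →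
      (∀ t, 0 < t → t ≤ ε → edge h t ∈ P) → (∀ t, 0 < t → t ≤ ε' → edge h' t ∈ Q) →
      (∀ y ∈ P, y ∈ Q → y = vertex G v) → u ≠ u' := by
    rintro u u' h h' ε ε' P Q e l e' hP hQ hPQ rfl
    have hm : 0 < min ε ε' := lt_min e e'
    have h1 := hPQ _ (hP _ hm (min_le_left _ _)) (hQ _ hm (min_le_right _ _))
    have h2 := edge_apply_right h (t := min ε ε') ⟨hm.le, (min_le_left _ _).trans l.le⟩
    rw [h1, vertex_apply_of_ne h.ne'] at h2
    exact hm.ne h2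
  have n12 := key h₁ h₂ e₁ l₁ e₂ hu₁ hu₂ hAB
  have n13 := key h₁ h₃ e₁ l₁ e₃ hu₁ hu₃ hAC
  have n23 := key h₂ h₃ e₂ l₂ e₃ hu₂ hu₃ hBC
  have hsub : ({u₁, u₂, u₃} : Set V) ⊆ G.neighborSet v := by
    rintro u (rfl | rfl | rfl)
    exacts [h₁, h₂, h₃]
  have h3 : ({u₁, u₂, u₃} : Set V).encard = 3 := by
    rw [encard_insert_of_notMem (by simp [n12, n13]), encard_pair n23]; norm_num
  have := (encard_le_encard hsub).trans hv
  rw [h3] at this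
  exact absurd this (by norm_num)

theorem exists_subset_of_arc_edge {h : G.Adj v w} {r : ℝ} (h0 : 0 < r) (h1 : r < 1)
    {b : GraphRealization G} {A : Set (GraphRealization G)} (hA : ArcFromTo (edge h r) b A)
    (hb : b ≠ edge h r) :
    ∃ r' ∈ Icc (0 : ℝ) 1, r' ≠ r ∧ ∀ t ∈ uIcc r r', edge h t ∈ A := by
  obtain ⟨f, s, t, hst, hc, hi, hs, rfl, rfl⟩ := hA
  have hlt : s < t := hst.lt_of_ne (by rintro rfl; exact hb hs)
  have hr01 : r ∈ Icc (0 : ℝ) 1 := ⟨h0.le, h1.le⟩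
  have hcv : ∀ v, ContinuousOn (fun r => (f r : V → ℝ) v) (Icc s t) := fun v =>
    (continuous_coord v).comp_continuousOn hc
  obtain ⟨q, hq, hq'⟩ : ∃ r ∈ Ioc s t, ∀ r' ∈ Icc s r, 0 < (f r' : V → ℝ) v ∧ 0 < (f r' : V → ℝ) w := by
    have hev : ∀ v, 0 < (f s : V → ℝ) v → ∀ᶠ r in 𝓝[≥] s, 0 < (f r : V → ℝ) v := fun v hv =>
      ((hcv v s (left_mem_Icc.2 hst)).mono_of_mem_nhdsWithin (Icc_mem_nhdsGE hlt)).eventually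
        (lt_mem_nhds hv)
    have ev := (hev v (by rw [hs, edge_apply_left h hr01]; linarith)).and
      (hev w (by rw [hs, edge_apply_right h hr01]; exact h0))
    obtain ⟨r, hr, h⟩ := (mem_nhdsGE_iff_exists_Icc_subset.1 ev)
    exact ⟨min r t, ⟨lt_min hr hlt, min_le_right _ _⟩,
      fun r' hr' => h ⟨hr'.1, hr'.2.trans (min_le_left _ _)⟩⟩
  have hsub : Icc s q ⊆ Icc s t := Icc_subset_Icc_right hq.2
  have hpt : ∀ r' ∈ Icc s q, (f r' : V → ℝ) w < 1 ∧ f r' = edge h ((f r' : V → ℝ) w) := fun r' hr' =>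
    (eq_edge h.ne (hq' r' hr').1 (hq' r' hr').2).2
  have hqm := right_mem_Icc.2 hq.1.le
  refine ⟨_, ⟨(hq' q hqm).2.le, (hpt q hqm).1.le⟩, fun e => ?_, fun τ hτ => ?_⟩
  · have h2 := (hpt q hqm).2
    rw [e, ← hs] at h2
    exact hq.1.ne' (hi (hsub hqm) (left_mem_Icc.2 hst) h2)
  · have hiv := intermediate_value_uIcc (f := fun r => (f r : V → ℝ) w) (a := s) (b := q)
      (by rw [uIcc_of_le hq.1.le]; exact (hcv w).mono hsub)
    rw [hs, edge_apply_right h hr01, uIcc_of_le hq.1.le] at hiv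
    obtain ⟨q', hq'', e⟩ := hiv hτ
    simp only at e
    exact ⟨q', hsub hq'', by rw [(hpt q' hq'').2, e]⟩

theorem noTriodAt_edge (h : G.Adj v w) {r : ℝ} (h0 : 0 < r) (h1 : r < 1) :
    NoTriodAt (edge h r) := by
  intro a b c A B C hA hB hC hAB hAC hBC
  by_contra! hne
  obtain ⟨r₁, l₁, n₁, hr₁⟩ := exists_subset_of_arc_edge h0 h1 hA hne.1
  obtain ⟨r₂, l₂, n₂, hr₂⟩ := exists_subset_of_arc_edge h0 h1 hB hne.2.1
  obtain ⟨r₃, l₃, n₃, hr₃⟩ := exists_subset_of_arc_edge h0 h1 hC hne.2.2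
  have key : ∀ {r₁ r₂ : ℝ} {A B : Set (GraphRealization G)}, r₁ ∈ Icc (0 : ℝ) 1 →
      r₂ ∈ Icc (0 : ℝ) 1 → (∀ t ∈ uIcc r r₁, edge h t ∈ A) → (∀ t ∈ uIcc r r₂, edge h t ∈ B) →
      (∀ y ∈ A, y ∈ B → y = edge h r) → ∀ q ∈ Icc (0 : ℝ) 1, q ∈ uIcc r r₁ → q ∈ uIcc r r₂ →
      q = r := by
    intro r₁ r₂ A B l₁ l₂ hr₁ hr₂ hAB q hq hq₁ hq₂
    exact injOn_edge h hq ⟨h0.le, h1.le⟩ (hAB _ (hr₁ q hq₁) (hr₂ q hq₂))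
  have k12 := key l₁ l₂ hr₁ hr₂ hAB
  have k13 := key l₁ l₃ hr₁ hr₃ hAC
  have k23 := key l₂ l₃ hr₂ hr₃ hBC
  have a1 := k12 r₁ l₁
  have a2 := k12 r₂ l₂
  have a3 := k13 r₁ l₁
  have a4 := k13 r₃ l₃
  have a5 := k23 r₂ l₂
  have a6 := k23 r₃ l₃
  simp only [mem_uIcc] at a1 a2 a3 a4 a5 a6
  grind

/-- Along an arc issuing from a vertex, the midpoint of an edge at that vertex cannot lie between
two points outside the corresponding half of the edge. -/
theorem false_of_midpoint_between (h : G.Adj v w) {f : ℝ → GraphRealization G} {s t a b c : ℝ}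
    (hc : ContinuousOn f (Icc s t)) (hi : InjOn f (Icc s t)) (hs : f s = vertex G v)
    (hsa : s ≤ a) (hab : a ≤ b) (hbc : b ≤ c) (hct : c ≤ t) (hb : f b = edge h (1 / 2))
    (ha : f a ∉ edge h '' Icc 0 (1 / 2)) (hc' : f c ∉ edge h '' Icc 0 (1 / 2)) : False := by
  have hσ := isSegment_edge h le_rfl (t := 1 / 2) (by norm_num) (by norm_num)
  rw [edge_zero] at hσ
  generalize edge h '' Icc 0 (1 / 2) = σ at *
  have arc : ∀ x y, s ≤ x → x ≤ y → y ≤ t → ArcFromTo (f x) (f y) (f '' Icc x y) :=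
    fun x y hsx hxy hyt => ⟨f, x, y, hxy, hc.mono (Icc_subset_Icc hsx hyt),
      hi.mono (Icc_subset_Icc hsx hyt), rfl, rfl, rfl⟩
  have h1 := (arc a b hsa hab (hbc.trans hct)).symm
  have h2 := arc b c (hsa.trans hab) hbc hct
  rw [hb] at h1 h2
  have hlt : s < a := hsa.lt_of_ne (by rintro rfl; exact ha (hs ▸ hσ.1.left_mem))
  have hv : ∀ x y, s < x → y ≤ t → vertex G v ∉ f '' Icc x y := by
    rintro x y hx hy ⟨r, hr, e⟩
    have := hi ⟨hx.le.trans hr.1, hr.2.trans hy⟩ ⟨le_rfl, hx.le.trans (hr.1.trans (hr.2.trans hy))⟩ (e.trans hs.symm)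
    exact (hx.trans_le hr.1).ne' this
  have k1 := hσ.eq_of_mem_arc h1 (hv a b hlt (hbc.trans hct)) ha
  have k2 := hσ.eq_of_mem_arc h2 (hv b c (hlt.trans_le hab) hct) hc'
  have k3 : ∀ y ∈ f '' Icc a b, y ∈ f '' Icc b c → y = edge h (1 / 2) := by
    rintro _ ⟨x, hx, rfl⟩ ⟨y, hy, e⟩
    have := hi ⟨(hsa.trans hab).trans hy.1, hy.2.trans hct⟩ ⟨hsa.trans hx.1, hx.2.trans (hbc.trans hct)⟩ e
    have : x = b := le_antisymm hx.2 (this ▸ hy.1)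
    rw [this, hb]
  rcases noTriodAt_edge h (r := 1 / 2) (by norm_num) (by norm_num) _ _ _ _ _ _ hσ.1.symm h1 h2
    (fun y h h' => k1 y h' h) (fun y h h' => k2 y h' h) k3 with e | e | e
  · exact hv a b hlt (hbc.trans hct) (e ▸ h1.left_mem)
  · exact ha (e ▸ hσ.1.right_mem)
  · exact hc' (e ▸ hσ.1.right_mem)

end GraphRealization

end RealizationArcs

section SubgraphRealization

open Set Topology

variable {V : Type*} {G : SimpleGraph V} {v w u : V}

namespace GraphRealization

/-- The part of the realization of `G` spanned by a subgraph. -/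
def region (H : G.Subgraph) : Set (GraphRealization G) :=
  {x | (∀ u, 0 < (x : V → ℝ) u → u ∈ H.verts) ∧
    ∀ u w, u ≠ w → 0 < (x : V → ℝ) u → 0 < (x : V → ℝ) w → H.Adj u w}

variable {H K : G.Subgraph} {x : GraphRealization G}

theorem vertex_mem_region : vertex G v ∈ region H ↔ v ∈ H.verts := by
  refine ⟨fun h => h.1 v (by rw [vertex_apply_self]; exact zero_lt_one), fun h => ⟨fun u hu => ?_,
    fun u w huw hu hw => ?_⟩⟩
  · rwa [eq_of_coord_pos_vertex hu]
  · exact absurd ((eq_of_coord_pos_vertex hu).trans (eq_of_coord_pos_vertex hw).symm) huw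

theorem edge_mem_region (h : H.Adj v w) (t : ℝ) : edge h.adj_sub t ∈ region H := by
  refine ⟨fun u hu => ?_, fun a b hab ha hb => ?_⟩
  · rcases eq_or_eq_of_coord_pos_edge _ hu with rfl | rfl
    exacts [h.fst_mem, h.snd_mem]
  · rcases eq_or_eq_of_coord_pos_edge _ ha with rfl | rfl <;>
    rcases eq_or_eq_of_coord_pos_edge _ hb with rfl | rfl
    exacts [absurd rfl hab, h, h.symm, absurd rfl hab]

theorem mem_region_cases (hx : x ∈ region H) : (∃ v ∈ H.verts, x = vertex G v) ∨
    ∃ v w, ∃ h : H.Adj v w, ∃ t, 0 < t ∧ t < 1 ∧ x = edge h.adj_sub t := by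
  rcases mem_cases x with ⟨v, rfl⟩ | ⟨v, w, h, t, h0, h1, rfl⟩
  · exact Or.inl ⟨v, vertex_mem_region.1 hx, rfl⟩
  · refine Or.inr ⟨v, w, hx.2 v w h.ne ?_ ?_, t, h0, h1, rfl⟩
    · rw [edge_apply_left h ⟨h0.le, h1.le⟩]; linarith
    · rw [edge_apply_right h ⟨h0.le, h1.le⟩]; exact h0

theorem eq_vertex_of_mem_region (hHK : H.verts ∩ K.verts ⊆ {v}) (hx : x ∈ region H)
    (hx' : x ∈ region K) : x = vertex G v :=
  eq_vertex fun u hu => hHK ⟨hx.1 u hu, hx'.1 u hu⟩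

theorem vertexPoint_subtype {s : Set V} (v u : s) : vertexPoint v u = vertexPoint (v : V) u := by
  rcases eq_or_ne u v with rfl | h
  · rw [vertexPoint_self, vertexPoint_self]
  · rw [vertexPoint_of_ne h, vertexPoint_of_ne (Subtype.coe_ne_coe.2 h)]

theorem edgePoint_subtype {s : Set V} {v w : s} (hvw : v ≠ w) (t : ℝ) (u : s) :
    edgePoint v w t u = edgePoint (v : V) w t u := by
  have hvw' := Subtype.coe_ne_coe.2 hvw
  rcases eq_or_ne u v with rfl | h
  · rw [edgePoint_left hvw, edgePoint_left hvw']
  rcases eq_or_ne u w with rfl | h'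
  · rw [edgePoint_right hvw, edgePoint_right hvw']
  · rw [edgePoint_of_ne h h', edgePoint_of_ne (Subtype.coe_ne_coe.2 h) (Subtype.coe_ne_coe.2 h')]

/-- The inclusion of the realization of a subgraph. -/
noncomputable def inclusion (H : G.Subgraph) (x : GraphRealization H.coe) : GraphRealization G :=
  ⟨Function.extend Subtype.val (x : H.verts → ℝ) 0, by
    rcases mem_cases x with ⟨⟨v, hv⟩, rfl⟩ | ⟨⟨v, hv⟩, ⟨w, hw⟩, h, t, h0, h1, rfl⟩
    · refine Or.inl ⟨v, funext fun u => ?_⟩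
      by_cases hu : u ∈ H.verts
      · exact (Subtype.val_injective.extend_apply _ _ ⟨u, hu⟩).trans
          (vertexPoint_subtype _ _)
      · rw [Function.extend_apply' _ _ _ (by rintro ⟨a, rfl⟩; exact hu a.2),
          vertexPoint_of_ne (by rintro rfl; exact hu hv)]
        rfl
    · refine Or.inr ⟨v, w, t, H.coe_adj_sub _ _ h, ⟨h0.le, h1.le⟩, funext fun u => ?_⟩
      rw [coe_edge h ⟨h0.le, h1.le⟩]
      by_cases hu : u ∈ H.verts
      · exact (Subtype.val_injective.extend_apply _ _ ⟨u, hu⟩).trans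
          (edgePoint_subtype h.ne _ _)
      · rw [Function.extend_apply' _ _ _ (by rintro ⟨a, rfl⟩; exact hu a.2),
          edgePoint_of_ne (by rintro rfl; exact hu hv) (by rintro rfl; exact hu hw)]
        rfl⟩

theorem inclusion_apply (x : GraphRealization H.coe) (u : H.verts) :
    (inclusion H x : V → ℝ) u = (x : H.verts → ℝ) u :=
  Subtype.val_injective.extend_apply _ _ u

theorem inclusion_apply_of_notMem (x : GraphRealization H.coe) (hu : u ∉ H.verts) :
    (inclusion H x : V → ℝ) u = 0 :=
  Function.extend_apply' _ _ _ (by rintro ⟨a, rfl⟩; exact hu a.2)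

theorem inclusion_vertex (v : H.verts) : inclusion H (vertex H.coe v) = vertex G v := by
  refine eq_vertex fun u hu => ?_
  by_cases huH : u ∈ H.verts
  · have := eq_of_coord_pos_vertex ((inclusion_apply _ ⟨u, huH⟩).symm ▸ hu)
    rw [← this]
  · rw [inclusion_apply_of_notMem _ huH] at hu
    exact absurd hu (lt_irrefl _)

theorem inclusion_edge {v w : H.verts} (h : H.coe.Adj v w) {t : ℝ} (ht : t ∈ Icc (0 : ℝ) 1) :
    inclusion H (edge h t) = edge (H.coe_adj_sub _ _ h) t := by
  have := (eq_edge_of_subset (x := inclusion H (edge h t)) (H.coe_adj_sub _ _ h) fun u hu => ?_).2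
  · rwa [inclusion_apply, edge_apply_right h ht] at this
  by_cases huH : u ∈ H.verts
  · rw [inclusion_apply _ ⟨u, huH⟩] at hu
    rcases eq_or_eq_of_coord_pos_edge h hu with e | e
    · exact Or.inl (congrArg Subtype.val e)
    · exact Or.inr (congrArg Subtype.val e)
  · rw [inclusion_apply_of_notMem _ huH] at hu
    exact absurd hu (lt_irrefl _)

theorem isEmbedding_inclusion (H : G.Subgraph) : IsEmbedding (inclusion H) := by
  have hc : Continuous (inclusion H) := by
    refine Continuous.subtype_mk (continuous_pi fun u => ?_) _
    by_cases hu : u ∈ H.verts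
    · exact (continuous_coord ⟨u, hu⟩).congr fun x => (inclusion_apply x ⟨u, hu⟩).symm
    · exact continuous_const.congr fun x => (inclusion_apply_of_notMem x hu).symm
  refine IsEmbedding.of_comp (g := fun (x : GraphRealization G) (u : H.verts) => (x : V → ℝ) u) hc
    (continuous_pi fun u => continuous_coord (u : V)) ?_
  have : (fun (x : GraphRealization G) (u : H.verts) => (x : V → ℝ) u) ∘ inclusion H =
      Subtype.val := by
    funext x u
    exact inclusion_apply x u
  rw [this]
  exact IsEmbedding.subtypeVal

theorem range_inclusion (H : G.Subgraph) : range (inclusion H) = region H := by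
  refine Subset.antisymm ?_ fun x hx => ?_
  · rintro _ ⟨x, rfl⟩
    rcases mem_cases x with ⟨v, rfl⟩ | ⟨v, w, h, t, h0, h1, rfl⟩
    · rw [inclusion_vertex, vertex_mem_region]
      exact v.2
    · rw [inclusion_edge h ⟨h0.le, h1.le⟩]
      exact edge_mem_region (show H.Adj v w from h) t
  · rcases mem_region_cases hx with ⟨v, hv, rfl⟩ | ⟨v, w, h, t, h0, h1, rfl⟩
    · exact ⟨vertex _ ⟨v, hv⟩, inclusion_vertex _⟩
    · have h' : H.coe.Adj ⟨v, h.fst_mem⟩ ⟨w, h.snd_mem⟩ := h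
      exact ⟨edge h' t, inclusion_edge h' ⟨h0.le, h1.le⟩⟩

/-- A subgraph has an `n`-arc connected realization if and only if any `n` points of the
corresponding region lie on an arc within that region. -/
theorem nArcConn_coe_iff {n : ℕ} : NArcConn (GraphRealization H.coe) n ↔
    ∀ S : Finset (GraphRealization G), S.card ≤ n → (S : Set (GraphRealization G)) ⊆ region H →
      ∃ a b A, a ≠ b ∧ ArcFromTo a b A ∧ A ⊆ region H ∧ (S : Set (GraphRealization G)) ⊆ A := by
  classical
  have hi := (isEmbedding_inclusion H).injective
  rw [nArcConn_iff, ← range_inclusion]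
  constructor
  · intro h S hS hSH
    obtain ⟨a, b, A, hab, hA, hSA⟩ := h (S.preimage _ hi.injOn)
      ((Finset.card_preimage S _ hi.injOn).trans_le ((Finset.card_filter_le _ _).trans hS))
    refine ⟨_, _, _, hi.ne hab, hA.image (isEmbedding_inclusion H).continuous hi,
      image_subset_range _ _, fun y hy => ?_⟩
    obtain ⟨x, rfl⟩ := hSH hy
    exact mem_image_of_mem _ (hSA (by simpa using hy))
  · intro h S hS
    obtain ⟨a, b, A, hab, hA, hAH, hSA⟩ := h (S.image (inclusion H)) (Finset.card_image_le.trans hS)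
      (by rw [Finset.coe_image]; exact image_subset_range _ _)
    obtain ⟨a', b', rfl, rfl, hA'⟩ := hA.preimage (isEmbedding_inclusion H) hAH
    refine ⟨a', b', _, fun e => hab (e ▸ rfl), hA', fun y hy => hSA ?_⟩
    rw [Finset.coe_image]
    exact mem_image_of_mem _ hy

theorem subset_edge_of_verts_subset (h : G.Adj v w) (hH : H.verts ⊆ {v, w}) :
    region H ⊆ edge h '' Icc 0 1 := fun x hx => by
  obtain ⟨h1, h2⟩ := eq_edge_of_subset h fun u hu => hH (hx.1 u hu)
  exact ⟨_, h1, h2.symm⟩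

theorem edge_subset_region (h : H.Adj v w) : edge h.adj_sub '' Icc 0 1 ⊆ region H := by
  rintro _ ⟨t, -, rfl⟩
  exact edge_mem_region h t

theorem nArcConn_of_verts_subset {n : ℕ} (h : H.Adj v w) (hH : H.verts ⊆ {v, w}) :
    NArcConn (GraphRealization H.coe) n :=
  nArcConn_coe_iff.2 fun _ _ hS => ⟨_, _, _, vertex_injective.ne h.ne, arcFromTo_edge h.adj_sub,
    edge_subset_region h, hS.trans (subset_edge_of_verts_subset h.adj_sub hH)⟩

end GraphRealization

namespace SimpleGraph.Subgraph

variable {H : G.Subgraph}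

theorem exists_ne_of_kConnected_two (hH : KConnected H.coe 2) (v : V) : ∃ w ∈ H.verts, w ≠ v := by
  by_cases hv : v ∈ H.verts
  · obtain ⟨⟨w, hw⟩⟩ := (hH {⟨v, hv⟩} (by rw [encard_singleton]; norm_num)).nonempty
    exact ⟨w, w.2, fun e => hw (Subtype.ext e)⟩
  · obtain ⟨⟨w, hw⟩⟩ := (hH ∅ (by rw [encard_empty]; norm_num)).nonempty
    exact ⟨w, w.2, fun e => hv (e ▸ w.2)⟩

theorem connected_coe_of_kConnected_two (hH : KConnected H.coe 2) : H.coe.Connected := by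
  have := hH ∅ (by rw [encard_empty]; norm_num)
  rw [compl_empty] at this
  exact (SimpleGraph.induceUnivIso H.coe).connected_iff.1 this

theorem exists_adj_of_kConnected_two (hH : KConnected H.coe 2) (hv : v ∈ H.verts) :
    ∃ w, H.Adj v w := by
  obtain ⟨w, hw, hwv⟩ := exists_ne_of_kConnected_two hH v
  obtain ⟨W⟩ := (connected_coe_of_kConnected_two hH).preconnected ⟨v, hv⟩ ⟨w, hw⟩
  cases W with
  | nil => exact absurd rfl hwv
  | cons h _ => exact ⟨_, h⟩

end SimpleGraph.Subgraph

namespace GraphRealization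

variable {H : G.Subgraph}

/-- In a two-connected and 4-arc connected subgraph, three points lie on an arc issuing from a given
vertex of degree at most two. -/
theorem exists_arc_in_region (hH : KConnected H.coe 2) (hH4 : NArcConn (GraphRealization H.coe) 4)
    (hv : v ∈ H.verts) (hdeg : (H.neighborSet v).encard ≤ 2) {S : Finset (GraphRealization G)}
    (hS : S.card ≤ 3) (hSH : (S : Set (GraphRealization G)) ⊆ region H) :
    ∃ e A, ArcFromTo (vertex G v) e A ∧ A ⊆ region H ∧ (S : Set (GraphRealization G)) ⊆ A := by
  classical
  obtain ⟨w, hvw⟩ := SimpleGraph.Subgraph.exists_adj_of_kConnected_two hH hv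
  by_cases h3 : H.verts ⊆ {v, w}
  · exact ⟨_, _, arcFromTo_edge hvw.adj_sub, edge_subset_region hvw,
      hSH.trans (subset_edge_of_verts_subset hvw.adj_sub h3)⟩
  obtain ⟨z, hz, hzvw⟩ := not_subset.1 h3
  have hX := segmentTwoConnected hH fun a b => by
    by_contra! hall
    have h1 := hall ⟨v, hv⟩
    have h2 := hall ⟨w, hvw.snd_mem⟩
    have h3 := hall ⟨z, hz⟩
    have hvw' := hvw.ne
    simp only [Subtype.ext_iff, ne_eq] at h1 h2 h3
    simp only [mem_insert_iff, mem_singleton_iff] at hzvw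
    rcases eq_or_ne v a with e | e <;> rcases eq_or_ne w a with e' | e' <;>
      rcases eq_or_ne z a with e'' | e'' <;> grind only
  have htri : NoTriodAt (vertex H.coe ⟨v, hv⟩) := by
    refine noTriodAt_vertex (le_trans ?_ hdeg)
    rw [← Subtype.val_injective.encard_image]
    refine encard_le_encard ?_
    rintro _ ⟨u, hu, rfl⟩
    exact hu
  have hrange : ∀ x : S, ∃ y, inclusion H y = x := fun x => by
    have := hSH x.2
    rwa [← range_inclusion] at this
  choose g hg using hrange
  obtain ⟨a, b, A, hab, hA, hSA⟩ := nArcConn_iff.1 hH4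
    (insert (vertex H.coe ⟨v, hv⟩) (Finset.univ.image g))
    ((Finset.card_insert_le _ _).trans (Nat.succ_le_succ
      (Finset.card_image_le.trans (by rw [Finset.card_univ, Fintype.card_coe]; exact hS))))
  have hSA' : ∀ x, g x ∈ A := fun x => hSA (by simp)
  have hvA : vertex H.coe ⟨v, hv⟩ ∈ A := hSA (by simp)
  suffices ∃ e A, ArcFromTo (vertex H.coe ⟨v, hv⟩) e A ∧ ∀ x, g x ∈ A by
    obtain ⟨e, B, hB, hgB⟩ := this
    have := hB.image (isEmbedding_inclusion H).continuous (isEmbedding_inclusion H).injective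
    rw [inclusion_vertex] at this
    refine ⟨_, _, this, ?_, fun x hx => ⟨g ⟨x, hx⟩, hgB _, hg ⟨x, hx⟩⟩⟩
    rw [← range_inclusion]
    exact image_subset_range _ _
  obtain ⟨x₁, x₂, x₃, h₁, h₂, h₃, hx⟩ : ∃ x₁ x₂ x₃, x₁ ∈ A ∧ x₂ ∈ A ∧ x₃ ∈ A ∧
      ∀ x, g x = x₁ ∨ g x = x₂ ∨ g x = x₃ := by
    obtain ⟨φ⟩ : Nonempty (S ↪ Fin 3) :=
      Function.Embedding.nonempty_of_card_le (by simpa using hS)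
    let k : Fin 3 → GraphRealization H.coe := fun i =>
      if h : ∃ x, φ x = i then g h.choose else vertex H.coe ⟨v, hv⟩
    have hk : ∀ i, k i ∈ A := fun i => by
      simp only [k]
      split_ifs
      exacts [hSA' _, hvA]
    refine ⟨k 0, k 1, k 2, hk 0, hk 1, hk 2, fun x => ?_⟩
    have : k (φ x) = g x := by
      have h : ∃ y, φ y = φ x := ⟨x, rfl⟩
      simp only [k, dif_pos h]
      rw [φ.injective h.choose_spec]
    rw [← this]
    generalize φ x = i
    fin_cases i <;> simp
  obtain ⟨e, B, hB, k₁, k₂, k₃⟩ := hX.exists_arc_from htri hab hA hvA h₁ h₂ h₃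
  refine ⟨e, B, hB, fun x => ?_⟩
  rcases hx x with e | e | e <;> rwa [e]

end GraphRealization

end SubgraphRealization

section ChainArcs

open Set Topology GraphRealization

variable {V : Type*} {G : SimpleGraph V} {J : Set ℤ} {L : ℤ → G.Subgraph}

theorem SimpleGraph.Reachable.of_closed {a b : V} (hab : G.Reachable a b) {P : V → Prop}
    (hP : ∀ u w, G.Adj u w → P u → P w) (ha : P a) : P b := by
  obtain ⟨W⟩ := hab
  induction W with
  | nil => exact ha
  | cons h _ ih => exact ih (hP _ _ h ha)

theorem ArcFromTo.ne_of_mem {X : Type*} [TopologicalSpace X] {a b x y : X} {A : Set X}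
    (hA : ArcFromTo a b A) (hx : x ∈ A) (hy : y ∈ A) (hxy : x ≠ y) : a ≠ b := by
  obtain ⟨f, s, t, hst, -, hi, rfl, rfl, rfl⟩ := hA
  intro e
  obtain rfl := hi (left_mem_Icc.2 hst) (right_mem_Icc.2 hst) e
  obtain ⟨r, hr, rfl⟩ := hx
  obtain ⟨q, hq, rfl⟩ := hy
  rw [Icc_self, mem_singleton_iff] at hr hq
  exact hxy (hr ▸ hq ▸ rfl)

namespace IsChainGraph

theorem exists_adj (hL : IsChainGraph G J L) {u w : V} (h : G.Adj u w) :
    ∃ i ∈ J, (L i).Adj u w := by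
  have : (⊤ : G.Subgraph).Adj u w := h
  rw [← hL.cover] at this
  simpa using this

theorem exists_mem_verts (hL : IsChainGraph G J L) (u : V) : ∃ i ∈ J, u ∈ (L i).verts := by
  have : u ∈ (⊤ : G.Subgraph).verts := trivial
  rw [← hL.cover] at this
  simpa using this

theorem exists_mem_region (hL : IsChainGraph G J L) (x : GraphRealization G) :
    ∃ i ∈ J, x ∈ region (L i) := by
  rcases mem_cases x with ⟨v, rfl⟩ | ⟨v, w, h, t, -, -, rfl⟩
  · obtain ⟨i, hi, hv⟩ := hL.exists_mem_verts v
    exact ⟨i, hi, vertex_mem_region.2 hv⟩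
  · obtain ⟨i, hi, hv⟩ := hL.exists_adj h
    exact ⟨i, hi, edge_mem_region hv t⟩

theorem eq_of_mem_verts (hL : IsChainGraph G J L) {i j k : ℤ} {u v : V} (hi : i ∈ J)
    (hj : j ∈ J) (hik : i ≤ k) (hkj : k < j) (hv : (L k).verts ∩ (L (k + 1)).verts = {v})
    (hui : u ∈ (L i).verts) (huj : u ∈ (L j).verts) : u = v := by
  by_cases hij : i + 1 < j
  · exact absurd ((hL.sep i hi j hj hij).subset ⟨hui, huj⟩) (notMem_empty _)
  · obtain rfl : i = k := by omega
    obtain rfl : j = i + 1 := by omega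
    exact hv.subset ⟨hui, huj⟩

theorem isCutVertex (hL : IsChainGraph G J L) (hK : ∀ i ∈ J, KConnected (L i).coe 2) {i : ℤ} {v : V}
    (hi : i ∈ J) (hi' : i + 1 ∈ J) (hv : (L i).verts ∩ (L (i + 1)).verts = {v}) :
    IsCutVertex G v := fun hc => by
  obtain ⟨a, ha, hav⟩ := SimpleGraph.Subgraph.exists_ne_of_kConnected_two (hK i hi) v
  obtain ⟨b, hb, hbv⟩ := SimpleGraph.Subgraph.exists_ne_of_kConnected_two (hK _ hi') v
  obtain ⟨k, hk, hki, hbk⟩ := (hc.preconnected ⟨a, hav⟩ ⟨b, hbv⟩).of_closed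
    (P := fun u => ∃ k ∈ J, k ≤ i ∧ (u : V) ∈ (L k).verts) (by
      rintro ⟨u, hu⟩ ⟨w, hw⟩ huw ⟨k, hk, hki, huk⟩
      obtain ⟨j, hj, h⟩ := hL.exists_adj (show G.Adj u w from huw)
      refine ⟨j, hj, ?_, h.snd_mem⟩
      by_contra hji
      exact hu (hL.eq_of_mem_verts hk hj hki (by omega) hv huk h.fst_mem))
    ⟨i, hi, le_rfl, ha⟩
  exact hbv (hL.eq_of_mem_verts hk hi' hki (by omega) hv hbk hb)

theorem eq_vertex_of_mem_region (hL : IsChainGraph G J L) {i j k : ℤ} {v : V}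
    {x : GraphRealization G} (hi : i ∈ J) (hj : j ∈ J) (hik : i ≤ k) (hkj : k < j)
    (hv : (L k).verts ∩ (L (k + 1)).verts = {v}) (hxi : x ∈ region (L i))
    (hxj : x ∈ region (L j)) : x = vertex G v :=
  GraphRealization.eq_vertex_of_mem_region
    (fun _ hu => hL.eq_of_mem_verts hi hj hik hkj hv hu.1 hu.2) hxi hxj

/-- A chain graph with suitable links is 4-arc connected. -/
theorem nArcConn (hL : IsChainGraph G J L)
    (h1 : ∀ i ∈ J, KConnected (L i).coe 2 ∧ NArcConn (GraphRealization (L i).coe) 4)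
    (h2 : ∀ i ∈ J, i - 1 ∈ J → i + 1 ∈ J → ∃ (v w : V) (h : G.Adj v w), L i = G.subgraphOfAdj h)
    (h3 : ∀ v, IsCutVertex G v → ∀ i ∈ J, v ∈ (L i).verts → ((L i).neighborSet v).encard ≤ 2) :
    NArcConn (GraphRealization G) 4 := by
  classical
  refine nArcConn_iff.2 fun S hS => ?_
  by_cases hone : ∃ i ∈ J, (S : Set (GraphRealization G)) ⊆ region (L i)
  · obtain ⟨i, hi, hSi⟩ := hone
    obtain ⟨a, b, A, hab, hA, -, hSA⟩ := nArcConn_coe_iff.1 (h1 i hi).2 S hS hSi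
    exact ⟨a, b, A, hab, hA, hSA⟩
  have hcard : ∀ i ∈ J, (S.filter (· ∈ region (L i))).card ≤ 3 := fun i hi => by
    by_contra! hlt
    refine hone ⟨i, hi, fun x hx => ?_⟩
    have := Finset.eq_of_subset_of_card_le (Finset.filter_subset (· ∈ region (L i)) S) (by omega)
    rw [Finset.mem_coe, ← this, Finset.mem_filter] at hx
    exact hx.2
  choose ι hι hιS using hL.exists_mem_region
  have hne : S.Nonempty := by
    rw [Finset.nonempty_iff_ne_empty]
    rintro rfl
    obtain ⟨i, hi⟩ := hL.nonempty
    exact hone ⟨i, hi, by simp⟩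
  obtain ⟨p, hp, hpmin⟩ := S.exists_min_image ι hne
  obtain ⟨q, hq, hqmax⟩ := S.exists_max_image ι hne
  have hlt : ι p < ι q := by
    by_contra! hle
    refine hone ⟨ι p, hι p, fun x hx => ?_⟩
    have := hpmin x hx
    have := hqmax x hx
    obtain e : ι x = ι p := by omega
    exact e ▸ hιS x
  have hJ : ∀ i, ι p ≤ i → i ≤ ι q → i ∈ J := fun i hi hi' =>
    hL.ordConnected.out (hι p) (hι q) ⟨hi, hi'⟩
  have := hL.connected.nonempty
  choose! v hv using hL.link
  have hend : ∀ i ∈ J, ∀ j, j ∈ J → j + 1 ∈ J → (i = j ∨ i = j + 1) →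
      ∃ e A, ArcFromTo (vertex G (v j)) e A ∧ A ⊆ region (L i) ∧
        ∀ x ∈ S, x ∈ region (L i) → x ∈ A := fun i hi j hj hj' hij => by
    have hmem : v j ∈ (L i).verts := by
      have := (hv j hj hj').symm.subset rfl
      rcases hij with rfl | rfl
      exacts [this.1, this.2]
    obtain ⟨e, A, hA, hAi, hSA⟩ := exists_arc_in_region (h1 i hi).1 (h1 i hi).2 hmem
      (h3 _ (hL.isCutVertex (fun i hi => (h1 i hi).1) hj hj' (hv j hj hj')) i hi hmem) (hcard i hi)
      (fun x hx => (Finset.mem_filter.1 hx).2)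
    exact ⟨e, A, hA, hAi, fun x hx hxi => hSA (Finset.mem_filter.2 ⟨hx, hxi⟩)⟩
  have key : ∀ n : ℕ, ι p + n + 1 ≤ ι q → ∃ e A, ArcFromTo (vertex G (v (ι p + n))) e A ∧
      (∀ x ∈ A, ∃ i ∈ J, i ≤ ι p + n ∧ x ∈ region (L i)) ∧
      ∀ x ∈ S, ∀ i, ι p ≤ i → i ≤ ι p + n → x ∈ region (L i) → x ∈ A := by
    intro n
    induction n with
    | zero =>
      intro hn
      obtain ⟨e, A, hA, hAi, hSA⟩ := hend (ι p) (hι p) (ι p) (hι p) (hJ _ (by omega) (by omega))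
        (Or.inl rfl)
      refine ⟨e, A, by simpa using hA, fun x hx => ⟨_, hι p, by simp, hAi hx⟩,
        fun x hx i hi hi' hxi => hSA x hx ?_⟩
      obtain rfl : i = ι p := by push_cast at hi'; omega
      exact hxi
    | succ n ih =>
      intro hn
      push_cast at hn ⊢
      obtain ⟨e, A, hA, hAi, hSA⟩ := ih (by omega)
      rw [← add_assoc]
      rw [← add_assoc] at hn
      set j := ι p + n with hj
      have hj0 := hJ j (by omega) (by omega)
      have hj1 := hJ (j + 1) (by omega) (by omega)
      have hj2 := hJ (j + 1 + 1) (by omega) (by omega)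
      obtain ⟨a, b, hab, hLj⟩ := h2 (j + 1) hj1 (by simpa using hj0) hj2
      have m1 := (hv j hj0 hj1).symm.subset rfl
      have m2 := (hv (j + 1) hj1 hj2).symm.subset rfl
      have hvv : v (j + 1) ≠ v j := fun e => absurd
        ((hL.sep j hj0 _ hj2 (by omega)).subset ⟨m1.1, e ▸ m2.2⟩) (notMem_empty _)
      have hadj : (L (j + 1)).Adj (v (j + 1)) (v j) ∧
          (L (j + 1)).verts ⊆ {v (j + 1), v j} := by
        have k1 := m1.2
        have k2 := m2.1
        rw [hLj] at k1 k2 ⊢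
        simp only [SimpleGraph.subgraphOfAdj_verts, SimpleGraph.subgraphOfAdj_adj, mem_insert_iff,
          mem_singleton_iff, Sym2.eq_iff, insert_subset_iff, singleton_subset_iff] at k1 k2 ⊢
        clear * - k1 k2 hvv
        generalize v (j + 1) = c at *
        generalize v j = d at *
        grind
      refine ⟨e, _, (arcFromTo_edge hadj.1.adj_sub).concat' hA ?_, ?_, ?_⟩
      · intro x hx hxA
        obtain ⟨i, hi, hij, hxi⟩ := hAi x hxA
        exact hL.eq_vertex_of_mem_region hi hj1 hij (by omega) (hv j hj0 hj1) hxi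
          (edge_subset_region hadj.1 hx)
      · rintro x (hx | hx)
        · exact ⟨_, hj1, le_rfl, edge_subset_region hadj.1 hx⟩
        · obtain ⟨i, hi, hij, hxi⟩ := hAi x hx
          exact ⟨i, hi, by omega, hxi⟩
      · intro x hx i hi hij hxi
        rcases eq_or_lt_of_le hij with rfl | hlt
        · exact Or.inl (subset_edge_of_verts_subset hadj.1.adj_sub hadj.2 hxi)
        · exact Or.inr (hSA x hx i hi (by omega) hxi)
  obtain ⟨n, hn⟩ := Int.eq_ofNat_of_zero_le (a := ι q - ι p - 1) (by omega)
  obtain ⟨e, A, hA, hAi, hSA⟩ := key n (by omega)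
  obtain ⟨j, hj⟩ : ∃ j, j = ι p + n := ⟨_, rfl⟩
  rw [← hj] at hA hAi hSA
  have hqj : ι q = j + 1 := by omega
  have hj0 := hJ j (by omega) (by omega)
  have hj1 := hJ (j + 1) (by omega) (by omega)
  obtain ⟨e', B, hB, hBi, hSB⟩ := hend (j + 1) hj1 j hj0 hj1 (Or.inr rfl)
  have hmem : ∀ x ∈ S, x ∈ A ∪ B := fun x hx => by
    have h1 := hpmin x hx
    have h2 := hqmax x hx
    by_cases h : ι x ≤ j
    · exact Or.inl (hSA x hx _ h1 h (hιS x))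
    · refine Or.inr (hSB x hx ?_)
      obtain e : ι x = j + 1 := by omega
      exact e ▸ hιS x
  have hAB := hA.symm.concat' hB fun x hxA hxB => by
    obtain ⟨i, hi, hij, hxi⟩ := hAi x hxA
    exact hL.eq_vertex_of_mem_region hi hj1 hij (by omega) (hv j hj0 hj1) hxi (hBi hxB)
  exact ⟨_, _, _, hAB.ne_of_mem (hmem p hp) (hmem q hq) (fun e => hlt.ne (e ▸ rfl)), hAB, hmem⟩

end IsChainGraph

end ChainArcs

section Separation

open Set Topology GraphRealization

variable {V : Type*} {G : SimpleGraph V} {v w : V} {A D : Set V}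

/-- All edges leaving `A` end in the vertex `v ∉ A`. -/
def SeparatedAt (G : SimpleGraph V) (v : V) (A : Set V) : Prop :=
  v ∉ A ∧ ∀ a ∈ A, ∀ b, G.Adj a b → b ∈ A ∨ b = v

/-- A nonempty part of the graph that `v` separates from some other vertex. -/
structure IsSide (G : SimpleGraph V) (v : V) (A : Set V) : Prop where
  sep : SeparatedAt G v A
  nonempty : A.Nonempty
  exists_notMem : ∃ y, y ∉ A ∧ y ≠ v

namespace SeparatedAt

theorem compl (h : SeparatedAt G v A) : SeparatedAt G v {u | u ∉ A ∧ u ≠ v} := by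
  refine ⟨fun h => h.2 rfl, fun a ha b hab => ?_⟩
  by_contra! hb
  have hbA : b ∈ A := by
    by_contra hbA
    exact hb.1 ⟨hbA, hb.2⟩
  exact (h.2 b hbA a hab.symm).elim ha.1 ha.2

theorem exists_coord_pos (h : SeparatedAt G v A) {P : Set (GraphRealization G)}
    (hP : IsPreconnected P) (hv : vertex G v ∉ P) {x y : GraphRealization G} (hx : x ∈ P)
    (hy : y ∈ P) (hxA : ∃ u ∈ A, 0 < (x : V → ℝ) u) : ∃ u ∈ A, 0 < (y : V → ℝ) u :=
  exists_coord_pos_of_isPreconnected (C := {v}) h.2 hP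
    (fun _ hz => exists_coord_pos_of_ne_vertex fun e => hv (e ▸ hz)) hx hy hxA

theorem mem_of_coord_pos_vertex {u : V} (h : ∃ a ∈ A, 0 < (vertex G u : V → ℝ) a) : u ∈ A := by
  obtain ⟨a, ha, hp⟩ := h
  rwa [← eq_of_coord_pos_vertex hp]

theorem exists_coord_pos_vertex {u : V} (h : u ∈ A) : ∃ a ∈ A, 0 < (vertex G u : V → ℝ) a :=
  ⟨u, h, by rw [vertex_apply_self]; exact zero_lt_one⟩

end SeparatedAt

theorem SimpleGraph.Connected.of_closed (hc : G.Connected) {P : V → Prop}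
    (hP : ∀ u w, G.Adj u w → P u → P w) {a : V} (ha : P a) (b : V) : P b :=
  (hc.preconnected a b).of_closed hP ha

theorem ArcFromTo.isPreconnected_sdiff {X : Type*} [TopologicalSpace X] {a b : X} {A : Set X}
    (h : ArcFromTo a b A) : IsPreconnected (A \ {a}) := by
  obtain ⟨f, s, t, hst, hc, hi, rfl, -, rfl⟩ := h
  have : f '' Icc s t \ {f s} = f '' Ioc s t := by
    rw [← image_singleton, ← hi.image_sdiff_subset (singleton_subset_iff.2 (left_mem_Icc.2 hst)),
      Icc_sdiff_left]
  rw [this]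
  exact isPreconnected_Ioc.image f (hc.mono Ioc_subset_Icc_self)

namespace NArcConn

/-- Removing a vertex from a 3-arc connected graph leaves at most two components. -/
theorem false_of_separatedAt (hG : NArcConn (GraphRealization G) 4) {D : Fin 3 → Set V}
    {p : Fin 3 → V} (hD : ∀ i, SeparatedAt G v (D i)) (hp : ∀ i, p i ∈ D i)
    (hdis : ∀ i j, i ≠ j → p j ∉ D i) : False := by
  classical
  obtain ⟨a, b, A, -, hA, hSA⟩ := nArcConn_iff.1 hG (Finset.univ.image fun i => vertex G (p i))
    (Finset.card_image_le.trans (by simp))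
  obtain ⟨i, j, P, hij, hP, -, hvP⟩ := hA.exists_subarc_disjoint {vertex G v}
    (fun i => vertex G (p i)) (fun i => hSA (by simp))
    (fun i h => (hD i).1 (vertex_injective (Finset.mem_singleton.1 h) ▸ hp i)) (by simp)
  exact hdis i j hij (SeparatedAt.mem_of_coord_pos_vertex ((hD i).exists_coord_pos hP.isPreconnected
    (hvP _ (Finset.mem_singleton_self _)) hP.left_mem hP.right_mem
    (SeparatedAt.exists_coord_pos_vertex (hp i))))

theorem connected (hG : NArcConn (GraphRealization G) 4) : G.Connected := by
  classical
  have hne : Nonempty V := by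
    obtain ⟨a, b, A, -, hA, -⟩ := nArcConn_iff.1 hG ∅ (by simp)
    exact ⟨(GraphRealization.exists_coord_pos a).choose⟩
  refine ⟨fun a b => ?_⟩
  obtain ⟨c, d, A, -, hA, hSA⟩ := nArcConn_iff.1 hG {vertex G a, vertex G b}
    (Finset.card_le_two.trans (by norm_num))
  refine SeparatedAt.mem_of_coord_pos_vertex (G := G) (A := {u | G.Reachable a u})
    (exists_coord_pos_of_isPreconnected (C := ∅) (fun u hu w huw => Or.inl ?_) hA.isPreconnected
      (fun x _ => ?_) (hSA (by simp : vertex G a ∈ _)) (hSA (by simp))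
      (SeparatedAt.exists_coord_pos_vertex (SimpleGraph.Reachable.refl a)))
  · exact SimpleGraph.Reachable.trans hu huw.reachable
  · obtain ⟨u, hu⟩ := GraphRealization.exists_coord_pos x
    exact ⟨u, notMem_empty _, hu⟩

theorem exists_ne (hG : NArcConn (GraphRealization G) 4) (v : V) : ∃ w, w ≠ v := by
  obtain ⟨a, b, A, hab, hA, -⟩ := nArcConn_iff.1 hG ∅ (by simp)
  by_contra! h
  exact hab ((eq_vertex fun u _ => h u).trans (eq_vertex fun u _ => h u).symm)

end NArcConn

namespace IsSide

theorem compl (h : IsSide G v A) : IsSide G v {u | u ∉ A ∧ u ≠ v} :=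
  ⟨h.sep.compl, h.exists_notMem, h.nonempty.imp fun _ hx =>
    ⟨fun h' => h'.1 hx, fun e => h.sep.1 (e ▸ hx)⟩⟩

theorem subset_of_separatedAt (hG : NArcConn (GraphRealization G) 4) (h : IsSide G v A) (hDA : D ⊆ A)
    (hne : D.Nonempty) (hD : SeparatedAt G v D) : A ⊆ D := fun c hc => by
  by_contra hcD
  obtain ⟨y, hyA, hyv⟩ := h.exists_notMem
  obtain ⟨z, hz⟩ := hne
  refine hG.false_of_separatedAt (v := v) (D := ![D, A \ D, {u | u ∉ A ∧ u ≠ v}]) (p := ![z, c, y])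
    (fun i => ?_) (fun i => ?_) fun i j => ?_
  · fin_cases i
    · exact hD
    · refine ⟨fun h' => h.sep.1 h'.1, fun a ha b hab => ?_⟩
      rcases h.sep.2 a ha.1 b hab with hb | hb
      · by_cases hbD : b ∈ D
        · rcases hD.2 b hbD a hab.symm with h' | rfl
          exacts [absurd h' ha.2, absurd ha.1 h.sep.1]
        · exact Or.inl ⟨hb, hbD⟩
      · exact Or.inr hb
    · exact h.sep.compl
  · fin_cases i
    exacts [hz, ⟨hc, hcD⟩, ⟨hyA, hyv⟩]
  · have := hDA hz
    fin_cases i <;> fin_cases j <;> simp <;> grind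

theorem exists_adj (hG : NArcConn (GraphRealization G) 4) (h : IsSide G v A) :
    ∃ u ∈ A, G.Adj v u := by
  by_contra! hno
  obtain ⟨a, ha⟩ := h.nonempty
  exact h.sep.1 (hG.connected.of_closed (P := (· ∈ A)) (fun u w huw hu =>
    (h.sep.2 u hu w huw).resolve_right fun e => hno u hu (e ▸ huw.symm)) ha v)

/-- An arc that visits a vertex off a side can be parametrized so that it enters the side through
the separating vertex. -/
theorem exists_param (hG : NArcConn (GraphRealization G) 4) (h : IsSide G v A)
    {S : Finset (GraphRealization G)} (hS : S.card ≤ 3)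
    (hSA : ∀ x ∈ S, ∃ u ∈ A, 0 < (x : V → ℝ) u) (hne : S.Nonempty) :
    ∃ (f : ℝ → GraphRealization G) (s t : ℝ), ContinuousOn f (Icc s t) ∧ InjOn f (Icc s t) ∧
      f s = vertex G v ∧ ∀ x ∈ S, ∃ c ∈ Icc s t, f c = x := by
  classical
  obtain ⟨y, hyA, hyv⟩ := h.exists_notMem
  obtain ⟨a, b, P, -, hP, hSP⟩ := nArcConn_iff.1 hG (insert (vertex G y) S)
    ((Finset.card_insert_le _ _).trans (by omega))
  have hyP : vertex G y ∈ P := hSP (by simp)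
  have hSP' : ∀ x ∈ S, x ∈ P := fun x hx => hSP (by simp [hx])
  have hcross : ∀ Q : Set (GraphRealization G), IsPreconnected Q → vertex G y ∈ Q →
      ∀ x ∈ S, x ∈ Q → vertex G v ∈ Q := fun Q hQ hyQ x hx hxQ => by
    by_contra hv
    exact hyA (SeparatedAt.mem_of_coord_pos_vertex (h.sep.exists_coord_pos hQ hv hxQ hyQ (hSA x hx)))
  have hvP : vertex G v ∈ P := by
    obtain ⟨x, hx⟩ := hne
    exact hcross P hP.isPreconnected hyP x hx (hSP' x hx)
  obtain ⟨A₁, A₂, h₁, h₂, rfl, h₁₂⟩ := hP.split' hvP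
  suffices H : ∀ (b' : GraphRealization G) (B B' : Set (GraphRealization G)),
      ArcFromTo (vertex G v) b' B → IsPreconnected (B' \ {vertex G v}) → vertex G y ∈ B' →
      A₁ ∪ A₂ = B ∪ B' → ∃ (f : ℝ → GraphRealization G) (s t : ℝ), ContinuousOn f (Icc s t) ∧
        InjOn f (Icc s t) ∧ f s = vertex G v ∧ ∀ x ∈ S, ∃ c ∈ Icc s t, f c = x by
    rcases hyP with hy | hy
    · exact H b A₂ A₁ h₂ h₁.symm.isPreconnected_sdiff hy (union_comm _ _)
    · exact H a A₁ A₂ h₁.symm h₂.isPreconnected_sdiff hy rfl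
  intro b' B B' hB hB' hyB' hBB
  obtain ⟨f, s, t, hst, hc, hi, hs, -, rfl⟩ := hB
  refine ⟨f, s, t, hc, hi, hs, fun x hx => ?_⟩
  rcases hBB ▸ hSP' x hx with hxB | hxB
  · exact hxB
  · by_cases hxv : x = vertex G v
    · exact ⟨s, left_mem_Icc.2 hst, hs.trans hxv.symm⟩
    · exact absurd rfl (hcross _ hB' ⟨hyB', fun e => hyv (vertex_injective e)⟩ x hx ⟨hxB, hxv⟩).2

end IsSide

namespace GraphRealization

theorem edge_half_notMem {u : V} (h : G.Adj v u) (h' : G.Adj v w) (huw : u ≠ w) :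
    edge h (1 / 2) ∉ (edge h') '' Icc 0 (1 / 2) := by
  rintro ⟨t, -, e⟩
  have := congrArg (fun x : GraphRealization G => (x : V → ℝ) u) e
  simp only [edge_apply_of_ne h' h.ne' huw] at this
  rw [edge_apply_right h ⟨by norm_num, by norm_num⟩] at this
  norm_num at this

theorem vertex_notMem_edge {u : V} (h : G.Adj v w) (hv : u ≠ v) (hw : u ≠ w) (I : Set ℝ) :
    vertex G u ∉ edge h '' I := by
  rintro ⟨t, -, e⟩
  have := congrArg (fun x : GraphRealization G => (x : V → ℝ) u) e
  simp only [edge_apply_of_ne h hv hw, vertex_apply_self] at this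
  norm_num at this

end GraphRealization

namespace IsSide

/-- The vertex separating a side has at most two neighbors in it. -/
theorem encard_neighborSet_inter_le (hG : NArcConn (GraphRealization G) 4) (h : IsSide G v A) :
    (G.neighborSet v ∩ A).encard ≤ 2 := by
  classical
  by_contra! hlt
  obtain ⟨T, hTsub, hT⟩ := exists_subset_encard_eq (Order.add_one_le_of_lt hlt)
  obtain ⟨a, b, c, hab, hac, hbc, rfl⟩ := encard_eq_three.1 (hT.trans (by norm_num))
  simp only [insert_subset_iff, singleton_subset_iff] at hTsub
  obtain ⟨⟨ha, haA⟩, ⟨hb, hbA⟩, ⟨hc, hcA⟩⟩ := hTsub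
  rw [SimpleGraph.mem_neighborSet] at ha hb hc
  have hpos : ∀ u ∈ A, ∀ hu : G.Adj v u, ∃ a ∈ A, 0 < (edge hu (1 / 2) : V → ℝ) a :=
    fun u huA hu => ⟨u, huA, by
      rw [edge_apply_right hu ⟨by norm_num, by norm_num⟩]; norm_num⟩
  obtain ⟨f, s, t, hfc, hfi, hs, hS⟩ := h.exists_param hG
    (S := {edge ha (1 / 2), edge hb (1 / 2), edge hc (1 / 2)}) Finset.card_le_three (by
      simp only [Finset.mem_insert, Finset.mem_singleton]
      rintro x (rfl | rfl | rfl)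
      exacts [hpos a haA ha, hpos b hbA hb, hpos c hcA hc]) (by simp)
  obtain ⟨r₁, h₁, e₁⟩ := hS (edge ha (1 / 2)) (by simp)
  obtain ⟨r₂, h₂, e₂⟩ := hS (edge hb (1 / 2)) (by simp)
  obtain ⟨r₃, h₃, e₃⟩ := hS (edge hc (1 / 2)) (by simp)
  have key : ∀ {a b c : V} {p q r : ℝ} (ha : G.Adj v a) (hb : G.Adj v b) (hc : G.Adj v c),
      p ∈ Icc s t → r ∈ Icc s t → f p = edge ha (1 / 2) → f q = edge hb (1 / 2) →
      f r = edge hc (1 / 2) → p ≤ q → q ≤ r → a ≠ b → c ≠ b → False :=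
    fun ha hb hc hp hr ep eq er hpq hqr hab hcb =>
      false_of_midpoint_between hb hfc hfi hs hp.1 hpq hqr hr.2 eq
        (ep ▸ edge_half_notMem ha hb hab) (er ▸ edge_half_notMem hc hb hcb)
  rcases le_total r₁ r₂ with h12 | h12 <;> rcases le_total r₂ r₃ with h23 | h23 <;>
    rcases le_total r₁ r₃ with h13 | h13
  · exact key ha hb hc h₁ h₃ e₁ e₂ e₃ h12 h23 hab hbc.symm
  · exact key ha hb hc h₁ h₃ e₁ e₂ e₃ h12 h23 hab hbc.symm
  · exact key ha hc hb h₁ h₂ e₁ e₃ e₂ h13 h23 hac hbc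
  · exact key hc ha hb h₃ h₂ e₃ e₁ e₂ h13 h12 hac.symm hab.symm
  · exact key hb ha hc h₂ h₃ e₂ e₁ e₃ h12 h13 hab.symm hac.symm
  · exact key hb hc ha h₂ h₁ e₂ e₃ e₁ h23 h13 hbc hac
  · exact key hc hb ha h₃ h₁ e₃ e₂ e₁ h23 h12 hbc.symm hab
  · exact key hc hb ha h₃ h₁ e₃ e₂ e₁ h23 h12 hbc.symm hab

/-- If `v` has two neighbors in its side `A`, then no vertex of `A` separates part of `A`. -/
theorem not_separatedAt (hG : NArcConn (GraphRealization G) 4) (h : IsSide G v A) {a b : V}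
    (ha : G.Adj v a) (hb : G.Adj v b) (haA : a ∈ A) (hbA : b ∈ A) (hab : a ≠ b) (hw : w ∈ A)
    (hDA : D ⊆ A) (hne : D.Nonempty) : ¬ SeparatedAt G w D := fun hD => by
  classical
  obtain ⟨z, hz⟩ := hne
  have hvD : v ∉ D := fun h' => h.sep.1 (hDA h')
  have hnD : ∀ u, G.Adj v u → u ∉ D := fun u hu huD =>
    (hD.2 u huD v hu.symm).elim hvD fun e => h.sep.1 (e ▸ hw)
  have hzv : z ≠ v := by rintro rfl; exact hvD hz
  have hpos : ∀ u ∈ A, ∀ hu : G.Adj v u, ∃ a ∈ A, 0 < (edge hu (1 / 2) : V → ℝ) a :=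
    fun u huA hu => ⟨u, huA, by
      rw [edge_apply_right hu ⟨by norm_num, by norm_num⟩]; norm_num⟩
  obtain ⟨f, s, t, hfc, hfi, hs, hS⟩ := h.exists_param hG
    (S := {edge ha (1 / 2), edge hb (1 / 2), vertex G z}) Finset.card_le_three (by
      simp only [Finset.mem_insert, Finset.mem_singleton]
      rintro x (rfl | rfl | rfl)
      exacts [hpos a haA ha, hpos b hbA hb, SeparatedAt.exists_coord_pos_vertex (hDA hz)]) (by simp)
  obtain ⟨r₁, h₁, e₁⟩ := hS (edge ha (1 / 2)) (by simp)
  obtain ⟨r₂, h₂, e₂⟩ := hS (edge hb (1 / 2)) (by simp)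
  obtain ⟨r₃, h₃, e₃⟩ := hS (vertex G z) (by simp)
  have hcross : ∀ I : Set ℝ, I ⊆ Icc s t → IsPreconnected I → r₃ ∈ I → ∀ r ∈ I,
      (∀ u ∈ D, ¬ 0 < (f r : V → ℝ) u) → vertex G w ∈ f '' I := fun I hIs hI h₃ r hr hrD => by
    by_contra hw
    obtain ⟨u, hu, hu'⟩ := hD.exists_coord_pos (hI.image f (hfc.mono hIs)) hw
      (mem_image_of_mem f h₃) (mem_image_of_mem f hr)
      (e₃ ▸ SeparatedAt.exists_coord_pos_vertex hz)
    exact hrD u hu hu'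
  have hlast : ∀ r ∈ Icc s t, (∀ u ∈ D, ¬ 0 < (f r : V → ℝ) u) → r ≤ r₃ := fun r hr hrD => by
    by_contra! hlt
    have hsub₁ : Icc s r₃ ⊆ Icc s t := Icc_subset_Icc_right h₃.2
    have hsub₂ : Icc r₃ r ⊆ Icc s t := Icc_subset_Icc h₃.1 hr.2
    obtain ⟨p, hp, ep⟩ := hcross (Icc s r₃) hsub₁ isPreconnected_Icc (right_mem_Icc.2 h₃.1) s
      (left_mem_Icc.2 h₃.1) fun u hu h' => hvD (by
        rw [hs] at h'; rwa [← eq_of_coord_pos_vertex h'])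
    obtain ⟨q, hq, eq⟩ := hcross (Icc r₃ r) hsub₂ isPreconnected_Icc (left_mem_Icc.2 hlt.le) r
      (right_mem_Icc.2 hlt.le) hrD
    obtain rfl := hfi (hsub₁ hp) (hsub₂ hq) (ep.trans eq.symm)
    obtain rfl := le_antisymm hp.2 hq.1
    exact hD.1 (vertex_injective (ep.symm.trans e₃) ▸ hz)
  have hmid : ∀ {u : V} (hu : G.Adj v u) {r : ℝ}, r ∈ Icc s t → f r = edge hu (1 / 2) → r ≤ r₃ :=
    fun {u} hu r hr er => hlast r hr fun d hd h' => by
      rw [er] at h'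
      rcases eq_or_eq_of_coord_pos_edge hu h' with rfl | rfl
      exacts [hvD hd, hnD _ hu hd]
  have key : ∀ {a b : V} {p q : ℝ} (ha : G.Adj v a) (hb : G.Adj v b),
      p ∈ Icc s t → q ∈ Icc s t → f p = edge ha (1 / 2) → f q = edge hb (1 / 2) →
      p ≤ q → a ≠ b → False := fun ha hb hp hq ep eq hpq hab =>
    false_of_midpoint_between hb hfc hfi hs hp.1 hpq (hmid hb hq eq) h₃.2 eq
      (ep ▸ edge_half_notMem ha hb hab)
      (e₃ ▸ vertex_notMem_edge hb hzv (by rintro rfl; exact hnD _ hb hz) _)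
  rcases le_total r₁ r₂ with h12 | h12
  exacts [key ha hb h₁ h₂ e₁ e₂ h12 hab, key hb ha h₂ h₁ e₂ e₁ h12 hab.symm]

end IsSide

end Separation

section EndLinks

open Set Topology GraphRealization

variable {V : Type*} {G : SimpleGraph V} {v w : V} {A D : Set V}

namespace GraphRealization

theorem mem_region_induce {B : Set V} {x : GraphRealization G} :
    x ∈ region ((⊤ : G.Subgraph).induce B) ↔ ∀ u, 0 < (x : V → ℝ) u → u ∈ B :=
  ⟨fun h => h.1, fun h => ⟨h, fun u w huw hu hw => ⟨h u hu, h w hw, (eq_edge huw hu hw).1⟩⟩⟩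

end GraphRealization

namespace IsSide

/-- A side together with its separating vertex inherits 4-arc connectedness. -/
theorem nArcConn_induce (hG : NArcConn (GraphRealization G) 4) (h : IsSide G v A) :
    NArcConn (GraphRealization ((⊤ : G.Subgraph).induce (A ∪ {v})).coe) 4 := by
  classical
  refine nArcConn_coe_iff.2 fun S₀ hS₀ hS₀A => ?_
  obtain ⟨S, hSS, hS, hSA, hnt⟩ : ∃ S : Finset (GraphRealization G), S₀ ⊆ S ∧ S.card ≤ 4 ∧
      (S : Set (GraphRealization G)) ⊆ region ((⊤ : G.Subgraph).induce (A ∪ {v})) ∧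
      ∃ x ∈ S, ∃ y ∈ S, x ≠ y := by
    by_cases hlt : 1 < S₀.card
    · exact ⟨S₀, Subset.rfl, hS₀, hS₀A, Finset.one_lt_card.1 hlt⟩
    · obtain ⟨a, ha⟩ := h.nonempty
      refine ⟨insert (vertex G v) (insert (vertex G a) S₀), fun x hx => by simp [hx], ?_, ?_,
        vertex G v, by simp, vertex G a, by simp,
        fun e => h.sep.1 (vertex_injective e ▸ ha)⟩
      · have := Finset.card_insert_le (vertex G v) (insert (vertex G a) S₀)
        have := Finset.card_insert_le (vertex G a) S₀
        omega
      · rw [Finset.coe_insert, Finset.coe_insert]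
        refine insert_subset ?_ (insert_subset ?_ hS₀A)
        · exact vertex_mem_region.2 (Or.inr rfl)
        · exact vertex_mem_region.2 (Or.inl ha)
  obtain ⟨a, b, P, -, ⟨f, s, t, hst, hc, hi, -, -, rfl⟩, hSP⟩ := nArcConn_iff.1 hG S hS
  have hSP' : ∀ x ∈ S, ∃ r ∈ Icc s t, f r = x := fun x hx => hSP hx
  choose! r hr hfr using hSP'
  obtain ⟨x, hx, y, hy, hxy⟩ := hnt
  obtain ⟨p, hp, hpmin⟩ := S.exists_min_image r ⟨x, hx⟩
  obtain ⟨q, hq, hqmax⟩ := S.exists_max_image r ⟨x, hx⟩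
  have hpq : p ≠ q := by
    rintro rfl
    have e : r x = r y := le_antisymm ((hqmax x hx).trans (hpmin y hy))
      ((hqmax y hy).trans (hpmin x hx))
    exact hxy ((hfr _ hx).symm.trans (e ▸ hfr _ hy))
  have hsub : Icc (r p) (r q) ⊆ Icc s t := Icc_subset_Icc (hr _ hp).1 (hr _ hq).2
  refine ⟨p, q, f '' Icc (r p) (r q), hpq, ⟨f, _, _, hpmin q hq, hc.mono hsub, hi.mono hsub,
    hfr _ hp, hfr _ hq, rfl⟩, ?_, fun x hx => ⟨r x, ⟨hpmin x (hSS hx), hqmax x (hSS hx)⟩,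
    hfr _ (hSS hx)⟩⟩
  rintro _ ⟨c, hcm, rfl⟩
  by_contra hcr
  rw [mem_region_induce] at hcr
  push Not at hcr
  obtain ⟨u, hu, huA⟩ := hcr
  have huA' : u ∉ A ∧ u ≠ v := ⟨fun h' => huA (Or.inl h'), fun h' => huA (Or.inr h')⟩
  have hcross : ∀ I ⊆ Icc s t, IsPreconnected I → c ∈ I → ∀ z ∈ S, r z ∈ I →
      vertex G v ∈ f '' I := fun I hIs hI hcI z hz hzI => by
    by_contra hv
    obtain ⟨d, hd, hd'⟩ := h.sep.compl.exists_coord_pos (hI.image f (hc.mono hIs)) hv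
      (mem_image_of_mem f hcI) (mem_image_of_mem f hzI) ⟨u, huA', hu⟩
    rw [hfr _ hz] at hd'
    rcases mem_region_induce.1 (hSA hz) d hd' with h' | h'
    exacts [hd.1 h', hd.2 h']
  have hsub₁ : Icc (r p) c ⊆ Icc s t := Icc_subset_Icc (hr _ hp).1 (hcm.2.trans (hr _ hq).2)
  have hsub₂ : Icc c (r q) ⊆ Icc s t := Icc_subset_Icc ((hr _ hp).1.trans hcm.1) (hr _ hq).2
  obtain ⟨i, hip, ei⟩ := hcross _ hsub₁ isPreconnected_Icc (right_mem_Icc.2 hcm.1) p hp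
    (left_mem_Icc.2 hcm.1)
  obtain ⟨j, hjq, ej⟩ := hcross _ hsub₂ isPreconnected_Icc (left_mem_Icc.2 hcm.2) q hq
    (right_mem_Icc.2 hcm.2)
  obtain rfl := hi (hsub₁ hip) (hsub₂ hjq) (ei.trans ej.symm)
  obtain rfl := le_antisymm hip.2 hjq.1
  rw [ei] at hu
  exact huA'.2 (eq_of_coord_pos_vertex hu)

end IsSide

/-- A subgraph is 2-connected if it is not separated by removing at most one vertex. -/
theorem SimpleGraph.Subgraph.kConnected_two_coe {H : G.Subgraph} (hH : H.verts.Nontrivial)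
    (h0 : ∀ D ⊆ H.verts, D.Nonempty → (∀ a ∈ D, ∀ b, H.Adj a b → b ∈ D) → H.verts ⊆ D)
    (h1 : ∀ w ∈ H.verts, ∀ D ⊆ H.verts, D.Nonempty → w ∉ D →
      (∀ a ∈ D, ∀ b, H.Adj a b → b ∈ D ∨ b = w) → ∀ c ∈ H.verts, c ∈ D ∨ c = w) :
    KConnected H.coe 2 := by
  intro S hS
  have hS' : S = ∅ ∨ ∃ w, S = {w} := encard_le_one_iff_eq.1 (Order.le_of_lt_add_one (by
    rw [one_add_one_eq_two]; exact hS))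
  have hne : Nonempty (Sᶜ : Set H.verts) := by
    rcases hS' with rfl | ⟨w, rfl⟩
    · obtain ⟨x, hx⟩ := hH.nonempty
      exact ⟨⟨⟨x, hx⟩, notMem_empty _⟩⟩
    · obtain ⟨x, hx, hxw⟩ := hH.exists_ne w
      exact ⟨⟨⟨x, hx⟩, fun e => hxw (congrArg Subtype.val e)⟩⟩
  refine ⟨fun a b => ?_⟩
  set K := H.coe.induce (Sᶜ : Set H.verts)
  have hstep : ∀ x, ∀ y (hy : y ∈ H.verts), (∃ z, K.Reachable a z ∧ (z : V) = x) → H.Adj x y →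
      (∃ z, K.Reachable a z ∧ (z : V) = y) ∨ ⟨y, hy⟩ ∈ S := by
    rintro _ y hy ⟨z, hz, rfl⟩ hzy
    by_cases hyS : (⟨y, hy⟩ : H.verts) ∈ S
    · exact Or.inr hyS
    · exact Or.inl ⟨⟨⟨y, hy⟩, hyS⟩, hz.trans (SimpleGraph.Adj.reachable hzy), rfl⟩
  have hsub : {x | ∃ z, K.Reachable a z ∧ (z : V) = x} ⊆ H.verts := by
    rintro _ ⟨z, -, rfl⟩
    exact z.1.2
  have hmem : ∃ z, K.Reachable a z ∧ (z : V) = b := by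
    rcases hS' with rfl | ⟨w, rfl⟩
    · exact h0 _ hsub ⟨_, a, .refl _, rfl⟩ (fun x hx y hxy =>
        (hstep x y hxy.snd_mem hx hxy).resolve_right (notMem_empty _)) b.1.2
    · refine (h1 w w.2 _ hsub ⟨_, a, .refl _, rfl⟩ ?_ (fun x hx y hxy =>
        (hstep x y hxy.snd_mem hx hxy).imp_right fun e => congrArg Subtype.val e) b
        b.1.2).resolve_right fun e => b.2 (Subtype.ext e)
      rintro ⟨z, -, e⟩
      exact z.2 (Subtype.ext e)
  obtain ⟨z, hz, e⟩ := hmem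
  obtain rfl : z = b := Subtype.ext (Subtype.ext e)
  exact hz

theorem SimpleGraph.Subgraph.kConnected_two_subgraphOfAdj (h : G.Adj v w) :
    KConnected (G.subgraphOfAdj h).coe 2 := by
  refine kConnected_two_coe ⟨v, by simp, w, by simp, h.ne⟩ ?_ ?_
  · rintro D hD ⟨x, hx⟩ hcl
    have hx' := hD hx
    simp only [SimpleGraph.subgraphOfAdj_verts, mem_insert_iff, mem_singleton_iff,
      insert_subset_iff, singleton_subset_iff] at hx' ⊢
    rcases hx' with rfl | rfl
    · exact ⟨hx, hcl _ hx w (by simp)⟩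
    · exact ⟨hcl _ hx v (by simp), hx⟩
  · intro u hu D hD hne huD hcl c hc
    obtain ⟨x, hx⟩ := hne
    have hx' := hD hx
    simp only [SimpleGraph.subgraphOfAdj_verts, mem_insert_iff, mem_singleton_iff] at hx' hu hc
    grind

/-- No vertex of `A` separates a part of `A`. -/
def IsTerminal (G : SimpleGraph V) (A : Set V) : Prop :=
  ∀ w ∈ A, ∀ D ⊆ A, D.Nonempty → ¬ SeparatedAt G w D

namespace IsSide

theorem kConnected_two (hG : NArcConn (GraphRealization G) 4) (h : IsSide G v A)
    (hA : IsTerminal G A) : KConnected ((⊤ : G.Subgraph).induce (A ∪ {v})).coe 2 := by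
  obtain ⟨a, ha⟩ := h.nonempty
  have hav : a ≠ v := by rintro rfl; exact h.sep.1 ha
  have hmem : ∀ x ∈ A, ∀ y, G.Adj x y → y ∈ A ∪ {v} := h.sep.2
  have hadj : ∀ x ∈ A ∪ {v}, ∀ y ∈ A ∪ {v}, G.Adj x y →
    ((⊤ : G.Subgraph).induce (A ∪ {v})).Adj x y := fun x hx y hy hxy => ⟨hx, hy, hxy⟩
  have hout : ∀ D ⊆ A, D.Nonempty → (∀ a ∈ D, ∀ b,
      ((⊤ : G.Subgraph).induce (A ∪ {v})).Adj a b → b ∈ D ∨ b = v) → A ⊆ D := fun D hD hne hcl =>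
    h.subset_of_separatedAt hG hD hne ⟨fun h' => h.sep.1 (hD h'), fun x hx y hxy =>
      hcl x hx y (hadj x (Or.inl (hD hx)) y (hmem x (hD hx) y hxy) hxy)⟩
  refine SimpleGraph.Subgraph.kConnected_two_coe ⟨a, Or.inl ha, v, Or.inr rfl, hav⟩ ?_ ?_
  · intro D hD hne hcl
    obtain ⟨u, hu, hvu⟩ := h.exists_adj hG
    have hne' : (D \ {v}).Nonempty := by
      obtain ⟨x, hx⟩ := hne
      by_cases hxv : x = v
      · subst hxv
        exact ⟨u, hcl x hx u (hadj x (Or.inr rfl) u (Or.inl hu) hvu), hvu.ne'⟩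
      · exact ⟨x, hx, hxv⟩
    have hAD : A ⊆ D \ {v} := hout _ (fun x hx => (hD hx.1).resolve_right hx.2) hne'
      fun x hx y hxy => by
        by_cases hyv : y = v
        · exact Or.inr hyv
        · exact Or.inl ⟨hcl x hx.1 y hxy, hyv⟩
    rintro x (hx | rfl)
    · exact (hAD hx).1
    · exact hcl u (hAD hu).1 x (hadj u (Or.inl hu) x (Or.inr rfl) hvu.symm)
  · intro w hw D hD hne hwD hcl
    rcases hw with hwA | rfl
    · have hwv : w ≠ v := by rintro rfl; exact h.sep.1 hwA
      by_cases hvD : v ∈ D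
      · by_contra! hex
        obtain ⟨c, hc, hcD, hcw⟩ := hex
        have hcA : c ∈ A := hc.resolve_right fun e => hcD (e ▸ hvD)
        refine hA w hwA {x | x ∈ A ∧ x ∉ D ∧ x ≠ w} (fun x hx => hx.1) ⟨c, hcA, hcD, hcw⟩
          ⟨fun h' => h'.2.2 rfl, fun x hx y hxy => ?_⟩
        have hyA := hmem x hx.1 y hxy
        have hyD : y ∉ D := fun hyD =>
          (hcl y hyD x (hadj y hyA x (Or.inl hx.1) hxy.symm)).elim hx.2.1 hx.2.2
        by_cases hyw : y = w
        · exact Or.inr hyw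
        · exact Or.inl ⟨hyA.resolve_right fun e => hyD (e ▸ hvD), hyD, hyw⟩
      · have hDA : D ⊆ A := fun x hx => (hD hx).resolve_right fun e => hvD (e ▸ hx)
        exact absurd ⟨hwD, fun x hx y hxy => hcl x hx y
          (hadj x (hD hx) y (hmem x (hDA hx) y hxy) hxy)⟩ (hA w hwA D hDA hne)
    · have := hout D (fun x hx => (hD hx).resolve_right fun e => hwD (e ▸ hx)) hne hcl
      rintro c (hc | hc)
      exacts [Or.inl (this hc), Or.inr hc]

/-- If the side `A` of `v` is not terminal, then `v` has a unique neighbor `u` in `A`, and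
`A \ {u}` is a side of `u`. -/
theorem exists_next (hG : NArcConn (GraphRealization G) 4) (h : IsSide G v A)
    (hA : ¬ IsTerminal G A) {u : V} (hu : u ∈ A) (hvu : G.Adj v u) :
    (∀ a ∈ A, G.Adj v a → a = u) ∧ IsSide G u (A \ {u}) := by
  unfold IsTerminal at hA
  push Not at hA
  obtain ⟨w, hw, D, hDA, hne, hD⟩ := hA
  have huniq : ∀ a ∈ A, G.Adj v a → a = u := fun a ha hva => by
    by_contra hau
    exact h.not_separatedAt hG hva hvu ha hu hau hw hDA hne hD
  refine ⟨huniq, ⟨fun h' => h'.2 rfl, fun a ha b hab => ?_⟩, ?_, v, fun h' => h.sep.1 h'.1, hvu.ne⟩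
  · rcases h.sep.2 a ha.1 b hab with hb | rfl
    · by_cases hbu : b = u
      exacts [Or.inr hbu, Or.inl ⟨hb, hbu⟩]
    · exact absurd (huniq a ha.1 hab.symm) ha.2
  · obtain ⟨z, hz⟩ := hne
    by_cases hzu : z = u
    · refine ⟨w, hw, fun e => ?_⟩
      exact hD.1 ((mem_singleton_iff.1 e).trans hzu.symm ▸ hz)
    · exact ⟨z, hDA hz, hzu⟩

theorem exists_of_isCutVertex (hG : NArcConn (GraphRealization G) 4)
    (hw : IsCutVertex G w) : ∃ D, IsSide G w D := by
  have hne : Nonempty ({w}ᶜ : Set V) := by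
    obtain ⟨x, hx⟩ := hG.exists_ne w
    exact ⟨⟨x, hx⟩⟩
  by_contra! hno
  refine hw ⟨fun a b => ?_⟩
  by_contra hab
  refine hno {x | ∃ y : ({w}ᶜ : Set V), (G.induce ({w}ᶜ : Set V)).Reachable a y ∧ (y : V) = x}
    ⟨⟨?_, ?_⟩, ⟨a, a, .refl _, rfl⟩, b, ?_, b.2⟩
  · rintro ⟨y, -, e⟩
    exact y.2 e
  · rintro _ ⟨y, hy, rfl⟩ c hyc
    by_cases hcw : c = w
    · exact Or.inr hcw
    · exact Or.inl ⟨⟨c, hcw⟩, hy.trans (SimpleGraph.Adj.reachable hyc), rfl⟩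
  · rintro ⟨y, hy, e⟩
    exact hab (Subtype.ext e ▸ hy)

/-- No vertex of a terminal side is a cut vertex. -/
theorem notMem_of_isCutVertex (hG : NArcConn (GraphRealization G) 4) (h : IsSide G v A)
    (hA : IsTerminal G A) (hw : IsCutVertex G w) : w ∉ A := fun hwA => by
  obtain ⟨D, hD⟩ := exists_of_isCutVertex hG hw
  have hvw : v ≠ w := by rintro rfl; exact h.sep.1 hwA
  obtain ⟨F, hF, hvF⟩ : ∃ F, IsSide G w F ∧ v ∉ F := by
    by_cases hvD : v ∈ D
    · exact ⟨_, hD.compl, fun h' => h'.1 hvD⟩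
    · exact ⟨D, hD, hvD⟩
  obtain ⟨y, hyF, hwy⟩ := hF.exists_adj hG
  have hyA : y ∈ A := (h.sep.2 w hwA y hwy).resolve_right fun e => hvF (e ▸ hyF)
  refine hA w hwA (F ∩ A) inter_subset_right ⟨y, hyF, hyA⟩ ⟨fun h' => hF.sep.1 h'.1,
    fun a ha b hab => ?_⟩
  rcases hF.sep.2 a ha.1 b hab with hb | hb
  · exact Or.inl ⟨hb, (h.sep.2 a ha.2 b hab).resolve_right fun e => hvF (e ▸ hb)⟩
  · exact Or.inr hb

end IsSide

end EndLinks

section Rays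

open Set Topology GraphRealization

variable {V : Type*} {G : SimpleGraph V} {v : V} {A B : Set V}

/-- A one-sided chain of links decomposing the side `A` of `v`, starting at `v`. -/
structure IsRay (G : SimpleGraph V) (v : V) (A : Set V) (J : Set ℕ) (L : ℕ → G.Subgraph) : Prop where
  zero_mem : 0 ∈ J
  mem_of_succ : ∀ n, n + 1 ∈ J → n ∈ J
  base_mem : v ∈ (L 0).verts
  verts_subset : ∀ n ∈ J, (L n).verts ⊆ A ∪ {v}
  base_notMem : ∀ n, n + 1 ∈ J → v ∉ (L (n + 1)).verts
  exists_adj : ∀ a ∈ A, ∀ b, G.Adj a b → ∃ n ∈ J, (L n).Adj a b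
  sep : ∀ i ∈ J, ∀ j ∈ J, i + 1 < j → (L i).verts ∩ (L j).verts = ∅
  link : ∀ i, i + 1 ∈ J → ∃ w, (L i).verts ∩ (L (i + 1)).verts = {w}
  good : ∀ i ∈ J, KConnected (L i).coe 2 ∧ NArcConn (GraphRealization (L i).coe) 4
  edge : ∀ i, i + 1 ∈ J → ∃ (u w : V) (h : G.Adj u w), L i = G.subgraphOfAdj h
  degree : ∀ w, IsCutVertex G w → ∀ i ∈ J, w ∈ (L i).verts → ((L i).neighborSet w).encard ≤ 2

open Classical in
/-- Successively pass from a vertex and one of its sides to a neighbor in the side and the rest of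
the side. -/
noncomputable def raySequence (G : SimpleGraph V) (v : V) (A : Set V) : ℕ → V × Set V
  | 0 => (v, A)
  | n + 1 =>
    let u := @Classical.epsilon V ⟨v⟩ fun u =>
      u ∈ (raySequence G v A n).2 ∧ G.Adj (raySequence G v A n).1 u
    (u, (raySequence G v A n).2 \ {u})

theorem IsSide.exists_ray (hG : NArcConn (GraphRealization G) 4) (h : IsSide G v A) :
    ∃ J L, IsRay G v A J L := by
  classical
  obtain ⟨x, B, hx0, hB0, hxB, hBx⟩ : ∃ (x : ℕ → V) (B : ℕ → Set V), x 0 = v ∧ B 0 = A ∧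
      (∀ n, (∃ u ∈ B n, G.Adj (x n) u) → x (n + 1) ∈ B n ∧ G.Adj (x n) (x (n + 1))) ∧
      ∀ n, B (n + 1) = B n \ {x (n + 1)} :=
    ⟨fun n => (raySequence G v A n).1, fun n => (raySequence G v A n).2, rfl, rfl,
      fun n hn => Classical.epsilon_spec hn, fun n => rfl⟩
  let J : Set ℕ := {n | ∀ k < n, ¬ IsTerminal G (B k)}
  have hJ : ∀ n, n + 1 ∈ J ↔ n ∈ J ∧ ¬ IsTerminal G (B n) := fun n => by
    simp only [J, mem_ofPred_eq, Nat.lt_succ_iff_lt_or_eq]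
    grind
  have hside : ∀ n ∈ J, IsSide G (x n) (B n) := by
    intro n
    induction n with
    | zero => exact fun _ => by rwa [hx0, hB0]
    | succ n ih =>
      intro hn
      obtain ⟨hn, ht⟩ := (hJ n).1 hn
      obtain ⟨hm, ha⟩ := hxB n ((ih hn).exists_adj hG)
      rw [hBx]
      exact ((ih hn).exists_next hG ht hm ha).2
  have hnext : ∀ n, n + 1 ∈ J → x (n + 1) ∈ B n ∧ G.Adj (x n) (x (n + 1)) ∧
      ∀ a ∈ B n, G.Adj (x n) a → a = x (n + 1) := fun n hn => by
    obtain ⟨hn, ht⟩ := (hJ n).1 hn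
    obtain ⟨hm, ha⟩ := hxB n ((hside n hn).exists_adj hG)
    exact ⟨hm, ha, ((hside n hn).exists_next hG ht hm ha).1⟩
  have hanti : Antitone B := antitone_nat_of_succ_le fun n => by
    rw [hBx]
    exact sdiff_subset
  have hdown : ∀ m ∈ J, ∀ n ≤ m, n ∈ J := fun m hm n hnm k hk => hm k (hk.trans_le hnm)
  have hsub : ∀ n m, n < m → m ∈ J → B m ∪ {x m} ⊆ B n := fun n m hnm hm => by
    obtain ⟨m, rfl⟩ : ∃ k, m = k + 1 := ⟨m - 1, by omega⟩
    rintro y (hy | rfl)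
    · exact hanti hnm.le hy
    · exact hanti (Nat.le_of_lt_succ hnm) (hnext m hm).1
  let L : ℕ → G.Subgraph := fun n =>
    if IsTerminal G (B n) then (⊤ : G.Subgraph).induce (B n ∪ {x n})
    else if hn : G.Adj (x n) (x (n + 1)) then G.subgraphOfAdj hn else ⊥
  have hterm : ∀ n, IsTerminal G (B n) → L n = (⊤ : G.Subgraph).induce (B n ∪ {x n}) :=
    fun n hn => if_pos hn
  have hedge : ∀ n (hn : n + 1 ∈ J), L n = G.subgraphOfAdj (hnext n hn).2.1 := fun n hn => by
    simp only [L]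
    rw [if_neg ((hJ n).1 hn).2, dif_pos (hnext n hn).2.1]
  have hcases : ∀ n ∈ J, IsTerminal G (B n) ∨ n + 1 ∈ J := fun n hn => by
    rw [hJ]
    tauto
  have hverts : ∀ n, n + 1 ∈ J → (L n).verts = {x n, x (n + 1)} := fun n hn => by
    rw [hedge n hn, SimpleGraph.subgraphOfAdj_verts]
  have hLsub : ∀ n ∈ J, (L n).verts ⊆ B n ∪ {x n} := fun n hn => by
    rcases hcases n hn with ht | hn'
    · rw [hterm n ht]
      rfl
    · rw [hverts n hn']
      rintro y (rfl | rfl)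
      exacts [Or.inr rfl, Or.inl (hnext n hn').1]
  have hmem : ∀ n ∈ J, x n ∈ (L n).verts := fun n hn => by
    rcases hcases n hn with ht | hn'
    · rw [hterm n ht]
      exact Or.inr rfl
    · rw [hverts n hn']
      exact Or.inl rfl
  have h0 : 0 ∈ J := fun k hk => absurd hk (Nat.not_lt_zero k)
  refine ⟨J, L, h0, fun n hn => ((hJ n).1 hn).1, hx0 ▸ hmem 0 h0, fun n hn => ?_, fun n hn h' => ?_,
    fun a ha b hab => ?_, fun i hi j hj hij => ?_, fun i hi => ⟨x (i + 1), ?_⟩, fun i hi => ?_,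
    fun i hi => ⟨_, _, _, hedge i hi⟩, fun w hw i hi hwi => ?_⟩
  · refine (hLsub n hn).trans (union_subset ?_ ?_)
    · exact (hB0 ▸ hanti (Nat.zero_le n)).trans subset_union_left
    · rcases Nat.eq_zero_or_pos n with rfl | hpos
      · rw [hx0]
        exact subset_union_right
      · exact (subset_union_right.trans (hB0 ▸ hsub 0 n hpos hn)).trans subset_union_left
  · exact h.sep.1 (hB0 ▸ hsub 0 (n + 1) (Nat.succ_pos n) hn (hLsub _ hn h'))
  · by_contra! hno
    have hedge_adj : ∀ n ∈ J, a ∈ B n ∪ {x n} → b ∈ B n ∪ {x n} → n + 1 ∈ J := fun n hn han hbn =>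
      (hcases n hn).resolve_left fun ht => hno n hn (by
        rw [hterm n ht]
        exact ⟨han, hbn, hab⟩)
    have key : ∀ n, n ∈ J ∧ a ∈ B n ∪ {x n} ∧ b ∈ B n ∪ {x n} := by
      intro n
      induction n with
      | zero =>
        rw [hB0, hx0]
        exact ⟨h0, Or.inl ha, h.sep.2 a ha b hab⟩
      | succ n ih =>
        obtain ⟨hn, han, hbn⟩ := ih
        have hn1 := hedge_adj n hn han hbn
        have hno' := hno n hn
        rw [hedge n hn1, SimpleGraph.subgraphOfAdj_adj, Sym2.eq_iff] at hno'
        have hu := (hnext n hn1).2.2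
        have hne := hab.ne
        have hax : a ≠ x n := fun e =>
          hno' (.inl ⟨e.symm, (hu b (hbn.resolve_right fun e' => hne (e.trans e'.symm))
            (e ▸ hab)).symm⟩)
        have hbx : b ≠ x n := fun e =>
          hno' (.inr ⟨e.symm, (hu a (han.resolve_right fun e' => hne (e'.trans e.symm))
            (e ▸ hab.symm)).symm⟩)
        rw [hBx]
        have haB := han.resolve_right hax
        have hbB := hbn.resolve_right hbx
        refine ⟨hn1, ?_, ?_⟩
        · by_cases e : a = x (n + 1)
          exacts [.inr e, .inl ⟨haB, e⟩]
        · by_cases e : b = x (n + 1)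
          exacts [.inr e, .inl ⟨hbB, e⟩]
    have hall : ∀ n, n ∈ J := fun n => (key n).1
    have hstep : ∀ n y y', y ∉ B n → G.Adj y y' → y' ∉ B (n + 1) := by
      intro n y y' hy hyy' hy'
      rw [hBx] at hy'
      have hyx : y = x n := ((hside n (hall n)).sep.2 y' hy'.1 y hyy'.symm).resolve_left hy
      exact hy'.2 ((hnext n (hall _)).2.2 y' hy'.1 (hyx ▸ hyy'))
    obtain ⟨n, hn⟩ : ∃ n, a ∉ B n :=
      hG.connected.of_closed (P := fun y => ∃ n, y ∉ B n)
        (fun y y' hyy' ⟨n, hn⟩ => ⟨n + 1, hstep n y y' hn hyy'⟩)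
        (a := v) ⟨0, hB0 ▸ h.sep.1⟩ a
    exact (key (n + 1)).2.1.elim (fun h' => hn (hanti (Nat.le_succ n) h'))
      fun e => hn (e ▸ (hnext n (hall _)).1)
  · rw [hverts i (hdown j hj _ hij.le), ← disjoint_iff_inter_eq_empty, disjoint_left]
    have hs := hside (i + 1) (hdown j hj _ hij.le)
    rintro y hy hyj
    have hyB := hsub _ j hij hj (hLsub j hj hyj)
    rcases hy with rfl | rfl
    · exact (hside i (hdown j hj _ (by omega))).sep.1 (hanti (Nat.le_succ i) hyB)
    · exact hs.sep.1 hyB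
  · rw [hverts i hi]
    refine Subset.antisymm ?_ ?_
    · rintro y ⟨rfl | rfl, hy⟩
      · exact absurd (hsub i (i + 1) (Nat.lt_succ_self i) hi (hLsub _ hi hy))
          (hside i ((hJ i).1 hi).1).sep.1
      · rfl
    · rintro y rfl
      exact ⟨Or.inr rfl, hmem _ hi⟩
  · rcases hcases i hi with ht | hi'
    · rw [hterm i ht]
      exact ⟨(hside i hi).kConnected_two hG ht, (hside i hi).nArcConn_induce hG⟩
    · rw [hedge i hi']
      exact ⟨SimpleGraph.Subgraph.kConnected_two_subgraphOfAdj _,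
        nArcConn_of_verts_subset (v := x i) (w := x (i + 1)) (by simp) (by simp)⟩
  · rcases hcases i hi with ht | hi'
    · rw [hterm i ht] at hwi ⊢
      rcases hwi with hwi | hwi
      · exact absurd hwi ((hside i hi).notMem_of_isCutVertex hG ht hw)
      · obtain rfl : w = x i := hwi
        refine (encard_le_encard ?_).trans ((hside i hi).encard_neighborSet_inter_le hG)
        rintro y ⟨-, hy, hxy⟩
        exact ⟨hxy, hy.resolve_right fun e => hxy.ne e.symm⟩
    · refine (encard_le_encard (SimpleGraph.Subgraph.neighborSet_subset_verts _ _)).trans ?_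
      rw [hverts i hi']
      exact (encard_insert_le _ _).trans (by rw [encard_singleton]; rfl)

end Rays

section Decomposition

open Set Topology GraphRealization

variable {V : Type*} {G : SimpleGraph V} {v : V} {A B : Set V}

/-- The bi-infinite sequence with values `f 0, f 1, …` at `0, 1, …` and `g 0, g 1, …` at
`-1, -2, …`. -/
def biSequence {α : Type*} (f g : ℕ → α) : ℤ → α
  | .ofNat n => f n
  | .negSucc n => g n

theorem IsRay.mem_of_le {J : Set ℕ} {L : ℕ → G.Subgraph} (h : IsRay G v A J L) {m n : ℕ}
    (hmn : m ≤ n) (hn : n ∈ J) : m ∈ J := by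
  induction hmn with
  | refl => exact hn
  | step _ ih => exact ih (h.mem_of_succ _ hn)

theorem IsRay.eq_of_mem {JA JB : Set ℕ} {LA LB : ℕ → G.Subgraph} (hA : IsRay G v A JA LA)
    (hB : IsRay G v B JB LB) (hAB : Disjoint A B) {m n : ℕ} {u : V} (hm : m ∈ JA) (hn : n ∈ JB)
    (hum : u ∈ (LA m).verts) (hun : u ∈ (LB n).verts) : u = v ∧ m = 0 ∧ n = 0 := by
  obtain rfl : u = v := by
    rcases hA.verts_subset m hm hum with huA | hu
    · exact (hB.verts_subset n hn hun).resolve_left fun huB => disjoint_left.1 hAB huA huB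
    · exact hu
  refine ⟨rfl, ?_, ?_⟩
  · cases m with
    | zero => rfl
    | succ m => exact absurd hum (hA.base_notMem m hm)
  · cases n with
    | zero => rfl
    | succ n => exact absurd hun (hB.base_notMem n hn)

theorem IsRay.isChainGraph_biSequence {JA JB : Set ℕ} {LA LB : ℕ → G.Subgraph}
    (hG : NArcConn (GraphRealization G) 4) (hA : IsRay G v A JA LA) (hB : IsRay G v B JB LB)
    (hAB : Disjoint A B) (hU : ∀ u, u ≠ v → u ∈ A ∨ u ∈ B) :
    IsChainGraph G {i | biSequence (· ∈ JA) (· ∈ JB) i} (biSequence LA LB) where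
  connected := hG.connected
  ordConnected := by
    refine ⟨fun i hi k hk j ⟨hij, hjk⟩ => ?_⟩
    rcases j with n | n
    · rcases k with m | m
      · exact hA.mem_of_le (Int.ofNat_le.1 hjk) hk
      · exact absurd (hjk.trans_lt (Int.negSucc_lt_zero m)) (by simp)
    · rcases i with m | m
      · exact absurd (hij.trans_lt (Int.negSucc_lt_zero n)) (by simp)
      · exact hB.mem_of_le (by omega) hi
  nonempty := ⟨0, hA.zero_mem⟩
  cover := by
    have hadj : ∀ a b, G.Adj a b → ∃ i, biSequence (· ∈ JA) (· ∈ JB) i ∧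
        (biSequence LA LB i).Adj a b := by
      have hone : ∀ a b, a ≠ v → G.Adj a b → ∃ i, biSequence (· ∈ JA) (· ∈ JB) i ∧
          (biSequence LA LB i).Adj a b := fun a b ha hab => by
        rcases hU a ha with ha | ha
        · obtain ⟨n, hn, h⟩ := hA.exists_adj a ha b hab
          exact ⟨.ofNat n, hn, h⟩
        · obtain ⟨n, hn, h⟩ := hB.exists_adj a ha b hab
          exact ⟨.negSucc n, hn, h⟩
      intro a b hab
      by_cases ha : a = v
      · obtain ⟨i, hi, h⟩ := hone b a (fun hb => hab.ne (ha.trans hb.symm)) hab.symm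
        exact ⟨i, hi, h.symm⟩
      · exact hone a b ha hab
    refine SimpleGraph.Subgraph.ext ?_ ?_
    · refine eq_univ_of_forall fun u => ?_
      obtain ⟨w, hwu⟩ := hG.exists_ne u
      have : ∃ b, G.Adj u b := by
        by_contra! hno
        exact hwu (hG.connected.of_closed (P := (· = u))
          (fun x y hxy hx => absurd hxy (hx ▸ hno y)) rfl w)
      obtain ⟨b, hub⟩ := this
      obtain ⟨i, hi, h⟩ := hadj u b hub
      simp only [SimpleGraph.Subgraph.verts_iSup, mem_iUnion]
      exact ⟨i, hi, h.fst_mem⟩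
    · ext a b
      refine ⟨fun h => h.adj_sub, fun h => ?_⟩
      obtain ⟨i, hi, h⟩ := hadj a b h
      simp only [SimpleGraph.Subgraph.iSup_adj]
      exact ⟨i, hi, h⟩
  sep := by
    rintro (m | m) hi (n | n) hj hij
    · exact hA.sep m hi n hj (by simp only [Int.ofNat_eq_natCast] at hij; omega)
    · exact absurd hij (by simp only [Int.ofNat_eq_natCast]; omega)
    · refine eq_empty_of_forall_notMem fun u hu => ?_
      obtain ⟨-, rfl, rfl⟩ := hA.eq_of_mem hB hAB hj hi hu.2 hu.1
      exact absurd hij (by decide)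
    · rw [inter_comm]
      exact hB.sep n hj m hi (by omega)
  link := by
    rintro (n | _ | n) hi hi'
    · exact hA.link n hi'
    · refine ⟨v, Subset.antisymm (fun u hu => (hA.eq_of_mem hB hAB hi' hi hu.2 hu.1).1) ?_⟩
      rintro _ rfl
      exact ⟨hB.base_mem, hA.base_mem⟩
    · obtain ⟨w, hw⟩ := hB.link n hi
      exact ⟨w, by rw [inter_comm]; exact hw⟩

theorem NArcConn.isChainGraph_top (hG : NArcConn (GraphRealization G) 4) :
    IsChainGraph G {0} fun _ => ⊤ where
  connected := hG.connected
  ordConnected := ordConnected_singleton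
  nonempty := singleton_nonempty 0
  cover := by simp
  sep := by
    rintro _ rfl _ rfl h
    exact absurd h (by decide)
  link := by
    rintro _ rfl h
    exact absurd h (by decide)

theorem NArcConn.kConnected_two_top (hG : NArcConn (GraphRealization G) 4)
    (hcut : ∀ v, ¬ IsCutVertex G v) : KConnected (⊤ : G.Subgraph).coe 2 := by
  obtain ⟨v⟩ := hG.connected.nonempty
  obtain ⟨w, hwv⟩ := hG.exists_ne v
  refine SimpleGraph.Subgraph.kConnected_two_coe ⟨w, trivial, v, trivial, hwv⟩ ?_ ?_
  · rintro D - ⟨a, ha⟩ hD b -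
    exact hG.connected.of_closed (fun u w huw hu => hD u hu w huw) ha b
  · rintro w - D - ⟨a, ha⟩ hwD hD c -
    by_contra! hc
    have hconn := not_not.1 (hcut w)
    exact hc.1 (hconn.of_closed (P := fun u => (u : V) ∈ D)
      (fun u y huy hu => (hD u hu y huy).resolve_right y.2)
      (a := ⟨a, fun e => hwD (mem_singleton_iff.1 e ▸ ha)⟩) ha ⟨c, hc.2⟩)

theorem NArcConn.nArcConn_top (hG : NArcConn (GraphRealization G) 4) :
    NArcConn (GraphRealization (⊤ : G.Subgraph).coe) 4 :=
  nArcConn_coe_iff.2 fun S hS _ => by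
    obtain ⟨a, b, A, hab, hA, hSA⟩ := nArcConn_iff.1 hG S hS
    exact ⟨a, b, A, hab, hA, fun x _ => ⟨fun _ _ => trivial,
      fun u w huw hu hw => (eq_edge huw hu hw).1⟩, hSA⟩

theorem NArcConn.exists_isChainGraph (hG : NArcConn (GraphRealization G) 4) :
    ∃ (J : Set ℤ) (L : ℤ → G.Subgraph), IsChainGraph G J L ∧
      (∀ i ∈ J, KConnected (L i).coe 2 ∧ NArcConn (GraphRealization (L i).coe) 4) ∧
      (∀ i ∈ J, i - 1 ∈ J → i + 1 ∈ J →
        ∃ (v w : V) (h : G.Adj v w), L i = G.subgraphOfAdj h) ∧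
      (∀ v : V, IsCutVertex G v → ∀ i ∈ J, v ∈ (L i).verts →
        ((L i).neighborSet v).encard ≤ 2) := by
  by_cases hcut : ∃ v, IsCutVertex G v
  · obtain ⟨v, hv⟩ := hcut
    obtain ⟨D, hD⟩ := IsSide.exists_of_isCutVertex hG hv
    obtain ⟨JA, LA, hA⟩ := hD.exists_ray hG
    obtain ⟨JB, LB, hB⟩ := hD.compl.exists_ray hG
    refine ⟨_, _, hA.isChainGraph_biSequence hG hB (disjoint_left.2 fun u hu h => h.1 hu)
      (fun u hu => or_iff_not_imp_left.2 fun h => ⟨h, hu⟩), ?_, ?_, ?_⟩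
    · rintro (n | n) hn
      exacts [hA.good n hn, hB.good n hn]
    · rintro (n | n) - h h'
      exacts [hA.edge n h', hB.edge n h]
    · rintro w hw (n | n) hn
      exacts [hA.degree w hw n hn, hB.degree w hw n hn]
  · push Not at hcut
    refine ⟨_, _, hG.isChainGraph_top, fun i _ => ⟨hG.kConnected_two_top hcut, hG.nArcConn_top⟩,
      ?_, fun v hv => absurd hv (hcut v)⟩
    rintro _ rfl h
    exact absurd h (by decide)

end Decomposition

/-- A graph `G` is 4-arc connected iff it is a chain graph such that:
(1) every link is 2-connected and has 4-arc connected realization; (2) every interior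
link is a single edge; (3) every cut vertex of `G` has degree at most 2 in every link
containing it. -/
theorem statement10 {V : Type*} (G : SimpleGraph V) :
    NArcConn ↥(GraphRealization G) 4 ↔
      ∃ (J : Set ℤ) (L : ℤ → G.Subgraph), IsChainGraph G J L ∧
        (∀ i ∈ J, KConnected (L i).coe 2 ∧ NArcConn ↥(GraphRealization (L i).coe) 4) ∧
        (∀ i ∈ J, i - 1 ∈ J → i + 1 ∈ J →
          ∃ (v w : V) (h : G.Adj v w), L i = G.subgraphOfAdj h) ∧
        (∀ v : V, IsCutVertex G v → ∀ i ∈ J, v ∈ (L i).verts →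
          ((L i).neighborSet v).encard ≤ 2) :=
  ⟨fun hG => hG.exists_isChainGraph, fun ⟨_, _, hL, h1, h2, h3⟩ => hL.nArcConn h1 h2 h3⟩
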